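/- Let X = G⟨c⟩ with G ≅ SD_{8n} (n ≥ 2), ⟨c⟩ cyclic of order m ≥ 2, G ∩ ⟨c⟩ = 1, and let M be the largest subgroup of X with ⟨c⟩ ≤ M ⊆ ⟨a⟩⟨c⟩ (as a subset). Then M has one of the forms ⟨a^i⟩⟨c⟩ for i ∈ {1, 2, 3, 4}, and correspondingly: M_X = M with X/M_X ≅ Z_2; M = ⟨a²⟩⟨c⟩ with M_X = ⟨a²⟩⟨c²⟩ and X/M_X ≅ D_8; M = ⟨a²⟩⟨c⟩ with M_X = ⟨a²⟩⟨c³⟩ and X/M_X ≅ A_4; M = ⟨a⁴⟩⟨c⟩ with M_X = ⟨a⁴⟩⟨c³⟩ and X/M_X ≅ S_4; M = ⟨a⁴⟩⟨c⟩ with M_X = ⟨a⁴⟩⟨c⁴⟩ and X/M_X ≅ (Z_4 × Z_2)·Z_4 of order 32; or M = ⟨a³⟩⟨c⟩ with M_X = ⟨a³⟩⟨c⁴⟩ and X/M_X ≅ S_4. -/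

import Mathlib

open Pointwise Subgroup

namespace SD
universe u
set_option linter.unusedVariables false
set_option linter.style.multiGoal false

structure Pair {X : Type u} [Group X] (A H : Subgroup X) : Prop where
  gA : ∃ a, A = zpowers a
  AH : A ≤ H
  ex : ∃ z ∈ H, z ∉ A
  two : ∀ x ∈ H, ∀ y ∈ H, x ∉ A → y ∉ A → x * y ∈ A

structure PSys {X : Type u} [Group X] (A H C : Subgroup X) : Prop extends Pair A H where
  gC : ∃ c, C = zpowers c
  inv : ∀ h ∈ H, h ∉ A → ∀ x ∈ A, h * x ^ 2 * h⁻¹ = (x ^ 2)⁻¹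
  HC : ∀ x : X, ∃ h ∈ H, ∃ d ∈ C, x = h * d
  dis : ∀ x, x ∈ H → x ∈ C → x = 1
  P : ∀ L : Subgroup X, C ≤ L → (∀ x ∈ L, x ∈ H → x ∈ A) → L ≤ C

structure Sys {X : Type u} [Group X] (A H C : Subgroup X) : Prop extends PSys A H C where
  core : ∀ E : Subgroup X, E ≤ C → E.Normal → E = ⊥

variable {X : Type u} [Group X]

namespace Pair
variable {A H : Subgroup X}

theorem normal (p : Pair A H) {h x : X} (hh : h ∈ H) (hx : x ∈ A) : h * x * h⁻¹ ∈ A := by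
  by_cases hA : h ∈ A
  · exact mul_mem (mul_mem hA hx) (inv_mem hA)
  · refine p.two _ (mul_mem hh (p.AH hx)) _ (inv_mem hh) ?_ ?_
    · intro h'; exact hA ((mul_mem_cancel_right hx).1 h')
    · intro h'; exact hA (inv_mem_iff.1 h')

theorem conj_pow (p : Pair A H) {h : X} (hh : h ∈ H) : ∃ t : ℤ, ∀ x ∈ A, h * x * h⁻¹ = x ^ t := by
  obtain ⟨a, ha⟩ := p.gA
  have h1 : h * a * h⁻¹ ∈ A := p.normal hh (ha ▸ mem_zpowers a)
  rw [ha, mem_zpowers_iff] at h1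
  obtain ⟨t, ht⟩ := h1
  refine ⟨t, fun x hx => ?_⟩
  rw [ha, mem_zpowers_iff] at hx
  obtain ⟨j, rfl⟩ := hx
  rw [← conj_zpow, ← ht, ← zpow_mul, ← zpow_mul, mul_comm]

theorem sub_inv (p : Pair A H) {U : Subgroup X} (hU : U ≤ A) {h x : X} (hh : h ∈ H) (hx : x ∈ U) :
    h * x * h⁻¹ ∈ U := by
  obtain ⟨t, ht⟩ := p.conj_pow hh
  rw [ht x (hU hx)]
  exact zpow_mem hx t

theorem comm (p : Pair A H) {x y : X} (hx : x ∈ A) (hy : y ∈ A) : x * y = y * x := by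
  obtain ⟨a, ha⟩ := p.gA
  rw [ha, mem_zpowers_iff] at hx hy
  obtain ⟨i, rfl⟩ := hx
  obtain ⟨j, rfl⟩ := hy
  rw [← zpow_add, ← zpow_add, add_comm]

theorem relIndex (p : Pair A H) : A.relIndex H = 2 := by
  obtain ⟨z, hz, hzA⟩ := p.ex
  rw [Subgroup.relIndex, index_eq_two_iff]
  refine ⟨⟨z, hz⟩, fun b => ?_⟩
  simp only [mem_subgroupOf, Subgroup.coe_mul]
  by_cases hb : (b : X) ∈ A
  · refine Or.inr ⟨hb, fun h => hzA ((mul_mem_cancel_left hb).1 h)⟩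
  · exact Or.inl ⟨p.two _ b.2 _ hz hb hzA, hb⟩

theorem card (p : Pair A H) : Nat.card H = 2 * Nat.card A := by
  have h1 := (A.subgroupOf H).card_mul_index
  have h2 : (A.subgroupOf H).index = 2 := p.relIndex
  rw [h2, Nat.card_congr (subgroupOfEquivOfLe p.AH).toEquiv] at h1
  omega

theorem sq (p : Pair A H) {h : X} (hh : h ∈ H) : h ^ 2 ∈ A := by
  by_cases hA : h ∈ A
  · exact pow_mem hA 2
  · rw [pow_two]; exact p.two _ hh _ hh hA hA

theorem mul_nmem (p : Pair A H) {x y : X} (hx : x ∈ A) (hy : y ∉ A) : x * y ∉ A := fun h =>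
  hy ((mul_mem_cancel_left hx).1 h)

theorem mul_nmem' (p : Pair A H) {x y : X} (hx : x ∈ A) (hy : y ∉ A) : y * x ∉ A := fun h =>
  hy ((mul_mem_cancel_right hx).1 h)

end Pair

namespace PSys
variable {A H C : Subgroup X}

theorem Ccomm (p : PSys A H C) {x y : X} (hx : x ∈ C) (hy : y ∈ C) : x * y = y * x := by
  obtain ⟨a, ha⟩ := p.gC
  rw [ha, mem_zpowers_iff] at hx hy
  obtain ⟨i, rfl⟩ := hx
  obtain ⟨j, rfl⟩ := hy
  rw [← zpow_add, ← zpow_add, add_comm]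

theorem CH (p : PSys A H C) (x : X) : ∃ d ∈ C, ∃ h ∈ H, x = d * h := by
  obtain ⟨h, hh, d, hd, e⟩ := p.HC x⁻¹
  exact ⟨d⁻¹, inv_mem hd, h⁻¹, inv_mem hh, by rw [← mul_inv_rev, ← e, inv_inv]⟩

theorem uniq (p : PSys A H C) {h h' d d' : X} (hh : h ∈ H) (hh' : h' ∈ H) (hd : d ∈ C)
    (hd' : d' ∈ C) (e : h * d = h' * d') : h = h' ∧ d = d' := by
  have h1 : h'⁻¹ * h = d' * d⁻¹ := by
    rw [inv_mul_eq_iff_eq_mul, ← mul_assoc, ← e]; group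
  have h2 := p.dis _ (mul_mem (inv_mem hh') hh) (h1 ▸ mul_mem hd' (inv_mem hd))
  have h3 : h = h' := (inv_mul_eq_one.1 h2).symm
  subst h3
  exact ⟨rfl, mul_left_cancel e⟩

theorem card (p : PSys A H C) : Nat.card X = 2 * Nat.card A * Nat.card C := by
  rw [← p.toPair.card, ← Nat.card_prod]
  symm
  refine Nat.card_congr (Equiv.ofBijective (fun q : H × C => (q.1 : X) * q.2) ⟨?_, ?_⟩)
  · rintro ⟨⟨h, hh⟩, ⟨d, hd⟩⟩ ⟨⟨h', hh'⟩, ⟨d', hd'⟩⟩ e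
    obtain ⟨rfl, rfl⟩ := p.uniq hh hh' hd hd' e
    rfl
  · intro x
    obtain ⟨h, hh, d, hd, e⟩ := p.HC x
    exact ⟨⟨⟨h, hh⟩, ⟨d, hd⟩⟩, e.symm⟩

/-- normality from invariance -/
theorem normal_of (p : PSys A H C) {U : Subgroup X} (h1 : ∀ h ∈ H, ∀ x ∈ U, h * x * h⁻¹ ∈ U)
    (h2 : ∀ h ∈ C, ∀ x ∈ U, h * x * h⁻¹ ∈ U) : U.Normal := by
  refine ⟨fun x hx g => ?_⟩
  obtain ⟨h, hh, d, hd, rfl⟩ := p.HC g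
  have := h1 h hh _ (h2 d hd x hx)
  convert this using 1; group

theorem P'normal (p : PSys A H C) {U : Subgroup X} (hU : U ≤ A) (hn : U.Normal) : U = ⊥ := by
  have h1 : U ⊔ C ≤ C := by
    refine p.P _ le_sup_right fun x hx hxH => ?_
    rw [← SetLike.mem_coe, Subgroup.normal_mul] at hx
    obtain ⟨v, hv, d, hd, rfl⟩ := hx
    have hv' : v ∈ A := hU hv
    have hd' : d ∈ H := (mul_mem_cancel_left (p.AH hv')).1 hxH
    rw [show d = 1 from p.dis _ hd' hd]; simpa using hv'
  rw [eq_bot_iff]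
  intro v hv
  exact p.dis _ (p.AH (hU hv)) (h1 (mem_sup_left hv))

theorem P' (p : PSys A H C) {U : Subgroup X} (hU : U ≤ A)
    (h2 : ∀ h ∈ C, ∀ x ∈ U, h * x * h⁻¹ ∈ U) : U = ⊥ :=
  p.P'normal hU (p.normal_of (fun h hh x hx => p.toPair.sub_inv hU hh hx) h2)

theorem L5 (p : PSys A H C) {N : Subgroup X} (hN : N.Normal) (hNC : ¬ N ≤ C) :
    ∃ h ∈ H, h ∉ A ∧ ∃ y ∈ N, ∃ d ∈ C, h = y * d := by
  by_contra hcon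
  push Not at hcon
  apply hNC
  refine le_trans le_sup_left (p.P (N ⊔ C) le_sup_right fun x hx hxH => ?_)
  rw [← SetLike.mem_coe, Subgroup.normal_mul] at hx
  obtain ⟨v, hv, d, hd, rfl⟩ := hx
  by_contra hA
  exact hcon _ hxH hA v hv d hd rfl

theorem HconjC (p : PSys A H C) {h g d : X} (hh : h ∈ H) (hd : d ∈ C) (e : h = g * d * g⁻¹) :
    d = 1 := by
  obtain ⟨x, hx, y, hy, rfl⟩ := p.HC g
  have h1 : x⁻¹ * h * x = d := by
    have : y * d = d * y := p.Ccomm hy hd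
    rw [e]
    calc _ = (y * d) * y⁻¹ := by group
      _ = d := by rw [this]; group
  exact p.dis _ (h1 ▸ mul_mem (mul_mem (inv_mem hx) hh) hx) hd

end PSys

theorem closure_conj {S : Set X} {g : X} (h : ∀ s ∈ S, g * s * g⁻¹ ∈ closure S) {x : X}
    (hx : x ∈ closure S) : g * x * g⁻¹ ∈ closure S := by
  induction hx using closure_induction with
  | mem x hx => exact h x hx
  | one => simp
  | mul x y _ _ hx hy =>
    have := mul_mem hx hy
    convert this using 1; group
  | inv x _ hx =>
    have := inv_mem hx
    convert this using 1; group

theorem comm_of_sq {x y : X} (hx : x ^ 2 = 1) (hy : y ^ 2 = 1) (hxy : (x * y) ^ 2 = 1) :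
    x * y = y * x := by
  have h1 : x⁻¹ = x := by rw [inv_eq_iff_mul_eq_one, ← pow_two, hx]
  have h2 : y⁻¹ = y := by rw [inv_eq_iff_mul_eq_one, ← pow_two, hy]
  have h3 : (x * y)⁻¹ = x * y := by rw [inv_eq_iff_mul_eq_one, ← pow_two, hxy]
  rw [← h3, mul_inv_rev, h1, h2]

theorem sq_closure_normal {N : Subgroup X} (hN : N.Normal) :
    (closure {y | ∃ x ∈ N, y = x ^ 2}).Normal := by
  refine ⟨fun x hx g => closure_conj ?_ hx⟩
  rintro _ ⟨x, hx, rfl⟩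
  exact subset_closure ⟨g * x * g⁻¹, hN.conj_mem x hx g, by rw [conj_pow]⟩

theorem zpowers_normal {q : X} (h : ∀ g, g * q * g⁻¹ ∈ zpowers q) : (zpowers q).Normal := by
  refine ⟨fun x hx g => ?_⟩
  rw [mem_zpowers_iff] at hx
  obtain ⟨j, rfl⟩ := hx
  rw [← conj_zpow]
  exact zpow_mem (h g) j

theorem Frob [Finite X] {G H0 C0 : Subgroup X} (hH : H0 ≤ G) (hC : C0 ≤ G)
    (hcard : Nat.card G ≤ Nat.card H0 * Nat.card C0) (dis : ∀ x ∈ H0, x ∈ C0 → x = 1)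
    (fr : ∀ h ∈ H0, h ≠ 1 → ∀ d ∈ C0, h * d * h⁻¹ ∈ C0 → d = 1) :
    ∀ y ∈ G, y ∉ H0 → ∃ h ∈ H0, ∃ d ∈ C0, d ≠ 1 ∧ y = h * d * h⁻¹ := by
  classical
  let F : H0 × C0 → G := fun q => if (q.2 : X) = 1 then ⟨q.1, hH q.1.2⟩ else
    ⟨q.1 * q.2 * (q.1 : X)⁻¹, mul_mem (mul_mem (hH q.1.2) (hC q.2.2)) (inv_mem (hH q.1.2))⟩
  have key : ∀ h ∈ H0, ∀ h' ∈ H0, ∀ d' ∈ C0, h = h' * d' * h'⁻¹ → d' = 1 := by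
    intro h hh h' hh' d' hd' e
    refine dis _ ?_ hd'
    have : d' = h'⁻¹ * h * h' := by rw [e]; group
    rw [this]
    exact mul_mem (mul_mem (inv_mem hh') hh) hh'
  have inj : Function.Injective F := by
    rintro ⟨⟨h, hh⟩, ⟨d, hd⟩⟩ ⟨⟨h', hh'⟩, ⟨d', hd'⟩⟩ e
    simp only [F] at e
    split_ifs at e with h1 h2 h2
    · simp only [Subtype.mk.injEq] at e
      simp_all
    · simp only [Subtype.mk.injEq] at e
      exact absurd (key h hh h' hh' d' hd' e) h2
    · simp only [Subtype.mk.injEq] at e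
      exact absurd (key h' hh' h hh d hd e.symm) h1
    · simp only [Subtype.mk.injEq] at e
      have e2 : (h'⁻¹ * h) * d * (h'⁻¹ * h)⁻¹ = d' := by
        calc _ = h'⁻¹ * (h * d * h⁻¹) * h' := by group
          _ = d' := by rw [e]; group
      have e3 : h'⁻¹ * h = 1 := by
        by_contra hne
        exact h1 (fr _ (mul_mem (inv_mem hh') hh) hne d hd (e2 ▸ hd'))
      have e4 : h = h' := (inv_mul_eq_one.1 e3).symm
      subst e4
      simp at e
      simp [e]
  have bij : Function.Bijective F := by
    refine (Nat.bijective_iff_injective_and_card F).2 ⟨inj, le_antisymm ?_ ?_⟩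
    · exact Nat.card_le_card_of_injective F inj
    · rw [Nat.card_prod]; exact hcard
  intro y hy hyH
  obtain ⟨⟨⟨h, hh⟩, ⟨d, hd⟩⟩, e⟩ := bij.2 ⟨y, hy⟩
  simp only [F] at e
  split_ifs at e with h1
  · simp only [Subtype.mk.injEq] at e
    exact absurd (e ▸ hh) hyH
  · simp only [Subtype.mk.injEq] at e
    exact ⟨h, hh, d, hd, h1, e.symm⟩

theorem FrobN [Finite X] {G H0 C0 : Subgroup X} (hH : H0 ≤ G) (hC : C0 ≤ G)
    (hcard : Nat.card G ≤ Nat.card H0 * Nat.card C0) (dis : ∀ x ∈ H0, x ∈ C0 → x = 1)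
    (fr : ∀ h ∈ H0, h ≠ 1 → ∀ d ∈ C0, h * d * h⁻¹ ∈ C0 → d = 1)
    (cj : ∀ h ∈ H0, ∀ g, ∀ d ∈ C0, h = g * d * g⁻¹ → d = 1) :
    ∀ g ∈ G, ∀ h ∈ H0, g * h * g⁻¹ ∈ H0 := by
  intro g hg h hh
  by_contra hcon
  obtain ⟨h1, hh1, d, hd, hd1, e⟩ := Frob hH hC hcard dis fr _
    (mul_mem (mul_mem hg (hH hh)) (inv_mem hg)) hcon
  refine hd1 (cj h hh (g⁻¹ * h1) d hd ?_)
  calc h = g⁻¹ * (g * h * g⁻¹) * g := by group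
    _ = _ := by rw [e]; group

theorem pow_card_mem {E : Subgroup X} {d : X} (hd : d ∈ E) : d ^ Nat.card E = 1 :=
  orderOf_dvd_iff_pow_eq_one.1 (Subgroup.orderOf_dvd_natCard E hd)

theorem cyc_mem [Finite X] {C E : Subgroup X} (gC : ∃ c, C = zpowers c) (hE : E ≤ C) {x : X}
    (hx : x ∈ C) (hx1 : x ^ Nat.card E = 1) : x ∈ E := by
  classical
  obtain ⟨c, rfl⟩ := gC
  have := Fintype.ofFinite (zpowers c)
  have h1 := IsCyclic.card_pow_eq_one_le (α := zpowers c) (n := Nat.card E) Nat.card_pos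
  let S : Finset (zpowers c) := Finset.univ.filter fun y => (y : X) ∈ E
  have hS : S.card = Nat.card E := by
    rw [← Nat.card_congr (subgroupOfEquivOfLe hE).toEquiv, Nat.card_eq_fintype_card,
      Fintype.card_subtype]
    simp only [S, mem_subgroupOf]
  have hsub : S ⊆ Finset.univ.filter fun y : zpowers c => y ^ Nat.card E = 1 := by
    intro y hy
    simp only [S, Finset.mem_filter, Finset.mem_univ, true_and] at hy ⊢
    ext
    simpa using pow_card_mem hy
  have heq := Finset.eq_of_subset_of_card_le hsub (by rw [hS]; exact h1)
  have : (⟨x, hx⟩ : zpowers c) ∈ S := by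
    rw [heq]
    simp only [Finset.mem_filter, Finset.mem_univ, true_and]
    ext; simpa using hx1
  simpa [S] using this

theorem cyc_conj [Finite X] {C E : Subgroup X} (gC : ∃ c, C = zpowers c) (hE : E ≤ C) {x d : X}
    (hd : d ∈ E) (hx : x * d * x⁻¹ ∈ C) : x * d * x⁻¹ ∈ E := by
  refine cyc_mem gC hE hx ?_
  rw [conj_pow, pow_card_mem hd]; simp

namespace PSys
variable {A H C : Subgroup X}

theorem sqA (p : PSys A H C) {N : Subgroup X} (hN : N.Normal) (h : ∀ x ∈ N, x ^ 2 ∈ A) :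
    ∀ x ∈ N, x ^ 2 = 1 := by
  have := p.P'normal (U := closure {y | ∃ x ∈ N, y = x ^ 2})
    (by rw [closure_le]; rintro _ ⟨x, hx, rfl⟩; exact h x hx) (sq_closure_normal hN)
  intro x hx
  rw [← mem_bot, ← this]
  exact subset_closure ⟨x, hx, rfl⟩
end PSys
namespace Sys
variable {A H C : Subgroup X}
theorem sqC (p : Sys A H C) {N : Subgroup X} (hN : N.Normal) (h : ∀ x ∈ N, x ^ 2 ∈ C) :
    ∀ x ∈ N, x ^ 2 = 1 := by
  have := p.core (closure {y | ∃ x ∈ N, y = x ^ 2})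
    (by rw [closure_le]; rintro _ ⟨x, hx, rfl⟩; exact h x hx) (sq_closure_normal hN)
  intro x hx
  rw [← mem_bot, ← this]
  exact subset_closure ⟨x, hx, rfl⟩

theorem core_elt (p : Sys A H C) {q : X} (hq : q ∈ C) (h : ∀ g, g * q * g⁻¹ ∈ zpowers q) :
    q = 1 := by
  have := p.core (zpowers q) (by rwa [zpowers_le]) (zpowers_normal h)
  rwa [zpowers_eq_bot] at this
end Sys

end SD

namespace SD
universe u
set_option linter.unusedVariables false
set_option linter.style.multiGoal false
variable {X : Type u} [Group X]

/-- the trivial intersection property of `C` relative to `B` -/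
def TIp (C B : Subgroup X) : Prop := ∀ x, x ∉ B → ∀ d ∈ C, x * d * x⁻¹ ∈ C → d = 1

theorem TI0 [Finite X] {C B : Subgroup X} (gC : ∃ c, C = zpowers c)
    (hB : ∀ E : Subgroup X, E ≤ C → ∀ h ∈ B, ∀ x ∈ E, h * x * h⁻¹ ∈ E)
    (hmax : ∀ L, B ≤ L → L = B ∨ L = ⊤)
    (core : ∀ E : Subgroup X, E ≤ C → E.Normal → E = ⊥) : TIp C B := by
  intro x hx d hd hxd
  let E : Subgroup X := C ⊓ C.comap (MulAut.conj x).toMonoidHom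
  have hE : E ≤ C := inf_le_left
  have h1 : x ∈ normalizer (E : Set X) := by
    refine mem_normalizer_fintype fun n hn => ?_
    refine cyc_conj gC hE hn ?_
    exact hn.2
  have h2 : B ≤ normalizer (E : Set X) := fun h hh =>
    mem_normalizer_fintype fun n hn => hB E hE h hh n hn
  rcases hmax _ h2 with h3 | h3
  · exact absurd (h3 ▸ h1) hx
  · have := core E hE (normalizer_eq_top_iff.1 h3)
    have h4 : d ∈ E := ⟨hd, hxd⟩
    rwa [this, mem_bot] at h4

theorem Pair.TI [Finite X] {C B : Subgroup X} (p : Pair C B)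
    (hmax : ∀ L, B ≤ L → L = B ∨ L = ⊤)
    (core : ∀ E : Subgroup X, E ≤ C → E.Normal → E = ⊥) : TIp C B :=
  TI0 p.gA (fun E hE h hh x hx => p.sub_inv hE hh hx) hmax core

theorem card_compl [Finite X] (B : Subgroup X) :
    Nat.card X = Nat.card B + Nat.card {x : X // x ∉ B} := by
  classical
  have := Nat.card_congr (Equiv.sumCompl (fun x : X => x ∈ B))
  rw [← this, Nat.card_sum]

theorem Div [Finite X] {C B : Subgroup X} (hCB : C ≤ B) (ti : TIp C B) :
    ∃ r, Nat.card X = Nat.card B + r * (Nat.card C * Nat.card C) := by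
  let act : MulAction (C × C) {x : X // x ∉ B} :=
    { smul := fun g x => ⟨g.1 * x * (g.2 : X)⁻¹, fun h => x.2 (by
        have h2 := mul_mem (mul_mem (inv_mem (hCB g.1.2)) h) (hCB g.2.2)
        have e : (g.1 : X)⁻¹ * (g.1 * x * (g.2 : X)⁻¹) * g.2 = x := by group
        rwa [e] at h2)⟩
      one_smul := fun x => Subtype.ext (by
        change ((1 : C × C).1 : X) * x * ((1 : C × C).2 : X)⁻¹ = x
        simp)
      mul_smul := fun g h x => Subtype.ext (by
        change ((g * h).1 : X) * x * ((g * h).2 : X)⁻¹ =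
          g.1 * (h.1 * x * (h.2 : X)⁻¹) * (g.2 : X)⁻¹
        simp [mul_assoc]) }
  have hst : ∀ b : {x : X // x ∉ B}, MulAction.stabilizer (C × C) b = ⊥ := by
    intro b
    rw [eq_bot_iff]
    intro g hg
    rw [MulAction.mem_stabilizer_iff] at hg
    have e : (g.1 : X) * b * (g.2 : X)⁻¹ = b := congrArg Subtype.val hg
    have e1 : (b : X) * g.2 * (b : X)⁻¹ = g.1 := by
      rw [mul_inv_eq_iff_eq_mul] at e ⊢; exact e.symm
    have e2 := ti b b.2 _ g.2.2 (e1 ▸ g.1.2)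
    have e3 : (g.1 : X) = 1 := by rw [← e1, e2]; simp
    rw [mem_bot]
    exact Prod.ext (Subtype.ext e3) (Subtype.ext e2)
  have := Nat.card_congr (MulAction.selfEquivOrbitsQuotientProd hst)
  rw [Nat.card_prod, Nat.card_prod] at this
  exact ⟨_, by rw [card_compl B, this]⟩

theorem invol_uniq [Finite X] {C : Subgroup X} (gC : ∃ c, C = zpowers c) {c0 d : X} (h0 : c0 ∈ C)
    (h1 : c0 ≠ 1) (h2 : c0 ^ 2 = 1) (hd : d ∈ C) (hd2 : d ^ 2 = 1) : d = 1 ∨ d = c0 := by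
  have ho : orderOf c0 = 2 := orderOf_eq_prime h2 h1
  have h3 := cyc_mem gC (E := zpowers c0) (by rwa [zpowers_le]) hd
    (by rw [Nat.card_zpowers, ho, hd2])
  rw [mem_zpowers_iff] at h3
  obtain ⟨j, rfl⟩ := h3
  have h2' : c0 ^ (2 : ℤ) = 1 := by exact_mod_cast h2
  rcases Int.even_or_odd' j with ⟨k, rfl | rfl⟩
  · left; rw [zpow_mul, h2', one_zpow]
  · right; rw [zpow_add, zpow_mul, h2', one_zpow, one_mul, zpow_one]

theorem TIcore [Finite X] {C B : Subgroup X} (p : Pair C B) (ti : TIp C B) {c0 : X} (h0 : c0 ∈ C)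
    (h1 : c0 ≠ 1) (h2 : c0 ^ 2 = 1) (all : ∀ x, x * c0 * x⁻¹ ∈ B) : B.index ≤ 3 := by
  have sqc : ∀ x, (x * c0 * x⁻¹) ^ 2 = 1 := fun x => by rw [conj_pow, h2]; simp
  have nec : ∀ x, x * c0 * x⁻¹ ≠ 1 := fun x h => h1 (by simpa using h)
  have cen : ∀ b ∈ B, b * c0 * b⁻¹ = c0 := fun b hb =>
    (invol_uniq p.gA h0 h1 h2 (p.normal hb h0) (sqc b)).resolve_left (nec b)
  have selfc : ∀ x, x * c0 * x⁻¹ ∈ C → x ∈ B := by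
    intro x hx
    by_contra hxB
    exact h1 (ti x hxB c0 h0 hx)
  by_cases hB : ∃ x0, x0 ∉ B
  · obtain ⟨x0, hx0⟩ := hB
    set e := x0 * c0 * x0⁻¹ with he
    have heC : e ∉ C := fun h => hx0 (selfc _ h)
    have main : ∀ x, x * c0 * x⁻¹ ∈ ({c0, e, e * c0} : Set X) := by
      intro x
      by_cases hx : x ∈ B
      · rw [cen x hx]; simp
      · have hf : x * c0 * x⁻¹ ∉ C := fun h => hx (selfc _ h)
        set f := x * c0 * x⁻¹ with hf'
        have hef : e * f ∈ C := p.two _ (all x0) _ (all x) heC hf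
        have hcomm : e * f = f * e := by
          have h3 := cen _ (all (x0⁻¹ * x))
          have h4 : (x0⁻¹ * x) * c0 * (x0⁻¹ * x)⁻¹ = x0⁻¹ * f * x0 := by rw [hf']; group
          rw [h4] at h3
          have h5 : f * e * f⁻¹ = e := by
            calc f * e * f⁻¹ = x0 * ((x0⁻¹ * f * x0) * c0 * (x0⁻¹ * f * x0)⁻¹) * x0⁻¹ := by
                  rw [he]; group
              _ = e := by rw [h3]
          rw [mul_inv_eq_iff_eq_mul] at h5
          exact h5.symm
        have hsq : (e * f) ^ 2 = 1 := by
          rw [(show Commute e f from hcomm).mul_pow, sqc, sqc, one_mul]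
        have he1 : e * e = 1 := by rw [← pow_two]; exact sqc x0
        have he2 : f = e * (e * f) := by rw [← mul_assoc, he1, one_mul]
        rcases invol_uniq p.gA h0 h1 h2 hef hsq with h | h
        · rw [h] at he2; rw [he2]; simp
        · rw [h] at he2; rw [he2]; simp
    let φ : X ⧸ B → ({c0, e, e * c0} : Set X) := Quotient.lift (fun x => ⟨x * c0 * x⁻¹, main x⟩) (by
      intro x y hxy
      have hxy' : x⁻¹ * y ∈ B := QuotientGroup.leftRel_apply.1 hxy
      ext
      have := cen _ hxy'
      calc x * c0 * x⁻¹ = x * ((x⁻¹ * y) * c0 * (x⁻¹ * y)⁻¹) * x⁻¹ := by rw [this]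
        _ = _ := by group)
    have hφ : Function.Injective φ := by
      intro x y
      induction x using QuotientGroup.induction_on with | H x => ?_
      induction y using QuotientGroup.induction_on with | H y => ?_
      intro h
      have h' : x * c0 * x⁻¹ = y * c0 * y⁻¹ := congrArg Subtype.val h
      rw [QuotientGroup.eq]
      apply selfc
      have : (x⁻¹ * y) * c0 * (x⁻¹ * y)⁻¹ = x⁻¹ * (y * c0 * y⁻¹) * x := by group
      rw [this, ← h']
      have : x⁻¹ * (x * c0 * x⁻¹) * x = c0 := by group
      rwa [this]
    have := Nat.card_le_card_of_injective φ hφ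
    rw [Subgroup.index]
    refine this.trans ?_
    rw [Nat.card_coe_set_eq]
    exact Set.ncard_insert_le _ _ |>.trans (by
      have := Set.ncard_insert_le e {e * c0}
      rw [Set.ncard_singleton] at this; omega)
  · push Not at hB
    rw [(eq_top_iff' B).2 hB, index_top]; norm_num

theorem BigB [Finite X] {C B : Subgroup X} (p : Pair C B) (ti : TIp C B) (hB : ∃ x, x ∉ B)
    (hcard : Nat.card X < Nat.card C * Nat.card B) : Nat.card X ≤ 3 * Nat.card B := by
  have h1 : ∀ x : X, ∃ d ∈ C, d ≠ 1 ∧ x * d * x⁻¹ ∈ B := by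
    intro x
    by_contra hcon
    push Not at hcon
    have : Function.Injective (fun q : C × B => (q.2 : X) * x * q.1) := by
      rintro ⟨⟨d, hd⟩, ⟨b, hb⟩⟩ ⟨⟨d', hd'⟩, ⟨b', hb'⟩⟩ e
      simp only at e
      have e1 : x * (d * d'⁻¹) * x⁻¹ = b⁻¹ * b' := by
        calc _ = b⁻¹ * (b * x * d) * d'⁻¹ * x⁻¹ := by group
          _ = _ := by rw [e]; group
      have e2 : d * d'⁻¹ = 1 := by
        by_contra hne
        exact hcon _ (mul_mem hd (inv_mem hd')) hne (e1 ▸ mul_mem (inv_mem hb) hb')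
      have e3 : d = d' := mul_inv_eq_one.1 e2
      subst e3
      have e4 : b = b' := by simpa using e
      subst e4
      rfl
    have := Nat.card_le_card_of_injective _ this
    rw [Nat.card_prod] at this
    omega
  have h2 : ∀ x, x ∉ B → ∀ d ∈ C, x * d * x⁻¹ ∈ B → d ^ 2 = 1 := by
    intro x hx d hd hxd
    have := p.sq hxd
    rw [conj_pow] at this
    exact ti x hx _ (pow_mem hd 2) this
  obtain ⟨x0, hx0⟩ := hB
  obtain ⟨c0, hc0, hc1, hxc⟩ := h1 x0
  have hc2 := h2 x0 hx0 c0 hc0 hxc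
  have := TIcore p ti hc0 hc1 hc2 (by
    intro x
    by_cases hx : x ∈ B
    · exact mul_mem (mul_mem hx (p.AH hc0)) (inv_mem hx)
    · obtain ⟨d, hd, hd1, hxd⟩ := h1 x
      have := (invol_uniq p.gA hc0 hc1 hc2 hd (h2 x hx d hd hxd)).resolve_left hd1
      rwa [← this])
  rw [← B.card_mul_index, mul_comm 3]
  exact Nat.mul_le_mul_left _ this
end SD

namespace SD
universe u
set_option linter.unusedVariables false
set_option linter.style.multiGoal false
set_option linter.unusedSimpArgs false
variable {X : Type u} [Group X]

theorem cyc_sub {C E : Subgroup X} (gC : ∃ c, C = zpowers c) (hE : E ≤ C) :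
    ∃ e, E = zpowers e := by
  obtain ⟨c, rfl⟩ := gC
  obtain ⟨⟨g, hg⟩, h⟩ := (Subgroup.isCyclic_iff_exists_zpowers_eq_top (E.subgroupOf (zpowers c))).1
    inferInstance
  refine ⟨g, ?_⟩
  have := congrArg (Subgroup.map (zpowers c).subtype) h
  rw [MonoidHom.map_zpowers, subgroupOf_map_subtype, inf_of_le_left hE] at this
  exact this.symm

theorem cyc_subgroupOf {C L : Subgroup X} (gC : ∃ c, C = zpowers c) :
    ∃ e, C.subgroupOf L = zpowers e := by
  obtain ⟨e, he⟩ := cyc_sub gC (inf_le_left : C ⊓ L ≤ C)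
  have heL : e ∈ C ⊓ L := he ▸ mem_zpowers e
  refine ⟨⟨e, heL.2⟩, ?_⟩
  ext ⟨x, hx⟩
  rw [mem_subgroupOf]
  have : x ∈ C ↔ x ∈ C ⊓ L := by simp [hx]
  rw [this, he, mem_zpowers_iff, mem_zpowers_iff]
  simp [Subtype.ext_iff]

namespace PSys
variable {A H C : Subgroup X}

theorem restrict (p : PSys A H C) {L : Subgroup X} (hL : C ≤ L) (hLC : ¬ L ≤ C) :
    PSys (A.subgroupOf L) (H.subgroupOf L) (C.subgroupOf L) where
  gA := cyc_subgroupOf p.gA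
  AH := fun x hx => p.AH hx
  ex := by
    by_contra hcon
    push Not at hcon
    refine hLC (p.P L hL fun x hx hxH => ?_)
    exact hcon ⟨x, hx⟩ hxH
  two := fun x hx y hy hxA hyA => p.two x hx y hy hxA hyA
  gC := cyc_subgroupOf p.gC
  inv := fun h hh hA x hx => Subtype.ext (p.inv h hh hA x hx)
  HC := by
    rintro ⟨x, hx⟩
    obtain ⟨h, hh, d, hd, rfl⟩ := p.HC x
    have hhL : h ∈ L := (mul_mem_cancel_right (hL hd)).1 hx
    exact ⟨⟨h, hhL⟩, hh, ⟨d, hL hd⟩, hd, rfl⟩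
  dis := fun x hx hxC => Subtype.ext (p.dis x hx hxC)
  P := by
    intro L' hCL' hLA
    have h1 := p.P (L'.map L.subtype) (by
      intro d hd
      exact ⟨⟨d, hL hd⟩, hCL' hd, rfl⟩) (by
      rintro _ ⟨x, hx, rfl⟩ hxH
      exact hLA x hx hxH)
    intro x hx
    exact h1 ⟨x, hx, rfl⟩

section
variable {Y : Type u} [Group Y] (f : X →* Y)

theorem inj_of (p : PSys A H C) (hf : ∀ x, f x = 1 → x ∈ C) {x y : X} (hx : x ∈ H) (hy : y ∈ H)
    (h : f x = f y) : x = y := by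
  have h1 : f (x * y⁻¹) = 1 := by rw [map_mul, map_inv, h, mul_inv_cancel]
  have := p.dis _ (mul_mem hx (inv_mem hy)) (hf _ h1)
  exact mul_inv_eq_one.1 this

theorem mapC_iff (hf : ∀ x, f x = 1 → x ∈ C) {x : X} : f x ∈ C.map f ↔ x ∈ C := by
  constructor
  · rintro ⟨d, hd, e⟩
    have h1 : f (d⁻¹ * x) = 1 := by rw [map_mul, map_inv, e, inv_mul_cancel]
    exact (mul_mem_cancel_left (inv_mem hd)).1 (hf _ h1)
  · exact fun h => ⟨x, h, rfl⟩

theorem mapA_iff (p : PSys A H C) (hf : ∀ x, f x = 1 → x ∈ C) {x : X} (hx : x ∈ H) :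
    f x ∈ A.map f ↔ x ∈ A := by
  constructor
  · rintro ⟨d, hd, e⟩
    rw [← p.inj_of f hf (p.AH hd) hx e]; exact hd
  · exact fun h => ⟨x, h, rfl⟩

theorem quot (p : PSys A H C) (hs : Function.Surjective f) (hf : ∀ x, f x = 1 → x ∈ C) :
    PSys (A.map f) (H.map f) (C.map f) where
  gA := by obtain ⟨a, rfl⟩ := p.gA; exact ⟨f a, by rw [MonoidHom.map_zpowers]⟩
  AH := map_mono p.AH
  ex := by
    obtain ⟨z, hz, hzA⟩ := p.ex
    exact ⟨f z, ⟨z, hz, rfl⟩, fun h => hzA ((p.mapA_iff f hf hz).1 h)⟩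
  two := by
    rintro _ ⟨x, hx, rfl⟩ _ ⟨y, hy, rfl⟩ hxA hyA
    rw [p.mapA_iff f hf hx] at hxA
    rw [p.mapA_iff f hf hy] at hyA
    exact ⟨x * y, p.two x hx y hy hxA hyA, map_mul f x y⟩
  gC := by obtain ⟨a, rfl⟩ := p.gC; exact ⟨f a, by rw [MonoidHom.map_zpowers]⟩
  inv := by
    rintro _ ⟨h, hh, rfl⟩ hA _ ⟨x, hx, rfl⟩
    rw [p.mapA_iff f hf hh] at hA
    have := congrArg f (p.inv h hh hA x hx)
    simpa using this
  HC := by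
    intro y
    obtain ⟨x, rfl⟩ := hs y
    obtain ⟨h, hh, d, hd, rfl⟩ := p.HC x
    exact ⟨f h, ⟨h, hh, rfl⟩, f d, ⟨d, hd, rfl⟩, map_mul f h d⟩
  dis := by
    rintro _ ⟨x, hx, rfl⟩ hxC
    rw [mapC_iff f hf] at hxC
    rw [p.dis x hx hxC, map_one]
  P := by
    intro L' hC hA
    have := p.P (L'.comap f) (map_le_iff_le_comap.1 hC) (by
      intro x hx hxH
      exact (p.mapA_iff f hf hxH).1 (hA _ hx ⟨x, hxH, rfl⟩))
    intro y hy
    obtain ⟨x, rfl⟩ := hs y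
    exact ⟨x, this hy, rfl⟩
end

theorem quotSys (p : PSys A H C) :
    Sys (A.map (QuotientGroup.mk' C.normalCore)) (H.map (QuotientGroup.mk' C.normalCore))
      (C.map (QuotientGroup.mk' C.normalCore)) where
  toPSys := p.quot _ (QuotientGroup.mk'_surjective _) (fun x hx => by
    rw [QuotientGroup.mk'_apply, QuotientGroup.eq_one_iff] at hx
    exact normalCore_le _ hx)
  core := by
    have hf : ∀ x, QuotientGroup.mk' C.normalCore x = 1 → x ∈ C := fun x hx => by
      rw [QuotientGroup.mk'_apply, QuotientGroup.eq_one_iff] at hx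
      exact normalCore_le _ hx
    intro E hE hn
    have h1 : E.comap (QuotientGroup.mk' C.normalCore) ≤ C := fun x hx =>
      (mapC_iff _ hf).1 (hE hx)
    have h2 := (normal_le_normalCore (H := C) (N := E.comap (QuotientGroup.mk' C.normalCore))).2 h1
    rw [eq_bot_iff]
    intro y hy
    obtain ⟨x, rfl⟩ := QuotientGroup.mk'_surjective _ y
    rw [mem_bot, QuotientGroup.mk'_apply, QuotientGroup.eq_one_iff]
    exact h2 hy

theorem reduction [Finite X] (p : PSys A H C) {L : Subgroup X} (hL : C ≤ L) (hLC : ¬ L ≤ C) :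
    ∃ (Y : Type u) (_ : Group Y) (_ : Finite Y) (f : L →* Y), Function.Surjective f ∧
      (∀ x, f x = 1 → (x : X) ∈ C) ∧ Sys ((A.subgroupOf L).map f) ((H.subgroupOf L).map f)
        ((C.subgroupOf L).map f) := by
  refine ⟨L ⧸ (C.subgroupOf L).normalCore, inferInstance, inferInstance,
    QuotientGroup.mk' _, QuotientGroup.mk'_surjective _, fun x hx => ?_,
    (p.restrict hL hLC).quotSys⟩
  rw [QuotientGroup.mk'_apply, QuotientGroup.eq_one_iff] at hx
  exact normalCore_le (C.subgroupOf L) hx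
end PSys

def Cond2 (A C : Subgroup X) (c : X) : Prop := ∃ u ∈ A, u ≠ 1 ∧ u ^ 2 = 1 ∧
  (∀ x ∈ closure {y | ∃ d ∈ C, y = d * u * d⁻¹}, x ^ 2 ∈ C) ∧
  u * (c * u * c⁻¹) * (c ^ 2 * u * (c ^ 2)⁻¹) ∈ C

def CondD8 (A C : Subgroup X) (c : X) : Prop := ∃ u ∈ A, u ≠ 1 ∧ u ^ 2 = 1 ∧
  (∀ x ∈ closure {y | ∃ d ∈ C, y = d * u * d⁻¹}, x ^ 2 ∈ C) ∧
  u * (c ^ 2 * u * (c ^ 2)⁻¹) ∈ C ∧ u * (c * u * c⁻¹) ∉ C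

def Cond34 (A C : Subgroup X) (c : X) : Prop := ∃ s ∈ A, s ^ 3 = 1 ∧ s ≠ 1 ∧
  c ^ 2 * s * (c ^ 2)⁻¹ ∉ zpowers s ∧ (c⁻¹ * s * c) * s * (c⁻¹ * s * c)⁻¹ ∉ zpowers s

section
variable {A H C L : Subgroup X} {Y : Type u} [Group Y] {f : L →* Y}

theorem liftC_iff (hf : ∀ x, f x = 1 → (x : X) ∈ C) {x : L} :
    f x ∈ (C.subgroupOf L).map f ↔ (x : X) ∈ C :=
  PSys.mapC_iff f (C := C.subgroupOf L) hf

theorem lift_closure (hL : C ≤ L) {u : L} {x : X}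
    (hx : x ∈ closure {y | ∃ d ∈ C, y = d * (u : X) * d⁻¹}) :
    ∃ hx : x ∈ L, f ⟨x, hx⟩ ∈ closure {y | ∃ d ∈ (C.subgroupOf L).map f, y = d * f u * d⁻¹} := by
  induction hx using closure_induction with
  | mem x hx =>
    obtain ⟨d, hd, rfl⟩ := hx
    refine ⟨mul_mem (mul_mem (hL hd) u.2) (inv_mem (hL hd)), subset_closure
      ⟨f ⟨d, hL hd⟩, ⟨⟨d, hL hd⟩, hd, rfl⟩, ?_⟩⟩
    rw [← map_inv, ← map_mul, ← map_mul]
    rfl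
  | one => exact ⟨one_mem _, by
      have : f ⟨1, one_mem _⟩ = 1 := map_one f
      rw [this]; exact one_mem _⟩
  | mul x y _ _ hx hy =>
    obtain ⟨hx, hx'⟩ := hx
    obtain ⟨hy, hy'⟩ := hy
    refine ⟨mul_mem hx hy, ?_⟩
    have := mul_mem hx' hy'
    rw [← map_mul] at this
    exact this
  | inv x _ hx =>
    obtain ⟨hx, hx'⟩ := hx
    refine ⟨inv_mem hx, ?_⟩
    have := inv_mem hx'
    rw [← map_inv] at this
    exact this

theorem lift_u (p : PSys A H C) (hL : C ≤ L) (hf : ∀ x, f x = 1 → (x : X) ∈ C) {u : L}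
    (huA : (u : X) ∈ A) (hu2 : f u ^ 2 = 1) : (u : X) ^ 2 = 1 := by
  rw [← map_pow] at hu2
  have := hf _ hu2
  exact p.dis _ (pow_mem (p.AH huA) 2) this

theorem lift_cl (hL : C ≤ L) (hf : ∀ x, f x = 1 → (x : X) ∈ C) {u : L}
    (h : ∀ x ∈ closure {y | ∃ d ∈ (C.subgroupOf L).map f, y = d * f u * d⁻¹},
      x ^ 2 ∈ (C.subgroupOf L).map f) :
    ∀ x ∈ closure {y | ∃ d ∈ C, y = d * (u : X) * d⁻¹}, x ^ 2 ∈ C := by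
  intro x hx
  obtain ⟨hxL, hx'⟩ := lift_closure (f := f) hL hx
  have := h _ hx'
  rw [← map_pow, liftC_iff hf] at this
  exact this

theorem Cond2_lift (p : PSys A H C) (hL : C ≤ L) (hf : ∀ x, f x = 1 → (x : X) ∈ C) {c : X}
    (hc : c ∈ L) (h : Cond2 ((A.subgroupOf L).map f) ((C.subgroupOf L).map f) (f ⟨c, hc⟩)) :
    Cond2 A C c := by
  obtain ⟨_, ⟨u, hu, rfl⟩, hu1, hu2, hcl, h3⟩ := h
  refine ⟨u, hu, fun h => hu1 ?_, lift_u p hL hf hu hu2, lift_cl hL hf hcl, ?_⟩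
  · rw [show u = 1 from Subtype.ext h, map_one]
  · simp only [← map_inv, ← map_mul, ← map_pow] at h3
    rw [liftC_iff hf] at h3
    exact h3

theorem CondD8_lift (p : PSys A H C) (hL : C ≤ L) (hf : ∀ x, f x = 1 → (x : X) ∈ C) {c : X}
    (hc : c ∈ L) (h : CondD8 ((A.subgroupOf L).map f) ((C.subgroupOf L).map f) (f ⟨c, hc⟩)) :
    CondD8 A C c := by
  obtain ⟨_, ⟨u, hu, rfl⟩, hu1, hu2, hcl, h3, h4⟩ := h
  refine ⟨u, hu, fun h => hu1 ?_, lift_u p hL hf hu hu2, lift_cl hL hf hcl, ?_, ?_⟩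
  · rw [show u = 1 from Subtype.ext h, map_one]
  · simp only [← map_inv, ← map_mul, ← map_pow] at h3
    rw [liftC_iff hf] at h3
    exact h3
  · simp only [← map_inv, ← map_mul, ← map_pow] at h4
    rw [liftC_iff hf] at h4
    exact h4

theorem lift_zp {s x : L} (h : (x : X) ∈ zpowers (s : X)) : f x ∈ zpowers (f s) := by
  rw [mem_zpowers_iff] at h ⊢
  obtain ⟨j, hj⟩ := h
  refine ⟨j, ?_⟩
  rw [← map_zpow]
  congr 1
  exact Subtype.ext hj

theorem Cond34_lift [Finite X] (p : PSys A H C) (hL : C ≤ L) (hf : ∀ x, f x = 1 → (x : X) ∈ C) {c : X}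
    (hs : Function.Surjective f)
    (q : Sys ((A.subgroupOf L).map f) ((H.subgroupOf L).map f) ((C.subgroupOf L).map f))
    (hgc : C = zpowers c)
    (hc : c ∈ L) (hc4 : f ⟨c, hc⟩ ^ 4 = 1) (hc1 : f ⟨c, hc⟩ ≠ 1)
    (h : Cond34 ((A.subgroupOf L).map f) ((C.subgroupOf L).map f) (f ⟨c, hc⟩)) :
    ∃ s ∈ A, s ^ 3 = 1 ∧ s ≠ 1 ∧
  c ^ 2 * s * (c ^ 2)⁻¹ ∉ zpowers s ∧ (c⁻¹ * s * c) * s * (c⁻¹ * s * c)⁻¹ ∉ zpowers s ∧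
   c ^ 4 * s = s * c ^ 4 := by
  obtain ⟨_, ⟨s, hsA, rfl⟩, hs3, hs1, h3, h4⟩ := h
  have hsA' : (s : X) ∈ A := hsA
  have hs3' : (s : X) ^ 3 = 1 := by
    rw [← map_pow] at hs3
    exact p.dis _ (pow_mem (p.AH hsA) 3) (hf _ hs3)
  refine ⟨s, hsA, hs3', fun h => hs1 ?_, fun h => h3 ?_, fun h => h4 ?_, ?_⟩
  · rw [show s = 1 from Subtype.ext h, map_one]
  · simp only [← map_inv, ← map_mul, ← map_pow]
    exact lift_zp h
  · simp only [← map_inv, ← map_mul, ← map_pow]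
    exact lift_zp h
  · set W : Subgroup L := centralizer (f.ker : Set L) with hW
    have hWn : W.Normal := inferInstance
    have hc4' : (⟨c, hc⟩ : L) ^ 4 ∈ f.ker := by rw [MonoidHom.mem_ker, map_pow]; exact hc4
    have hCW : C.subgroupOf L ≤ W := by
      intro d hd
      rw [hW, mem_centralizer_iff]
      intro x hx
      exact Subtype.ext (p.Ccomm (hf x hx) hd)
    have hne : ¬ W ≤ C.subgroupOf L := by
      intro hle
      have heq : W = C.subgroupOf L := le_antisymm hle hCW
      have hn : ((C.subgroupOf L).map f).Normal := by
        rw [← heq]; exact hWn.map f hs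
      have := q.core _ le_rfl hn
      have h5 : f ⟨c, hc⟩ ∈ (C.subgroupOf L).map f :=
        ⟨⟨c, hc⟩, by rw [SetLike.mem_coe, mem_subgroupOf, hgc]; exact mem_zpowers c, rfl⟩
      rw [this, mem_bot] at h5
      exact hc1 h5
    have hex : ∃ h ∈ W, (h : X) ∈ H ∧ (h : X) ∉ A := by
      by_contra hcon
      push Not at hcon
      apply hne
      have hLC : ¬ L ≤ C := by
        intro hle
        apply hne
        intro x hx
        exact hle x.2
      exact (p.restrict hL hLC).P W hCW hcon
    obtain ⟨h, hhW, hhH, hhA⟩ := hex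
    have e1 : (h : X) * s * (h : X)⁻¹ = (s : X)⁻¹ := by
      have := p.inv h hhH hhA (s ^ 2 : X) (pow_mem hsA' 2)
      have e : ((s : X) ^ 2) ^ 2 = s := by
        rw [← pow_mul, show 2 * 2 = 3 + 1 by norm_num, pow_succ, hs3', one_mul]
      rwa [e] at this
    have e2 : h * (s * h⁻¹ * s⁻¹) ∈ W := mul_mem hhW (hWn.conj_mem _ (inv_mem hhW) s)
    have e3 : h * (s * h⁻¹ * s⁻¹) = s := by
      ext
      simp only [Subgroup.coe_mul, InvMemClass.coe_inv]
      rw [← mul_assoc, ← mul_assoc, e1, ← mul_inv_rev, inv_eq_iff_mul_eq_one, ← pow_two, ← pow_succ]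
      exact hs3'
    rw [e3, hW, mem_centralizer_iff] at e2
    exact congrArg Subtype.val (e2 _ hc4')
end
end SD

namespace SD
universe u
set_option linter.unusedVariables false
set_option linter.style.multiGoal false
set_option linter.unusedSimpArgs false
variable {X : Type u} [Group X] {A H C : Subgroup X}

theorem norm_gen [Finite X] {s x : X} (h : x * s * x⁻¹ ∈ zpowers s) :
    x ∈ normalizer (zpowers s : Set X) := by
  refine mem_normalizer_fintype fun n hn => ?_
  rw [SetLike.mem_coe, mem_zpowers_iff] at hn
  obtain ⟨j, rfl⟩ := hn
  rw [← conj_zpow]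
  exact zpow_mem h j

theorem PSys.notinv [Finite X] (p : PSys A H C) {c : X} (hc : C = zpowers c) {s : X} (hs : A = zpowers s)
    (h1 : s ≠ 1) : c * s * c⁻¹ ∉ A := by
  intro h
  have h2 : c ∈ normalizer (zpowers s : Set X) := norm_gen (hs ▸ h)
  have h3 : C ≤ normalizer (zpowers s : Set X) := by rw [hc, zpowers_le]; exact h2
  have := p.P' (U := A) le_rfl (fun d hd x hx => by
    have := h3 hd
    rw [← hs, mem_normalizer_iff] at this
    exact (this x).1 hx)
  rw [hs, zpowers_eq_bot] at this
  exact h1 this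

theorem sq_eq_one_iff' {x : X} (h : x ^ 2 = 1) : x⁻¹ = x := by
  rw [inv_eq_iff_mul_eq_one, ← pow_two, h]

theorem lemma1 [Finite X] (p : Sys A H C) (hA : A ≠ ⊥) (hmax : ∀ L, C ≤ L → L = C ∨ L = ⊤)
    {c : X} (hc : C = zpowers c) : Cond2 A C c := by
  have hcC : c ∈ C := hc ▸ mem_zpowers c
  have ti : TIp C C := TI0 p.gC (fun E hE h hh x hx => by
    rw [p.Ccomm hh (hE hx)]; simpa using hx) hmax p.core
  have hHn : H.Normal := by
    refine ⟨fun h hh g => FrobN (G := ⊤) le_top le_top ?_ p.dis ?_ ?_ g (mem_top g) h hh⟩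
    · rw [card_top, p.card, p.toPair.card]
    · intro h hh h1 d hd hhd
      exact ti h (fun hC => h1 (p.dis h hh hC)) d hd hhd
    · intro h hh g d hd e
      exact p.HconjC hh hd e
  have hsq := p.sqA hHn (fun x hx => p.sq hx)
  obtain ⟨u, hu⟩ := p.gA
  have huA : u ∈ A := hu ▸ mem_zpowers u
  have huH := p.AH huA
  have hu1 : u ≠ 1 := by rintro rfl; apply hA; rw [hu]; simp
  have hu2 := hsq u huH
  have fre : ∀ x ∈ H, x ≠ 1 → ∀ d ∈ C, d * x * d⁻¹ = x → d = 1 := by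
    intro x hx hx1 d hd e
    refine ti x (fun hC => hx1 (p.dis x hx hC)) d hd ?_
    have : x * d * x⁻¹ = d := by
      rw [mul_inv_eq_iff_eq_mul] at e ⊢; exact e.symm
    rwa [this]
  have hcj : ∀ g, g * u * g⁻¹ ∈ H := fun g => hHn.conj_mem u huH g
  have hni := p.notinv hc hu hu1
  have hc1 : c ≠ 1 := by rintro rfl; apply hni; simpa using huA
  have hcc : ∀ x ∈ H, ∀ y ∈ H, x * y = y * x := fun x hx y hy =>
    comm_of_sq (hsq x hx) (hsq y hy) (hsq _ (mul_mem hx hy))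
  have hc2 : c ^ 2 ≠ 1 := by
    intro h2
    have h3 : c⁻¹ = c := sq_eq_one_iff' h2
    have hw : u * (c * u * c⁻¹) = 1 := by
      by_contra hne
      refine hc1 (fre _ (mul_mem huH (hcj c)) hne c hcC ?_)
      rw [hcc u huH _ (hcj c)]
      calc c * (c * u * c⁻¹ * u) * c⁻¹ = (c ^ 2) * u * (c ^ 2)⁻¹ * (c * u * c⁻¹) := by
            simp only [pow_two]; group
        _ = u * (c * u * c⁻¹) := by rw [h2]; simp
        _ = _ := hcc u huH _ (hcj c)
    apply hni
    rw [← inv_eq_of_mul_eq_one_right hw]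
    exact inv_mem huA
  have hn2 : c ^ 2 * u * (c ^ 2)⁻¹ ∉ A := by
    intro h
    rcases invol_uniq p.gA huA hu1 hu2 h (hsq _ (hcj _)) with h | h
    · exact hu1 (by simpa using h)
    · exact hc2 (fre u huH hu1 _ (pow_mem hcC 2) h)
  have h12 := p.two _ (hcj c) _ (hcj (c ^ 2)) hni hn2
  refine ⟨u, huA, hu1, hu2, ?_, ?_⟩
  · intro x hx
    rw [hsq x]; exact one_mem _
    have : closure {y | ∃ d ∈ C, y = d * u * d⁻¹} ≤ H := by
      rw [closure_le]
      rintro _ ⟨d, hd, rfl⟩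
      exact hcj d
    exact this hx
  · rcases invol_uniq p.gA huA hu1 hu2 h12 (hsq _ (p.AH h12)) with h | h
    · exfalso
      apply hc1
      refine fre (c * u * c⁻¹) (hcj c) (by simpa using hu1) c hcC ?_
      have h4 := (inv_eq_of_mul_eq_one_right h)
      rw [sq_eq_one_iff' (hsq _ (hcj c))] at h4
      rw [h4]
      calc _ = c * (c * u * c⁻¹) * c⁻¹ := by rw [h4]
        _ = _ := by simp only [pow_two]; group
    · rw [mul_assoc, h, ← pow_two, hu2]; exact one_mem _

theorem condD8_of [Finite X] (p : Sys A H C) (hA : Nat.card A = 2) (hC : Nat.card C = 2)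
    {c : X} (hc : C = zpowers c) : CondD8 A C c := by
  have hcC : c ∈ C := hc ▸ mem_zpowers c
  have hHn : H.Normal := by
    apply normal_of_index_eq_two
    have h1 := H.card_mul_index
    rw [p.card, p.toPair.card, hA, hC] at h1
    omega
  have hsq := p.sqA hHn (fun x hx => p.sq hx)
  obtain ⟨u, hu⟩ := p.gA
  have huA : u ∈ A := hu ▸ mem_zpowers u
  have huH := p.AH huA
  have hu1 : u ≠ 1 := by rintro rfl; rw [hu] at hA; simp at hA
  have hu2 := hsq u huH
  have hcj : ∀ g, g * u * g⁻¹ ∈ H := fun g => hHn.conj_mem u huH g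
  have hni := p.notinv hc hu hu1
  have hc2 : c ^ 2 = 1 := by rw [← hC]; exact pow_card_mem hcC
  refine ⟨u, huA, hu1, hu2, ?_, ?_, ?_⟩
  · intro x hx
    rw [hsq x]; exact one_mem _
    have : closure {y | ∃ d ∈ C, y = d * u * d⁻¹} ≤ H := by
      rw [closure_le]
      rintro _ ⟨d, hd, rfl⟩
      exact hcj d
    exact this hx
  · rw [hc2]; simp [← pow_two, hu2]
  · intro h
    have := p.dis _ (mul_mem huH (hcj c)) h
    apply hni
    rw [← inv_eq_of_mul_eq_one_right this]
    exact inv_mem huA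

theorem cond34_of [Finite X] (p : Sys A H C) (hA : Nat.card A = 3) (hC : Nat.card C = 4)
    {c : X} (hc : C = zpowers c) : Cond34 A C c := by
  have hcC : c ∈ C := hc ▸ mem_zpowers c
  obtain ⟨s, hs⟩ := p.gA
  have hsA : s ∈ A := hs ▸ mem_zpowers s
  have hs3 : s ^ 3 = 1 := by rw [← hA]; exact pow_card_mem hsA
  have hs1 : s ≠ 1 := by rintro rfl; rw [hs] at hA; simp at hA
  have hni := p.notinv hc hs hs1
  have hc4 : c ^ 4 = 1 := by rw [← hC]; exact pow_card_mem hcC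
  set N := normalizer (A : Set X) with hN
  have hHN : H ≤ N := fun h hh => mem_normalizer_fintype fun n hn => p.normal hh hn
  have hcN : c ∉ N := fun h => hni ((mem_normalizer_iff.1 h s).1 hsA)
  have hAN : A ≤ N := le_normalizer
  have hc2N : c ^ 2 ∉ N := by
    intro h2
    have hev : ∀ j : ℤ, c ^ j ∈ N ↔ Even j := by
      intro j
      have e : ∀ k : ℤ, c ^ (2 * k) ∈ N := fun k => by
        rw [zpow_mul]; exact zpow_mem (by exact_mod_cast h2) k
      rcases Int.even_or_odd' j with ⟨k, rfl | rfl⟩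
      · exact ⟨fun _ => by simp, fun _ => e k⟩
      · constructor
        · intro h
          rw [zpow_add, zpow_one] at h
          exact absurd ((mul_mem_cancel_left (e k)).1 h) hcN
        · intro h; rw [Int.even_iff] at h; omega
    have hi : N.index = 2 := by
      rw [index_eq_two_iff]
      refine ⟨c, fun b => ?_⟩
      obtain ⟨h, hh, d, hd, rfl⟩ := p.HC b
      rw [hc, mem_zpowers_iff] at hd
      obtain ⟨j, rfl⟩ := hd
      rw [mul_assoc, mul_mem_cancel_left (hHN hh), mul_mem_cancel_left (hHN hh), ← zpow_add_one, hev,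
        hev, Int.even_add_one]
      by_cases hj : Even j <;> simp [hj]
    have hNn : N.Normal := normal_of_index_eq_two hi
    have hcard := N.card_mul_index
    rw [hi, p.card, hA, hC] at hcard
    have hAn : (A.subgroupOf N).Normal := normal_subgroupOf_iff_le_normalizer hAN |>.2 le_rfl
    have hidx := (A.subgroupOf N).card_mul_index
    rw [Nat.card_congr (subgroupOfEquivOfLe hAN).toEquiv, hA] at hidx
    have hidx4 : (A.subgroupOf N).index = 4 := by omega
    have hy : c * s * c⁻¹ ∈ N := hNn.conj_mem s (hAN hsA) c
    have h5 := (A.subgroupOf N).pow_index_mem ⟨_, hy⟩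
    rw [hidx4, mem_subgroupOf] at h5
    have h6 : (c * s * c⁻¹) ^ 4 ∈ A := h5
    rw [conj_pow, pow_succ, hs3, one_mul] at h6
    exact hni h6
  refine ⟨s, hsA, hs3, hs1, fun h => hc2N ?_, fun h => ?_⟩
  · rw [hN, hs]; exact norm_gen h
  · have hy : c⁻¹ * s * c ∈ N := by rw [hN, hs]; exact norm_gen h
    obtain ⟨h0, hh, d, hd, e⟩ := p.HC (c⁻¹ * s * c)
    have hdN : d ∈ N := by rw [e] at hy; exact (mul_mem_cancel_left (hHN hh)).1 hy
    have hd1 : d = 1 := by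
      have hc4' : c ^ (4 : ℤ) = 1 := by exact_mod_cast hc4
      rw [hc, mem_zpowers_iff] at hd
      obtain ⟨j, rfl⟩ := hd
      have e4 : ∀ k : ℤ, c ^ (4 * k) = 1 := fun k => by rw [zpow_mul, hc4', one_zpow]
      obtain ⟨k, hk | hk | hk | hk⟩ : ∃ k : ℤ, j = 4 * k ∨ j = 4 * k + 1 ∨ j = 4 * k + 2 ∨
        j = 4 * k + 3 := ⟨j / 4, by omega⟩
      · rw [hk, e4]
      · rw [hk, zpow_add, e4, one_mul, zpow_one] at hdN; exact absurd hdN hcN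
      · rw [hk, zpow_add, e4, one_mul] at hdN; exact absurd (by exact_mod_cast hdN) hc2N
      · rw [hk, zpow_add, e4, one_mul] at hdN
        have h7 : c ^ 3 ∈ N := by exact_mod_cast hdN
        have h8 := pow_mem h7 2
        rw [← pow_mul, show 3 * 2 = 4 + 2 by norm_num, pow_add, hc4, one_mul] at h8
        exact absurd h8 hc2N
    rw [hd1, mul_one] at e
    have hyH : c⁻¹ * s * c ∈ H := e ▸ hh
    have h9 := pow_mem (p.sq hyH) 2
    have h10 : ((c⁻¹ * s * c) ^ 2) ^ 2 = c⁻¹ * s * c := by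
      have : (c⁻¹ * s * c) ^ 3 = 1 := by
        have := conj_pow (i := 3) (a := c⁻¹) (b := s)
        rw [inv_inv] at this
        rw [this, hs3]; simp
      rw [← pow_mul, show 2 * 2 = 3 + 1 by norm_num, pow_succ, this, one_mul]
    rw [h10] at h9
    refine p.notinv (c := c⁻¹) (by rw [hc, zpowers_inv]) hs hs1 ?_
    rwa [inv_inv]
end SD

namespace SD
universe u
set_option linter.unusedVariables false
set_option linter.style.multiGoal false
set_option linter.unusedSimpArgs false
variable {X : Type u} [Group X] {A H C : Subgroup X}

theorem mem_klein {S : Set X} {u v x : X} (hu : u ^ 2 = 1) (hv : v ^ 2 = 1) (huv : u * v = v * u)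
    (hS : ∀ s ∈ S, s = 1 ∨ s = u ∨ s = v ∨ s = u * v) (hx : x ∈ closure S) :
    x = 1 ∨ x = u ∨ x = v ∨ x = u * v := by
  rw [pow_two] at hu hv
  have h1 : ∀ x, u * (u * x) = x := fun x => by rw [← mul_assoc, hu, one_mul]
  have h2 : ∀ x, v * (v * x) = x := fun x => by rw [← mul_assoc, hv, one_mul]
  have h3 : ∀ x, v * (u * x) = u * (v * x) := fun x => by rw [← mul_assoc, ← huv, mul_assoc]
  have h4 : u⁻¹ = u := inv_eq_of_mul_eq_one_right hu
  have h5 : v⁻¹ = v := inv_eq_of_mul_eq_one_right hv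
  induction hx using closure_induction with
  | mem x hx => exact hS x hx
  | one => simp
  | mul x y _ _ hx hy =>
    rcases hx with rfl | rfl | rfl | rfl <;> rcases hy with rfl | rfl | rfl | rfl <;>
      simp [mul_assoc, hu, hv, h1, h2, h3, ← huv]
  | inv x _ hx =>
    rcases hx with rfl | rfl | rfl | rfl <;> simp [h4, h5, huv]

theorem conjM (g x y : X) : g * (x * y) * g⁻¹ = (g * x * g⁻¹) * (g * y * g⁻¹) := by group
theorem conjC (g h x : X) : (g * h) * x * (g * h)⁻¹ = g * (h * x * h⁻¹) * g⁻¹ := by group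
theorem conj_iff_comm {g x : X} : g * x * g⁻¹ = x ↔ g * x = x * g := by
  rw [mul_inv_eq_iff_eq_mul]
theorem conj_inj' {g x y : X} (h : g * x * g⁻¹ = g * y * g⁻¹) : x = y := by simpa using h

theorem uBase [Finite X] (p : Sys A H C) {u : X} (huA : u ∈ A) (hu1 : u ≠ 1) (hu2 : u ^ 2 = 1)
    (hcl : ∀ x ∈ closure {y | ∃ d ∈ C, y = d * u * d⁻¹}, x ^ 2 ∈ C) :
    (closure {y | ∃ d ∈ C, y = d * u * d⁻¹}).Normal ∧
    (∀ x ∈ closure {y | ∃ d ∈ C, y = d * u * d⁻¹}, x ^ 2 = 1) ∧ (∀ h ∈ H, h * u * h⁻¹ = u) ∧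
    (∀ g, ∃ d ∈ C, g * u * g⁻¹ = d * u * d⁻¹) := by
  have h1 : ∀ h ∈ H, h * u * h⁻¹ = u := fun h hh =>
    (invol_uniq p.gA huA hu1 hu2 (p.normal hh huA) (by rw [conj_pow, hu2]; simp)).resolve_left
      (fun h => hu1 (by simpa using h))
  have h2 : ∀ g, ∃ d ∈ C, g * u * g⁻¹ = d * u * d⁻¹ := by
    intro g
    obtain ⟨d, hd, h, hh, rfl⟩ := p.CH g
    exact ⟨d, hd, by rw [conjC, h1 h hh]⟩
  have h3 : (closure {y | ∃ d ∈ C, y = d * u * d⁻¹}).Normal := by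
    refine ⟨fun x hx g => closure_conj ?_ hx⟩
    rintro _ ⟨d, hd, rfl⟩
    rw [← conjC]
    exact subset_closure (h2 _)
  exact ⟨h3, p.sqC h3 hcl, h1, h2⟩

/-- structure of the Klein normal subgroup with `c` acting as a 3-cycle -/
structure K4 (A H C : Subgroup X) (c u v : X) (U : Subgroup X) : Prop where
  hc : C = zpowers c
  huA : u ∈ A
  hu1 : u ≠ 1
  hu2 : u ^ 2 = 1
  hH : ∀ h ∈ H, h * u * h⁻¹ = u
  cu : c * u * c⁻¹ = v
  cv : c * v * c⁻¹ = u * v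
  hv2 : v ^ 2 = 1
  huv : u * v = v * u
  hv1 : v ≠ 1
  hvu : v ≠ u
  hUn : U.Normal
  hU : ∀ x, x ∈ U ↔ x = 1 ∨ x = u ∨ x = v ∨ x = u * v

theorem lemma3a [Finite X] (p : Sys A H C) {c : X} (hc : C = zpowers c) (h : Cond2 A C c) :
    ∃ u v U, K4 A H C c u v U := by
  obtain ⟨u, huA, hu1, hu2, hcl, hq⟩ := h
  obtain ⟨hUn, hUsq, hH, hconj⟩ := uBase p huA hu1 hu2 hcl
  set U := closure {y | ∃ d ∈ C, y = d * u * d⁻¹} with hUdef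
  have hcC : c ∈ C := hc ▸ mem_zpowers c
  have huU : u ∈ U := subset_closure ⟨1, one_mem _, by simp⟩
  have hcomm : ∀ x ∈ U, ∀ y ∈ U, x * y = y * x := fun x hx y hy =>
    comm_of_sq (hUsq x hx) (hUsq y hy) (hUsq _ (mul_mem hx hy))
  set u1 := c * u * c⁻¹ with hu1def
  set u2 := c ^ 2 * u * (c ^ 2)⁻¹ with hu2def
  have hu1U : u1 ∈ U := hUn.conj_mem u huU c
  have hu2U : u2 ∈ U := hUn.conj_mem u huU _
  have e12 : c * u1 * c⁻¹ = u2 := by rw [hu1def, hu2def, pow_two]; group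
  have e23 : c * u2 * c⁻¹ = u := by
    have h1 : c * (u * u1 * u2) * c⁻¹ = u * u1 * u2 := by
      rw [conj_iff_comm]; exact p.Ccomm hcC hq
    rw [conjM, conjM, ← hu1def, e12] at h1
    have hm := hUn.conj_mem _ hu2U c
    rw [mul_assoc u, hcomm u huU _ (mul_mem hu1U hu2U)] at h1
    exact mul_left_cancel h1
  have hne : u1 ≠ u := by
    intro h
    have hC : ∀ d ∈ C, d * u * d⁻¹ = u := by
      intro d hd
      rw [hc, mem_zpowers_iff] at hd
      obtain ⟨j, rfl⟩ := hd
      rw [conj_iff_comm]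
      exact ((show Commute c u from conj_iff_comm.1 h).zpow_left j)
    have := p.P' (U := zpowers u) (by rwa [zpowers_le]) (fun d hd x hx => by
      rw [mem_zpowers_iff] at hx
      obtain ⟨j, rfl⟩ := hx
      rw [← conj_zpow, hC d hd]
      exact zpow_mem (mem_zpowers u) j)
    rw [zpowers_eq_bot] at this
    exact hu1 this
  have hne2 : u2 ≠ u1 := by
    intro h
    rw [← e12, hu1def] at h
    exact hne (conj_inj' h)
  have hne3 : u2 ≠ u := by
    intro h
    rw [h] at e23
    exact hne e23
  have hcon3 : ∀ d ∈ C, d * u * d⁻¹ = u ∨ d * u * d⁻¹ = u1 ∨ d * u * d⁻¹ = u2 := by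
    intro d hd
    rw [hc, mem_zpowers_iff] at hd
    obtain ⟨j, rfl⟩ := hd
    have h3 : Commute (c ^ 3) u := by
      rw [Commute, SemiconjBy, ← conj_iff_comm, show c ^ 3 = c * c ^ 2 by rw [pow_succ'], conjC, ← hu2def, e23]
    have h3' : Commute (c ^ (3 : ℤ)) u := by exact_mod_cast h3
    have h3k : ∀ k : ℤ, c ^ (3 * k) * u * (c ^ (3 * k))⁻¹ = u := fun k => by
      rw [conj_iff_comm, zpow_mul]; exact h3'.zpow_left k
    obtain ⟨k, hk | hk | hk⟩ : ∃ k : ℤ, j = 3 * k ∨ j = 1 + 3 * k ∨ j = 2 + 3 * k :=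
      ⟨j / 3, by omega⟩
    · left; rw [hk, h3k]
    · right; left; rw [hk, zpow_add, conjC, h3k, zpow_one]
    · right; right; rw [hk, zpow_add, conjC, h3k, hu2def]; norm_cast
  have hX3 : ∀ g, g * u * g⁻¹ = u ∨ g * u * g⁻¹ = u1 ∨ g * u * g⁻¹ = u2 := by
    intro g
    obtain ⟨d, hd, e⟩ := hconj g
    rw [e]; exact hcon3 d hd
  have hX3' : ∀ g, g * u1 * g⁻¹ = u ∨ g * u1 * g⁻¹ = u1 ∨ g * u1 * g⁻¹ = u2 := by
    intro g; rw [hu1def, ← conjC]; exact hX3 _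
  have hX3'' : ∀ g, g * u2 * g⁻¹ = u ∨ g * u2 * g⁻¹ = u1 ∨ g * u2 * g⁻¹ = u2 := by
    intro g; rw [hu2def, ← conjC]; exact hX3 _
  have hq1 : u * u1 * u2 = 1 := by
    refine p.core_elt hq fun g => ?_
    have : g * (u * u1 * u2) * g⁻¹ = u * u1 * u2 := by
      obtain ⟨d, hd, h, hh, rfl⟩ := p.CH g
      rw [conjC]
      have h1 : h * (u * u1 * u2) * h⁻¹ = u * u1 * u2 := by
        rw [conjM, conjM, hH h hh]
        have n1 : h * u1 * h⁻¹ ≠ u := fun e => hne (conj_inj' (e.trans (hH h hh).symm))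
        have n2 : h * u2 * h⁻¹ ≠ u := fun e => hne3 (conj_inj' (e.trans (hH h hh).symm))
        rcases hX3' h with e | e | e
        · exact absurd e n1
        · rcases hX3'' h with f | f | f
          · exact absurd f n2
          · exact absurd (conj_inj' (f.trans e.symm)) hne2
          · rw [e, f]
        · rcases hX3'' h with f | f | f
          · exact absurd f n2
          · rw [e, f, mul_assoc u u2 u1, hcomm u2 hu2U u1 hu1U, mul_assoc u u1 u2]
          · exact absurd (conj_inj' (f.trans e.symm)) hne2
      rw [h1, conj_iff_comm]
      exact p.Ccomm hd hq
    rw [this]; exact mem_zpowers _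
  have hu2' : u2 = u * u1 := by
    have := inv_eq_of_mul_eq_one_right hq1
    rw [sq_eq_one_iff' (hUsq _ (mul_mem huU hu1U))] at this
    exact this.symm
  refine ⟨u, u1, U, hc, huA, hu1, hu2, hH, rfl, by rw [e12, hu2'], hUsq _ hu1U,
    hcomm u huU u1 hu1U, fun h => hu1 (by rw [hu1def] at h; simpa using h), hne, hUn, fun x => ⟨fun hx => ?_, ?_⟩⟩
  · refine mem_klein hu2 (hUsq _ hu1U) (hcomm u huU u1 hu1U) ?_ (hUdef ▸ hx)
    rintro _ ⟨d, hd, rfl⟩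
    rcases hcon3 d hd with e | e | e
    · simp [e]
    · simp [e]
    · simp [e, hu2']
  · rintro (rfl | rfl | rfl | rfl)
    · exact one_mem _
    · exact huU
    · exact hu1U
    · exact mul_mem huU hu1U
end SD

namespace SD
universe u
set_option linter.unusedVariables false
set_option linter.style.multiGoal false
set_option linter.unusedSimpArgs false
variable {X : Type u} [Group X] {A H C U : Subgroup X} {c u v : X}

def Emb4 (X : Type u) [Group X] : Prop := ∃ f : X →* Equiv.Perm (Fin 4), Function.Injective f

theorem emb4_of [Finite X] {K : Subgroup X} (hi : K.index = 4) (hK : K.normalCore = ⊥) : Emb4 X := by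
  have e : (X ⧸ K) ≃ Fin 4 := Finite.equivFinOfCardEq hi
  let g := (MulAction.toPermHom X (X ⧸ K))
  refine ⟨(Equiv.permCongrHom e).toMonoidHom.comp g, ?_⟩
  have : Function.Injective g := by
    rw [← MonoidHom.ker_eq_bot_iff, ← normalCore_eq_ker, hK]
  exact (Equiv.permCongrHom e).injective.comp this

theorem normal_of_two {K : Subgroup X} {a : X} (h : ∀ x, x ∈ K ∨ a⁻¹ * x ∈ K) : K.Normal := by
  by_cases ha : a ∈ K
  · have : K = ⊤ := by
      rw [eq_top_iff']
      intro x
      rcases h x with h | h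
      · exact h
      · exact (mul_mem_cancel_left (inv_mem ha)).1 h
    rw [this]; infer_instance
  · apply normal_of_index_eq_two
    rw [index_eq_two_iff]
    refine ⟨a, fun b => ?_⟩
    by_cases hb : b ∈ K
    · exact Or.inr ⟨hb, fun h => ha ((mul_mem_cancel_left hb).1 h)⟩
    · refine Or.inl ⟨?_, hb⟩
      rcases h b⁻¹ with h | h
      · exact absurd (inv_mem_iff.1 h) hb
      · rw [← mul_inv_rev, inv_mem_iff] at h; exact h

namespace K4

theorem mU1 (k : K4 A H C c u v U) : u ∈ U := (k.hU _).2 (by simp)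
theorem mU2 (k : K4 A H C c u v U) : v ∈ U := (k.hU _).2 (by simp)

theorem sqU (k : K4 A H C c u v U) {x : X} (hx : x ∈ U) : x ^ 2 = 1 := by
  rcases (k.hU x).1 hx with rfl | rfl | rfl | rfl
  · simp
  · exact k.hu2
  · exact k.hv2
  · rw [(show Commute u v from k.huv).mul_pow, k.hu2, k.hv2, one_mul]

theorem comm (k : K4 A H C c u v U) {x y : X} (hx : x ∈ U) (hy : y ∈ U) : x * y = y * x :=
  comm_of_sq (k.sqU hx) (k.sqU hy) (k.sqU (mul_mem hx hy))

/-- commuting with u and v means commuting with U -/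
theorem commU (k : K4 A H C c u v U) {g : X} (h1 : g * u * g⁻¹ = u) (h2 : g * v * g⁻¹ = v) {x : X}
    (hx : x ∈ U) : g * x * g⁻¹ = x := by
  rcases (k.hU x).1 hx with rfl | rfl | rfl | rfl
  · simp
  · exact h1
  · exact h2
  · rw [conjM, h1, h2]

theorem Ccen (k : K4 A H C c u v U) (p : Sys A H C) {d : X} (hd : d ∈ C) (h1 : d * u * d⁻¹ = u) {x : X}
    (hx : x ∈ U) : d * x * d⁻¹ = x := by
  refine k.commU h1 ?_ hx
  have hcC : c ∈ C := k.hc ▸ mem_zpowers c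
  rw [← k.cu, ← conjC, p.Ccomm hd hcC, conjC, h1]

theorem c3 (k : K4 A H C c u v U) : c ^ 3 * u * (c ^ 3)⁻¹ = u := by
  have : c ^ 3 = c * (c * c) := by rw [pow_succ, pow_two, mul_assoc]
  rw [this, conjC, conjC, k.cu, k.cv, conjM, k.cu, k.cv, k.huv, ← mul_assoc, ← pow_two, k.hv2, one_mul]

theorem nofix (k : K4 A H C c u v U) {x : X} (hx : x ∈ U) (h : c * x * c⁻¹ = x) : x = 1 := by
  rcases (k.hU x).1 hx with rfl | rfl | rfl | rfl
  · rfl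
  · rw [k.cu] at h; exact absurd h k.hvu
  · rw [k.cv] at h; exact absurd (by simpa using h) k.hu1
  · rw [conjM, k.cu, k.cv, k.huv, ← mul_assoc, ← pow_two, k.hv2, one_mul] at h
    exact absurd (by simpa using h.symm) k.hv1

theorem c1 (k : K4 A H C c u v U) : c ≠ 1 := by
  rintro rfl
  exact k.hvu (by rw [← k.cu]; simp)

theorem uC (k : K4 A H C c u v U) (p : Sys A H C) : u ∉ C := fun h => k.hu1 (p.dis u (p.AH k.huA) h)

theorem main [Finite X] (k : K4 A H C c u v U) (p : Sys A H C) {a : X} (ha : A = zpowers a) :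
    a ^ 4 = 1 ∧ c ^ 3 = 1 ∧ ∀ x, x ∈ U ⊔ C ∨ a⁻¹ * x ∈ U ⊔ C := by
  have haA : a ∈ A := ha ▸ mem_zpowers a
  have := k.hUn
  have haH := p.AH haA
  have hcC : c ∈ C := k.hc ▸ mem_zpowers c
  obtain ⟨z, hzH, hzA, w, hw, e, he, hz⟩ := p.L5 k.hUn (fun h => k.uC p (h k.mU1))
  have heu : e * u * e⁻¹ = u := by
    have h1 := k.hH z hzH
    rw [hz, conjC] at h1
    have h2 : w * u * w⁻¹ = u := by rw [conj_iff_comm]; exact k.comm hw k.mU1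
    exact conj_inj' (h1.trans h2.symm)
  have heU : ∀ x ∈ U, e * x * e⁻¹ = x := fun x hx => k.Ccen p he heu hx
  have hzU : ∀ x ∈ U, z * x * z⁻¹ = x := fun x hx => by
    rw [hz, conjC, heU x hx, conj_iff_comm]; exact k.comm hw hx
  have hwe : e * w = w * e := conj_iff_comm.1 (heU w hw)
  have hz2' : z ^ 2 = e ^ 2 := by
    rw [hz, (show Commute w e from hwe.symm).mul_pow, k.sqU hw, one_mul]
  have hz2 : z ^ 2 = 1 := p.dis _ (pow_mem hzH 2) (hz2' ▸ pow_mem he 2)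
  have he2 : e ^ 2 = 1 := by rw [← hz2', hz2]
  have hzi := sq_eq_one_iff' hz2
  have hei := sq_eq_one_iff' he2
  have hwi := sq_eq_one_iff' (k.sqU hw)
  have hez : e = w * z := by rw [hz, ← mul_assoc, ← pow_two, k.sqU hw, one_mul]
  let T : Subgroup X := {
    carrier := {t | t ∈ A ∧ (∀ x ∈ U, t * x * t⁻¹ = x) ∧ z * t * z⁻¹ = t⁻¹}
    mul_mem' := by
      rintro s t ⟨h1, h2, h3⟩ ⟨h4, h5, h6⟩
      refine ⟨mul_mem h1 h4, fun x hx => by rw [conjC, h5 x hx, h2 x hx], ?_⟩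
      rw [conjM, h3, h6, p.toPair.comm h1 h4, mul_inv_rev]
    one_mem' := ⟨one_mem _, by simp, by simp⟩
    inv_mem' := by
      rintro t ⟨h4, h5, h6⟩
      refine ⟨inv_mem h4, fun x hx => ?_, ?_⟩
      · rw [conj_iff_comm]
        exact (show Commute t x from conj_iff_comm.1 (h5 x hx)).inv_left
      · rw [← conj_inv, h6] }
  have hT : ∀ t ∈ T, t ∈ A ∧ (∀ x ∈ U, t * x * t⁻¹ = x) ∧ z * t * z⁻¹ = t⁻¹ := fun t h => h
  have hTe : ∀ t ∈ T, e * t * e⁻¹ = t⁻¹ := by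
    intro t ht
    rw [hez, conjC, (hT t ht).2.2, conj_iff_comm]
    exact (show Commute t w from conj_iff_comm.1 ((hT t ht).2.1 w hw)).inv_left.symm
  have hTU : ∀ t ∈ T, ∀ x ∈ U, t * x = x * t := fun t ht x hx =>
    conj_iff_comm.1 ((hT t ht).2.1 x hx)
  have hyT : ∀ h ∈ H, h * z * h⁻¹ * z⁻¹ ∈ T := by
    intro h hh
    refine ⟨?_, ?_, ?_⟩
    · have e1 : h * z * h⁻¹ * z⁻¹ = (h * z) * (h⁻¹ * z⁻¹) := by group
      rw [e1]
      by_cases hA : h ∈ A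
      · refine p.two _ (mul_mem hh hzH) _ (mul_mem (inv_mem hh) (inv_mem hzH)) ?_ ?_
        · exact p.toPair.mul_nmem hA hzA
        · exact p.toPair.mul_nmem (inv_mem hA) (fun h => hzA (inv_mem_iff.1 h))
      · refine mul_mem (p.two _ hh _ hzH hA hzA) (p.two _ (inv_mem hh) _ (inv_mem hzH) ?_ ?_)
        · exact (fun h => hA (inv_mem_iff.1 h))
        · exact (fun h => hzA (inv_mem_iff.1 h))
    · intro x hx
      have h1 : h⁻¹ * x * h ∈ U := by simpa using k.hUn.conj_mem x hx h⁻¹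
      have h2 := hzU _ h1
      have h3 := hzU x hx
      rw [mul_inv_eq_iff_eq_mul] at h3
      calc h * z * h⁻¹ * z⁻¹ * x * (h * z * h⁻¹ * z⁻¹)⁻¹
          = h * z * h⁻¹ * z⁻¹ * (x * z) * h * z⁻¹ * h⁻¹ := by group
        _ = h * (z * (h⁻¹ * x * h) * z⁻¹) * h⁻¹ := by rw [← h3]; group
        _ = x := by rw [h2]; group
    · have : (h * z * h⁻¹ * z⁻¹)⁻¹ = z * h * z⁻¹ * h⁻¹ := by group
      rw [this]
      calc z * (h * z * h⁻¹ * z⁻¹) * z⁻¹ = z * h * z * h⁻¹ * (z ^ 2)⁻¹ := by rw [pow_two]; group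
        _ = z * h * z⁻¹ * h⁻¹ := by rw [hz2, hzi]; simp
  let N : Subgroup X := closure {w | w ∈ U ∨ ∃ g, w = g * e * g⁻¹}
  have hUN : ∀ x ∈ U, x ∈ N := fun x hx => subset_closure (Or.inl hx)
  have hNn : N.Normal := by
    refine ⟨fun x hx g => closure_conj ?_ hx⟩
    rintro s (hs | ⟨g', rfl⟩)
    · exact hUN _ (k.hUn.conj_mem s hs g)
    · rw [← conjC]; exact subset_closure (Or.inr ⟨_, rfl⟩)
  have form : ∀ x ∈ N, ∃ y ∈ U, ∃ t ∈ T, x = y * t ∨ x = y * t * e := by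
    intro x hx
    induction hx using closure_induction with
    | mem x hx =>
      rcases hx with hx | ⟨g, rfl⟩
      · exact ⟨x, hx, 1, one_mem _, Or.inl (by simp)⟩
      · obtain ⟨h, hh, d, hd, rfl⟩ := p.HC g
        refine ⟨(h * w * h⁻¹) * w, mul_mem (k.hUn.conj_mem w hw h) hw, _, hyT h hh, Or.inr ?_⟩
        have h1 : d * e * d⁻¹ = e := by rw [conj_iff_comm]; exact p.Ccomm hd he
        rw [conjC, h1]
        have h2 := hTU _ (hyT h hh) w hw
        calc h * e * h⁻¹ = (h * w * h⁻¹) * ((h * z * h⁻¹ * z⁻¹) * z) := by rw [hez]; group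
          _ = (h * w * h⁻¹) * ((h * z * h⁻¹ * z⁻¹) * w * (w⁻¹ * z)) := by group
          _ = (h * w * h⁻¹) * ((w * (h * z * h⁻¹ * z⁻¹)) * (w⁻¹ * z)) := by rw [h2]
          _ = _ := by rw [hwi, ← hez]; group
    | one => exact ⟨1, one_mem _, 1, one_mem _, Or.inl (by simp)⟩
    | mul x y _ _ hx hy =>
      obtain ⟨x1, hx1, t1, ht1, hx⟩ := hx
      obtain ⟨x2, hx2, t2, ht2, hy⟩ := hy
      have q1 := hTU t1 ht1 x2 hx2
      have q2 : e * x2 = x2 * e := conj_iff_comm.1 (heU x2 hx2)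
      have q3 : e * t2 = t2⁻¹ * e := by rw [← mul_inv_eq_iff_eq_mul]; exact hTe t2 ht2
      have r1 : ∀ y, (x1 * t1) * (x2 * y) = (x1 * x2) * (t1 * y) := fun y => by
        rw [mul_assoc, ← mul_assoc t1, q1]; group
      rcases hx with rfl | rfl <;> rcases hy with rfl | rfl
      · exact ⟨x1 * x2, mul_mem hx1 hx2, t1 * t2, mul_mem ht1 ht2, Or.inl (r1 _)⟩
      · refine ⟨x1 * x2, mul_mem hx1 hx2, t1 * t2, mul_mem ht1 ht2, Or.inr ?_⟩
        rw [mul_assoc x2, r1]; group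
      · refine ⟨x1 * x2, mul_mem hx1 hx2, t1 * t2⁻¹, mul_mem ht1 (inv_mem ht2), Or.inr ?_⟩
        rw [mul_assoc (x1 * t1), ← mul_assoc e, q2, mul_assoc x2, r1, q3]; group
      · refine ⟨x1 * x2, mul_mem hx1 hx2, t1 * t2⁻¹, mul_mem ht1 (inv_mem ht2), Or.inl ?_⟩
        rw [mul_assoc (x1 * t1), ← mul_assoc e, ← mul_assoc e, q2, mul_assoc x2, q3, mul_assoc x2, r1,
          mul_assoc _ e e, ← pow_two, he2, mul_one]
    | inv x _ hx =>
      obtain ⟨x1, hx1, t1, ht1, hx⟩ := hx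
      have q1 := hTU t1 ht1 x1 hx1
      have q2 : e * x1 = x1 * e := conj_iff_comm.1 (heU x1 hx1)
      have q3 : e * t1⁻¹ = t1 * e := by
        rw [← mul_inv_eq_iff_eq_mul]
        have := hTe _ (inv_mem ht1); rwa [inv_inv] at this
      have q4 := hTU _ (inv_mem ht1) x1 hx1
      have hx1i := sq_eq_one_iff' (k.sqU hx1)
      rcases hx with rfl | rfl
      · exact ⟨x1, hx1, t1⁻¹, inv_mem ht1, Or.inl (by rw [mul_inv_rev, hx1i, q4])⟩
      · refine ⟨x1, hx1, t1, ht1, Or.inr ?_⟩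
        rw [mul_inv_rev, mul_inv_rev, hx1i, hei, q4, ← mul_assoc, q2, mul_assoc x1, q3, mul_assoc]
  have hNsq := p.sqA hNn (by
    intro x hx
    obtain ⟨y, hy, t, ht, h | h⟩ := form x hx
    · have := hTU t ht y hy
      rw [h, (show Commute y t from this.symm).mul_pow, k.sqU hy, one_mul]
      exact pow_mem (hT t ht).1 2
    · have q1 := hTU t ht y hy
      have q2 : e * y = y * e := conj_iff_comm.1 (heU y hy)
      have q3 : e * t = t⁻¹ * e := by rw [← mul_inv_eq_iff_eq_mul]; exact hTe t ht
      have : x ^ 2 = 1 := by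
        calc x ^ 2 = y * t * (e * y) * t * e := by rw [h, pow_two]; group
          _ = y * (t * y) * (e * t) * e := by rw [q2]; group
          _ = y ^ 2 * e ^ 2 := by rw [q1, q3, pow_two, pow_two]; group
          _ = 1 := by rw [k.sqU hy, he2, one_mul]
      rw [this]; exact one_mem _)
  have hyN : a * z * a⁻¹ * z⁻¹ ∈ N := by
    have hzN : z ∈ N := by
      rw [hz]; exact mul_mem (hUN w hw) (subset_closure (Or.inr ⟨1, by simp⟩))
    exact mul_mem (hNn.conj_mem z hzN a) (inv_mem hzN)
  have ha4 : a ^ 4 = 1 := by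
    have h1 := hNsq _ hyN
    have h2 : a * z * a⁻¹ * z⁻¹ = a * (z * a⁻¹ * z⁻¹) := by group
    have h3 := p.toPair.comm haA (p.normal hzH (inv_mem haA))
    rw [h2, (show Commute _ _ from h3).mul_pow, conj_pow, p.inv z hzH hzA _ (inv_mem haA)] at h1
    rw [← h1]; group
  have hzK : z ∈ U ⊔ C := by rw [hz]; exact mul_mem (mem_sup_left hw) (mem_sup_right he)
  have ha2K : a ^ 2 ∈ U ⊔ C := by
    refine mem_sup_left ?_
    rcases invol_uniq p.gA k.huA k.hu1 k.hu2 (pow_mem haA 2) (by rw [← pow_mul]; exact ha4) with h | h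
    · rw [h]; exact one_mem _
    · rw [h]; exact k.mU1
  have hAK : ∀ x ∈ A, x ∈ U ⊔ C ∨ a⁻¹ * x ∈ U ⊔ C := by
    intro x hx
    rw [ha, mem_zpowers_iff] at hx
    obtain ⟨j, rfl⟩ := hx
    have e2 : ∀ i : ℤ, a ^ (2 * i) ∈ U ⊔ C := fun i => by
      rw [zpow_mul]; exact zpow_mem (by exact_mod_cast ha2K) i
    rcases Int.even_or_odd' j with ⟨i, rfl | rfl⟩
    · exact Or.inl (e2 i)
    · right; rw [add_comm, zpow_add, zpow_one, inv_mul_cancel_left]; exact e2 i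
  have htwo : ∀ x, x ∈ U ⊔ C ∨ a⁻¹ * x ∈ U ⊔ C := by
    intro x
    obtain ⟨h, hh, d, hd, rfl⟩ := p.HC x
    have hdK : d ∈ U ⊔ C := mem_sup_right hd
    rw [← mul_assoc, mul_mem_cancel_right hdK, mul_mem_cancel_right hdK]
    by_cases hA : h ∈ A
    · exact hAK h hA
    · have := hAK (h * z) (p.two _ hh _ hzH hA hzA)
      rwa [← mul_assoc, mul_mem_cancel_right hzK, mul_mem_cancel_right hzK] at this
  refine ⟨ha4, ?_, htwo⟩
  have hKn : (U ⊔ C).Normal := normal_of_two htwo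
  have hZC : (U ⊔ C) ⊓ centralizer ((U ⊔ C : Subgroup X) : Set X) ≤ C := by
    intro x hx0
    rw [mem_inf] at hx0
    obtain ⟨hx, hxc⟩ := hx0
    rw [← SetLike.mem_coe, Subgroup.normal_mul] at hx
    obtain ⟨y, hy, d, hd, rfl⟩ := hx
    have hxc' := mem_centralizer_iff.1 hxc
    have h1 : (y * d) * u * (y * d)⁻¹ = u := by
      rw [conj_iff_comm]; exact (hxc' u (mem_sup_left k.mU1)).symm
    have h1' : d * u * d⁻¹ = u := by
      rw [conjC] at h1
      have h2 : y * u * y⁻¹ = u := by rw [conj_iff_comm]; exact k.comm hy k.mU1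
      exact conj_inj' (h1.trans h2.symm)
    have h2 := hxc' c (mem_sup_right hcC)
    have h3 : y = 1 := by
      refine k.nofix hy ?_
      rw [conj_iff_comm]
      have h4 := p.Ccomm hcC hd
      simp only at h2
      rw [mul_assoc, ← h4, ← mul_assoc, ← mul_assoc] at h2
      exact mul_right_cancel h2
    simp only
    rw [h3, one_mul]; exact hd
  have hZ := p.core _ hZC inferInstance
  have : c ^ 3 ∈ (U ⊔ C) ⊓ centralizer ((U ⊔ C : Subgroup X) : Set X) := by
    rw [mem_inf]
    refine ⟨mem_sup_right (pow_mem hcC 3), ?_⟩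
    rw [mem_centralizer_iff]
    intro x hx
    rw [Subgroup.normal_mul] at hx
    obtain ⟨y, hy, d, hd, rfl⟩ := hx
    have h1 := conj_iff_comm.1 (k.Ccen p (pow_mem hcC 3) k.c3 hy)
    have h2 := p.Ccomm (pow_mem hcC 3) hd
    simp only
    rw [mul_assoc, ← h2, ← mul_assoc, ← h1, mul_assoc]
  rw [hZ, mem_bot] at this
  exact this
end K4
end SD

namespace SD
universe u
set_option linter.unusedVariables false
set_option linter.style.multiGoal false
set_option linter.unusedSimpArgs false
variable {X : Type u} [Group X] {A H C U : Subgroup X} {c u v : X}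

namespace K4

theorem Cmem (k : K4 A H C c u v U) (h3 : c ^ 3 = 1) {d : X} (hd : d ∈ C) : d = 1 ∨ d = c ∨ d = c⁻¹ := by
  rw [k.hc, mem_zpowers_iff] at hd
  obtain ⟨j, rfl⟩ := hd
  have e : c ^ j = c ^ (j % 3) := by
    conv_lhs => rw [← Int.emod_add_mul_ediv j 3, zpow_add, zpow_mul]
    rw [show c ^ (3 : ℤ) = 1 by exact_mod_cast h3]; simp
  rw [e]
  have h1 := Int.emod_nonneg j (by norm_num : (3 : ℤ) ≠ 0)
  have h2 := Int.emod_lt_of_pos j (by norm_num : (0 : ℤ) < 3)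
  generalize j % 3 = r at h1 h2
  interval_cases r
  · simp
  · simp
  · right; right
    rw [eq_inv_iff_mul_eq_one, ← h3, pow_succ]; norm_cast

theorem fixu (k : K4 A H C c u v U) (h3 : c ^ 3 = 1) {d x : X} (hd : d ∈ C) (hx : x ∈ U) (hx1 : x ≠ 1)
    (h : d * x * d⁻¹ = x) : d = 1 := by
  rcases k.Cmem h3 hd with h' | h' | h'
  · exact h'
  · rw [h'] at h; exact absurd (k.nofix hx h) hx1
  · rw [h', conj_iff_comm] at h
    refine absurd (k.nofix hx ?_) hx1
    rw [conj_iff_comm]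
    have := (show Commute c⁻¹ x from h).inv_left
    rwa [inv_inv] at this

theorem UC (k : K4 A H C c u v U) (p : Sys A H C) {x : X} (hx : x ∈ U) (hxC : x ∈ C) : x = 1 := by
  have hcC : c ∈ C := k.hc ▸ mem_zpowers c
  exact k.nofix hx (by rw [conj_iff_comm]; exact p.Ccomm hcC hxC)

theorem cardU (k : K4 A H C c u v U) : Nat.card U = 4 := by
  have : (U : Set X) = {1, u, v, u * v} := by
    ext x; simp [k.hU]
  classical
  have h2 : (U : Set X) = (({1, u, v, u * v} : Finset X) : Set X) := by rw [this]; simp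
  rw [← SetLike.coe_sort_coe, h2, Nat.card_coe_set_eq, Set.ncard_coe_finset]
  have e1 := k.hu1
  have e2 := k.hv1
  have e3 := k.hvu
  have e4 : u * v ≠ 1 := fun h => e3 (by
    rw [← sq_eq_one_iff' k.hu2]; exact (inv_eq_of_mul_eq_one_right h).symm)
  rw [Finset.card_insert_of_notMem, Finset.card_insert_of_notMem, Finset.card_pair]
  · simpa using fun h => e1 h
  · simp; exact ⟨e3.symm, e2⟩
  · simp only [Finset.mem_insert, Finset.mem_singleton, not_or]
    exact ⟨e1.symm, e2.symm, e4.symm⟩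

theorem embBig [Finite X] (k : K4 A H C c u v U) (p : Sys A H C) {a : X} (ha : A = zpowers a)
    (h3 : c ^ 3 = 1) (ha2 : a ^ 2 ≠ 1) (ha4 : a ^ 4 = 1)
    (htwo : ∀ x, x ∈ U ⊔ C ∨ a⁻¹ * x ∈ U ⊔ C) : Emb4 X := by
  have := k.hUn
  have hKn : (U ⊔ C).Normal := normal_of_two htwo
  have hcC : c ∈ C := k.hc ▸ mem_zpowers c
  have haA : a ∈ A := ha ▸ mem_zpowers a
  have nrm : ∀ x, x * c * x⁻¹ ∈ C → x ∈ normalizer (C : Set X) := fun x hx => by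
    have := norm_gen (s := c) (x := x) (k.hc ▸ hx)
    rwa [← k.hc] at this
  have hUN : ∀ x ∈ U, x ∈ normalizer (C : Set X) → x = 1 := by
    intro x hx hxN
    have h1 : x * c * x⁻¹ ∈ C := (mem_normalizer_iff.1 hxN c).1 hcC
    have h2 : x * (c * x⁻¹ * c⁻¹) ∈ U := mul_mem hx (k.hUn.conj_mem _ (inv_mem hx) c)
    have h4 : x * (c * x⁻¹ * c⁻¹) = 1 := by
      refine k.UC p h2 ?_
      have : x * (c * x⁻¹ * c⁻¹) = (x * c * x⁻¹) * c⁻¹ := by group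
      rw [this]; exact mul_mem h1 (inv_mem hcC)
    apply k.nofix hx
    rw [conj_iff_comm]
    have h5 : x * c * x⁻¹ * c⁻¹ = 1 := by rw [← h4]; group
    rw [mul_inv_eq_one, mul_inv_eq_iff_eq_mul] at h5
    exact h5.symm
  have hidx : (normalizer (C : Set X)).index = 4 := by
    rw [← k.cardU]
    refine IsComplement'.index_eq_card (isComplement'_of_disjoint_and_mul_eq_univ ?_ ?_)
    · rw [disjoint_iff_inf_le]
      intro x hx
      rw [mem_inf] at hx
      rw [mem_bot]; exact hUN x hx.1 hx.2
    · rw [Set.eq_univ_iff_forall]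
      intro x
      have h1 : x * c * x⁻¹ ∈ U ⊔ C := hKn.conj_mem c (mem_sup_right hcC) x
      rw [← SetLike.mem_coe, Subgroup.normal_mul] at h1
      obtain ⟨y, hy, d, hd, hyd⟩ := h1
      simp only at hyd
      have hd1 : d ≠ 1 := by
        rintro rfl
        rw [mul_one] at hyd
        have h2 : c ∈ U := by
          have := k.hUn.conj_mem y hy x⁻¹
          rw [hyd] at this
          have e : x⁻¹ * (x * c * x⁻¹) * x⁻¹⁻¹ = c := by group
          rwa [e] at this
        exact k.c1 (k.UC p h2 hcC)
      let φ : U → U := fun w => ⟨w * (d * w * d⁻¹), mul_mem w.2 (k.hUn.conj_mem _ w.2 d)⟩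
      have hφ : Function.Injective φ := by
        intro w w' e
        have e1 : (w : X) * (d * w * d⁻¹) = w' * (d * w' * d⁻¹) := congrArg Subtype.val e
        by_contra hne
        have m1 : (w : X)⁻¹ * w' ∈ U := mul_mem (inv_mem w.2) w'.2
        apply hd1
        refine k.fixu h3 hd m1 (fun h => hne (Subtype.ext (inv_mul_eq_one.1 h))) ?_
        have m2 : d * w * d⁻¹ ∈ U := k.hUn.conj_mem _ w.2 d
        have m3 : d * w' * d⁻¹ ∈ U := k.hUn.conj_mem _ w'.2 d
        have q1 := sq_eq_one_iff' (k.sqU m3)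
        have q2 := sq_eq_one_iff' (k.sqU m2)
        have q3 := sq_eq_one_iff' (k.sqU m1)
        have e2 : (w : X)⁻¹ * w' * (d * w' * d⁻¹) = d * w * d⁻¹ := by rw [mul_assoc, ← e1]; group
        rw [conjM]
        have e3 : (w : X)⁻¹ * w' = d * w * d⁻¹ * (d * w' * d⁻¹)⁻¹ := by rw [← e2]; group
        rw [q1] at e3
        rw [← conj_inv, q2, e3]
      obtain ⟨w, hw⟩ := (Finite.injective_iff_surjective.1 hφ) ⟨y, hy⟩
      have hw' : (w : X) * (d * w * d⁻¹) = y := congrArg Subtype.val hw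
      refine ⟨w, w.2, (w : X)⁻¹ * x, ?_, by simp⟩
      apply nrm
      rw [conjC, ← hyd, ← hw']
      have q := sq_eq_one_iff' (k.sqU w.2)
      have : (w : X)⁻¹ * (w * (d * w * d⁻¹) * d) * (w : X)⁻¹⁻¹ = d * w * w := by group
      rw [this, mul_assoc, ← pow_two, k.sqU w.2, mul_one]; exact hd
  apply emb4_of hidx
  have hdis : Disjoint (normalizer (C : Set X)).normalCore U := by
    rw [disjoint_iff_inf_le]
    intro x hx
    rw [mem_inf] at hx
    rw [mem_bot]; exact hUN x hx.2 (normalCore_le _ hx.1)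
  have hcom : ∀ x ∈ (normalizer (C : Set X)).normalCore, x * u = u * x := fun x hx =>
    commute_of_normal_of_disjoint _ _ inferInstance k.hUn hdis x u hx k.mU1
  generalize hK0 : (normalizer (C : Set X)).normalCore = K0 at hdis hcom
  have hK0n : K0.Normal := by rw [← hK0]; infer_instance
  have hK0H : K0 ≤ H := by
    intro x hx
    have h1 := hcom x hx
    obtain ⟨h, hh, d, hd, rfl⟩ := p.HC x
    rw [← conj_iff_comm, conjC] at h1
    have h2 := conj_inj' (h1.trans (k.hH h hh).symm)
    rw [k.fixu h3 hd k.mU1 k.hu1 h2, mul_one]; exact hh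
  have hsq := p.sqA hK0n (fun x hx => p.toPair.sq (hK0H hx))
  have hKA : ∀ x ∈ K0, x ∈ A → x = 1 := by
    intro x hx hxA
    rcases invol_uniq p.gA k.huA k.hu1 k.hu2 hxA (hsq x hx) with h | h
    · exact h
    · exact disjoint_def.1 hdis hx (h ▸ k.mU1)
  rw [eq_bot_iff]
  intro x hx
  rw [mem_bot]
  by_contra hx1
  have hxA : x ∉ A := fun h => hx1 (hKA x hx h)
  have huniq : ∀ g, g * x * g⁻¹ = x := by
    intro g
    have h1 := hK0n.conj_mem x hx g
    have h2 : g * x * g⁻¹ ∉ A := fun h => hx1 (by simpa using hKA _ h1 h)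
    have h4 := hKA _ (mul_mem h1 hx) (p.two _ (hK0H h1) _ (hK0H hx) h2 hxA)
    rw [mul_eq_one_iff_eq_inv.1 h4, sq_eq_one_iff' (hsq x hx)]
  have key : ∀ g ∈ U ⊔ C, g * u * g⁻¹ = u → g ∈ U := by
    intro g hg hgu
    rw [← SetLike.mem_coe, Subgroup.normal_mul] at hg
    obtain ⟨y, hy, d, hd, rfl⟩ := hg
    simp only at hgu ⊢
    rw [conjC] at hgu
    have h2 : y * u * y⁻¹ = u := by rw [conj_iff_comm]; exact k.comm hy k.mU1
    have := k.fixu h3 hd k.mU1 k.hu1 (conj_inj' (hgu.trans h2.symm))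
    rw [this, mul_one]; exact hy
  have hxu : x * u * x⁻¹ = u := by rw [conj_iff_comm]; exact hcom x hx
  rcases htwo x with h | h
  · exact hx1 (disjoint_def.1 hdis hx (key x h hxu))
  · have h1 := k.sqU (key _ h (by rw [conjC, hxu]; exact k.hH _ (inv_mem (p.AH haA))))
    have h2 : Commute a⁻¹ x := (show Commute a x from conj_iff_comm.1 (huniq a)).inv_left
    rw [h2.mul_pow, hsq x hx, mul_one, inv_pow, inv_eq_one] at h1
    exact ha2 h1

end K4

theorem lemma3 [Finite X] (p : Sys A H C) (hc : C = zpowers c) (h : Cond2 A C c) :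
    (Nat.card A = 2 ∨ Nat.card A = 4) ∧ Nat.card C = 3 ∧ Emb4 X := by
  obtain ⟨u, v, U, k⟩ := lemma3a p hc h
  obtain ⟨a, ha⟩ := p.gA
  obtain ⟨ha4, hc3, htwo⟩ := k.main p ha
  have hC : Nat.card C = 3 := by
    rw [hc, Nat.card_zpowers]; exact orderOf_eq_prime hc3 k.c1
  have ha1 : a ≠ 1 := by
    rintro rfl
    have := k.huA
    rw [ha, zpowers_one_eq_bot, mem_bot] at this
    exact k.hu1 this
  by_cases ha2 : a ^ 2 = 1
  · have hA : Nat.card A = 2 := by rw [ha, Nat.card_zpowers]; exact orderOf_eq_prime ha2 ha1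
    refine ⟨Or.inl hA, hC, emb4_of (K := C) ?_ (p.core _ (normalCore_le _) inferInstance)⟩
    have h1 := C.card_mul_index
    rw [p.card, hA, hC] at h1
    omega
  · refine ⟨Or.inr ?_, hC, k.embBig p ha hc3 ha2 ha4 htwo⟩
    rw [ha, Nat.card_zpowers]
    exact orderOf_eq_prime_pow (p := 2) (n := 1) ha2 ha4
end SD

namespace SD
universe u
set_option linter.unusedVariables false
set_option linter.style.multiGoal false
set_option linter.unusedSimpArgs false
variable {X : Type u} [Group X] {A H C U : Subgroup X} {c u v : X}

theorem zpow_mod (c : X) (n : ℕ) (h : c ^ n = 1) (j : ℤ) : c ^ j = c ^ (j % n) := by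
  conv_lhs => rw [← Int.emod_add_mul_ediv j n, zpow_add, zpow_mul]
  rw [show c ^ (n : ℤ) = 1 by exact_mod_cast h]; simp

theorem Emb4.card [Finite X] (h : Emb4 X) : Nat.card X ∣ 24 := by
  obtain ⟨f, hf⟩ := h
  have := Subgroup.card_dvd_of_injective f hf
  rwa [Nat.card_perm, Nat.card_fin] at this

theorem lemma4 [Finite X] (p : Sys A H C) (hc : C = zpowers c) {s : X} (hsA : s ∈ A) (hs3 : s ^ 3 = 1)
    (hs1 : s ≠ 1) (h2 : c ^ 2 * s * (c ^ 2)⁻¹ ∉ zpowers s)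
    (hcs : (c⁻¹ * s * c) * s * (c⁻¹ * s * c)⁻¹ ∉ zpowers s) (h4 : c ^ 4 * s = s * c ^ 4) :
    Nat.card A = 3 ∧ Nat.card C = 4 ∧ Emb4 X := by
  have hcC : c ∈ C := hc ▸ mem_zpowers c
  have hsm : s ∈ zpowers s := mem_zpowers s
  generalize hN : normalizer (zpowers s : Set X) = N
  have hNs : ∀ x ∈ N, x * s * x⁻¹ ∈ zpowers s := fun x hx => by
    rw [← hN] at hx; exact (mem_normalizer_iff.1 hx s).1 hsm
  have hsN : ∀ x, x * s * x⁻¹ ∈ zpowers s → x ∈ N := fun x hx => hN ▸ norm_gen hx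
  have hHN : H ≤ N := fun h hh => hsN h (p.sub_inv (by rwa [zpowers_le]) hh hsm)
  have hc4 : c ^ 4 ∈ N := hsN _ (by rw [conj_iff_comm.2 h4]; exact hsm)
  have hc2 : c ^ 2 ∉ N := fun h => h2 (hNs _ h)
  have hc1 : c ∉ N := fun h => hc2 (pow_mem h 2)
  have hcj : ∀ j : ℤ, c ^ j ∈ N → (4 : ℤ) ∣ j := by
    intro j hj
    have e : c ^ (j % 4) ∈ N := by
      rw [← Int.emod_add_mul_ediv j 4, zpow_add, zpow_mul] at hj
      refine (mul_mem_cancel_right (zpow_mem ?_ _)).1 hj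
      exact_mod_cast hc4
    apply Int.dvd_of_emod_eq_zero
    have h1 := Int.emod_nonneg j (by norm_num : (4 : ℤ) ≠ 0)
    have h2 := Int.emod_lt_of_pos j (by norm_num : (0 : ℤ) < 4)
    generalize j % 4 = r at h1 h2 e
    interval_cases r
    · rfl
    · exact absurd (by simpa using e) hc1
    · exact absurd (by exact_mod_cast e) hc2
    · have e3 : c ^ 3 ∈ N := by exact_mod_cast e
      rw [pow_succ, mul_mem_cancel_left e3] at hc4
      exact absurd hc4 hc1
  have hidx : N.index = 4 := by
    rw [Subgroup.index, ← Nat.card_fin 4]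
    symm
    refine Nat.card_congr (Equiv.ofBijective (fun r : Fin 4 => ((c ^ (r : ℕ) : X) : X ⧸ N)) ⟨?_, ?_⟩)
    · intro r r' e
      simp only at e
      rw [QuotientGroup.eq] at e
      have := hcj (-(r : ℕ) + (r' : ℕ)) (by rw [zpow_add, zpow_neg]; exact_mod_cast e)
      omega
    · intro x
      induction x using QuotientGroup.induction_on with
      | _ x =>
      obtain ⟨d, hd, h, hh, rfl⟩ := p.CH x
      rw [hc, mem_zpowers_iff] at hd
      obtain ⟨j, rfl⟩ := hd
      refine ⟨⟨(j % 4).toNat, by omega⟩, ?_⟩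
      simp only
      rw [QuotientGroup.eq, ← mul_assoc]
      refine mul_mem ?_ (hHN hh)
      have e : (c ^ ((j % 4).toNat) : X) = c ^ (j % 4) := by
        rw [← zpow_natCast, Int.toNat_of_nonneg (by omega)]
      rw [e, ← zpow_neg, ← zpow_add]
      have : -(j % 4) + j = 4 * (j / 4) := by omega
      rw [this, zpow_mul]
      exact zpow_mem (by exact_mod_cast hc4) _
  have hemb : Emb4 X := by
    apply emb4_of hidx
    refine p.core _ ?_ inferInstance
    by_contra hcon
    obtain ⟨h, hh, hA, y, hy, d, hd, e⟩ := p.L5 inferInstance hcon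
    have hdN : d ∈ N := (mul_mem_cancel_left (normalCore_le _ hy)).1 (e ▸ hHN hh)
    have hds : d * s * d⁻¹ = s := by
      rw [hc, mem_zpowers_iff] at hd
      obtain ⟨j, rfl⟩ := hd
      obtain ⟨i, rfl⟩ := hcj j hdN
      rw [conj_iff_comm, zpow_mul]
      exact (show Commute (c ^ (4 : ℤ)) s by exact_mod_cast h4).zpow_left i
    have hinv : h * s * h⁻¹ = s⁻¹ := by
      have := p.inv h hh hA (s ^ 2) (pow_mem hsA 2)
      have e4 : (s ^ 2) ^ 2 = s := by rw [← pow_mul, pow_succ, hs3, one_mul]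
      rwa [e4] at this
    rw [e, conjC, hds] at hinv
    have hsY : s ∈ N.normalCore := by
      have h1 : y * (s * y⁻¹ * s⁻¹) ∈ N.normalCore :=
        mul_mem hy ((inferInstance : N.normalCore.Normal).conj_mem _ (inv_mem hy) s)
      have h2 : y * (s * y⁻¹ * s⁻¹) = s := by
        calc _ = (y * s * y⁻¹) * s⁻¹ := by group
          _ = s⁻¹ * s⁻¹ * s ^ 3 * (s ^ 3)⁻¹ := by rw [hinv]; group
          _ = s := by rw [hs3]; simp; rw [← mul_inv_rev, inv_eq_iff_mul_eq_one, ← pow_two, ← pow_succ, hs3]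
      rwa [h2] at h1
    have h3 := (inferInstance : N.normalCore.Normal).conj_mem _ hsY c⁻¹
    rw [inv_inv] at h3
    exact hcs (hNs _ (normalCore_le _ h3))
  have hdvd := hemb.card
  have hA3 : 3 ∣ Nat.card A := by
    have := Subgroup.orderOf_dvd_natCard A hsA
    rwa [orderOf_eq_prime hs3 hs1] at this
  have hC4 : 4 ∣ Nat.card C := by
    have := hcj (Nat.card C) (by
      rw [zpow_natCast, pow_card_mem hcC]; exact one_mem _)
    exact_mod_cast this
  rw [p.card] at hdvd
  obtain ⟨i, hi⟩ := hA3
  obtain ⟨k, hk⟩ := hC4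
  have : i * k ∣ 1 := by
    rw [hi, hk] at hdvd
    have e : 2 * (3 * i) * (4 * k) = 24 * (i * k) := by ring
    rw [e] at hdvd
    exact Nat.dvd_of_mul_dvd_mul_left (by norm_num : 0 < 24) (by simpa using hdvd)
  have h1 := Nat.eq_one_of_mul_eq_one_right (Nat.dvd_one.1 this)
  have h2 := Nat.eq_one_of_mul_eq_one_left (Nat.dvd_one.1 this)
  refine ⟨by rw [hi]; omega, by rw [hk]; omega, hemb⟩
end SD

namespace SD
universe u
set_option linter.unusedVariables false
set_option linter.style.multiGoal false
set_option linter.unusedSimpArgs false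
variable {X : Type u} [Group X] {A H C U : Subgroup X} {c u v w : X}

structure D8 (A H C : Subgroup X) (c u v w : X) : Prop where
  hc : C = zpowers c
  huA : u ∈ A
  hu1 : u ≠ 1
  hu2 : u ^ 2 = 1
  hv2 : v ^ 2 = 1
  cu : c * u * c⁻¹ = v
  cv : c * v * c⁻¹ = u
  huv : u * v = v * u
  hw : w = u * v
  hwC : w ∉ C
  hH : ∀ h ∈ H, h * u * h⁻¹ = u
  hHv : ∀ h ∈ H, h * v * h⁻¹ = v
  cen : ∀ g, g * w = w * g

theorem lemma5a [Finite X] (p : Sys A H C) (hc : C = zpowers c) (hD : CondD8 A C c) :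
    ∃ u v w, D8 A H C c u v w := by
  obtain ⟨u, huA, hu1, hu2, hcl, hqC, hpC⟩ := hD
  obtain ⟨hUn, hsq, hH, hcj⟩ := uBase p huA hu1 hu2 hcl
  have hcC : c ∈ C := hc ▸ mem_zpowers c
  have hCU : ∀ g, (∀ d ∈ C, g * (d * u * d⁻¹) * g⁻¹ = d * u * d⁻¹) →
      ∀ x ∈ closure {y | ∃ d ∈ C, y = d * u * d⁻¹}, g * x * g⁻¹ = x := by
    intro g hg x hx
    induction hx using closure_induction with
    | mem x hx => obtain ⟨d, hd, rfl⟩ := hx; exact hg d hd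
    | one => simp
    | mul x y _ _ hx hy => rw [conjM, hx, hy]
    | inv x _ hx => rw [← conj_inv, hx]
  have hdU : ∀ d ∈ C, d * u * d⁻¹ ∈ closure {y | ∃ d ∈ C, y = d * u * d⁻¹} := fun d hd =>
    subset_closure ⟨d, hd, rfl⟩
  have huU : u ∈ closure {y | ∃ d ∈ C, y = d * u * d⁻¹} := by simpa using hdU 1 (one_mem _)
  generalize hUdef : closure {y | ∃ d ∈ C, y = d * u * d⁻¹} = U at *
  have hcomm : ∀ x ∈ U, ∀ y ∈ U, x * y = y * x := fun x hx y hy =>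
    comm_of_sq (hsq x hx) (hsq y hy) (hsq _ (mul_mem hx hy))
  obtain ⟨v, cu⟩ : ∃ v, v = c * u * c⁻¹ := ⟨_, rfl⟩
  rw [← cu] at hpC
  have hvU : v ∈ U := cu ▸ hdU c hcC
  obtain ⟨q, hq⟩ : ∃ q, q = u * (c ^ 2 * u * (c ^ 2)⁻¹) := ⟨_, rfl⟩
  rw [← hq] at hqC
  have hqU : q ∈ U := hq ▸ mul_mem huU (hdU _ (pow_mem hcC 2))
  have huv := hcomm u huU v hvU
  have huq := hcomm u huU q hqU
  have hvq := hcomm v hvU q hqU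
  have hv2 := hsq v hvU
  have hq2 := hsq q hqU
  have cv : c * v * c⁻¹ = u * q := by
    have h1 : u * q = c ^ 2 * u * (c ^ 2)⁻¹ := by rw [hq, ← mul_assoc, ← pow_two, hu2, one_mul]
    rw [h1, pow_two, conjC, ← cu]
  have cq : c * q * c⁻¹ = q := by rw [conj_iff_comm]; exact p.Ccomm hcC hqC
  have a1 : u * u = 1 := by rw [← pow_two, hu2]
  have a2 : v * v = 1 := by rw [← pow_two, hv2]
  have a3 : q * q = 1 := by rw [← pow_two, hq2]
  have b1 : ∀ x, u * (u * x) = x := fun x => by rw [← mul_assoc, a1, one_mul]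
  have b2 : ∀ x, v * (v * x) = x := fun x => by rw [← mul_assoc, a2, one_mul]
  have b3 : ∀ x, q * (q * x) = x := fun x => by rw [← mul_assoc, a3, one_mul]
  have b4 : ∀ x, v * (u * x) = u * (v * x) := fun x => by rw [← mul_assoc, ← huv, mul_assoc]
  have b5 : ∀ x, q * (u * x) = u * (q * x) := fun x => by rw [← mul_assoc, ← huq, mul_assoc]
  have b6 : ∀ x, q * (v * x) = v * (q * x) := fun x => by rw [← mul_assoc, ← hvq, mul_assoc]
  have orb : ∀ g, g * u * g⁻¹ = u ∨ g * u * g⁻¹ = v ∨ g * u * g⁻¹ = u * q ∨ g * u * g⁻¹ = v * q := by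
    have key : ∀ x, x = u ∨ x = v ∨ x = u * q ∨ x = v * q →
      c * x * c⁻¹ = u ∨ c * x * c⁻¹ = v ∨ c * x * c⁻¹ = u * q ∨ c * x * c⁻¹ = v * q := by
      rintro x (rfl | rfl | rfl | rfl)
      · right; left; exact cu.symm
      · right; right; left; exact cv
      · right; right; right; rw [conjM, cq, ← cu]
      · left; rw [conjM, cv, cq, mul_assoc, a3, mul_one]
    have key2 : ∀ n : ℕ, c ^ n * u * (c ^ n)⁻¹ = u ∨ c ^ n * u * (c ^ n)⁻¹ = v ∨
        c ^ n * u * (c ^ n)⁻¹ = u * q ∨ c ^ n * u * (c ^ n)⁻¹ = v * q := by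
      intro n
      induction n with
      | zero => left; simp
      | succ n ih => rw [pow_succ', conjC]; exact key _ ih
    intro g
    obtain ⟨d, hd, e⟩ := hcj g
    rw [hc, ← mem_powers_iff_mem_zpowers] at hd
    obtain ⟨n, rfl⟩ := hd
    rw [e]; exact key2 n
  have hq1 : q = 1 := by
    by_contra hq1
    obtain ⟨h, hh, hhA, y, hy, d, hd, e⟩ := p.L5 (N := centralizer (U : Set X)) inferInstance (fun hcon => by
      have : u ∈ C := hcon (by
        rw [mem_centralizer_iff]; intro x hx; exact hcomm x hx u huU)
      exact hu1 (p.dis u (p.AH huA) this))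
    have hyU : ∀ x ∈ U, y * x * y⁻¹ = x := fun x hx => by
      rw [conj_iff_comm]; exact (mem_centralizer_iff.1 hy x hx).symm
    have hdu : d * u * d⁻¹ = u := by
      have h1 := hH h hh
      rw [e, conjC] at h1
      exact conj_inj' (h1.trans (hyU u huU).symm)
    have hdU' : ∀ x ∈ U, d * x * d⁻¹ = x := hCU d (fun d' hd' => by
      rw [← conjC, p.Ccomm hd hd', conjC, hdu])
    have hhU : ∀ x ∈ U, h * x * h⁻¹ = x := fun x hx => by
      rw [e, conjC, hdU' x hx, hyU x hx]
    obtain ⟨a, ha⟩ := p.gA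
    have haA : a ∈ A := ha ▸ mem_zpowers a
    have ha4 : ∀ x ∈ U, a ^ 4 * x * (a ^ 4)⁻¹ = x := by
      intro x hx
      have e1 : a ^ 4 = a ^ 2 * (h * a⁻¹ ^ 2 * h⁻¹) := by
        rw [p.inv h hh hhA _ (inv_mem haA)]; group
      have e2 : a ^ 4 = a ^ 2 * (h * (a⁻¹ ^ 2 * h⁻¹)) := by rw [e1]; group
      have h1 : h⁻¹ * x * h⁻¹⁻¹ = x := by
        rw [conj_iff_comm]; exact (show Commute h x from conj_iff_comm.1 (hhU x hx)).inv_left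
      rw [e2, conjC, conjC, conjC, h1, hhU _ (hUn.conj_mem x hx _), ← conjC]
      simp
    have hV : ∀ x, (x = q ∨ x = u * v ∨ x = u * v * q) → ∀ g, g * x * g⁻¹ = q ∨ g * x * g⁻¹ = u * v ∨
        g * x * g⁻¹ = u * v * q := by
      intro x hx g
      have hx' : ∃ g1 g2, x = (g1 * u * g1⁻¹) * (g2 * u * g2⁻¹) := by
        rcases hx with rfl | rfl | rfl
        · exact ⟨1, c ^ 2, by simpa using hq⟩
        · exact ⟨1, c, by rw [← cu]; simp⟩
        · refine ⟨c, c ^ 2, ?_⟩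
          have h1 : u * q = c ^ 2 * u * (c ^ 2)⁻¹ := by rw [hq, ← mul_assoc, ← pow_two, hu2, one_mul]
          rw [← cu, ← h1, ← mul_assoc, huv]
      have hxn : g * x * g⁻¹ ≠ 1 := by
        intro h1
        have h2 : x = 1 := by simpa using h1
        rcases hx with rfl | rfl | rfl
        · exact hq1 h2
        · exact hpC (h2 ▸ one_mem _)
        · exact hpC ((mul_mem_cancel_right hqC).1 (h2 ▸ one_mem _))
      obtain ⟨g1, g2, rfl⟩ := hx'
      rw [conjM, ← conjC, ← conjC] at hxn ⊢
      rcases orb (g * g1) with h1 | h1 | h1 | h1 <;> rcases orb (g * g2) with h2 | h2 | h2 | h2 <;>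
        rw [h1, h2] at hxn ⊢ <;>
        simp only [mul_assoc, a1, a2, a3, b1, b2, b3, b4, b5, b6, ← huv, ← huq, ← hvq, mul_one] at hxn ⊢ <;>
        simp at hxn ⊢
    have hqq := hV q (Or.inl rfl) a
    have cp : c * (u * v) * c⁻¹ = u * v * q := by
      rw [conjM, cv, ← cu, ← mul_assoc, huv]
    have cpq : c * (u * v * q) * c⁻¹ = u * v := by
      rw [conjM, cp, cq, mul_assoc, a3, mul_one]
    have hne1 : u * v ≠ q := fun h => hpC (h ▸ hqC)
    have hne2 : u * v * q ≠ q := fun h => hpC (by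
      rw [show u * v = 1 by simpa using h]; exact one_mem _)
    have hne3 : u * v * q ≠ u * v := fun h => hq1 (by simpa using h)
    have hHact : ∀ S : Set X, q ∈ S → (∀ x ∈ S, x ∈ U) → (∀ x ∈ S, a * x * a⁻¹ ∈ S) →
        ∀ g, g * q * g⁻¹ ∈ S := by
      intro S hS hSU hSa g
      obtain ⟨x, hx, d, hd, rfl⟩ := p.HC g
      have h1 : d * q * d⁻¹ = q := by rw [conj_iff_comm]; exact p.Ccomm hd hqC
      rw [conjC, h1]
      have hA : ∀ x ∈ A, x * q * x⁻¹ ∈ S := by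
        intro x hx
        rw [ha, ← mem_powers_iff_mem_zpowers] at hx
        obtain ⟨n, rfl⟩ := hx
        simp only
        clear h1
        induction n with
        | zero => simpa using hS
        | succ n ih => rw [pow_succ', conjC]; exact hSa _ ih
      by_cases hxA : x ∈ A
      · exact hA x hxA
      · have := hA _ (p.two x hx h hh hxA hhA)
        rwa [conjC, hhU q hqU] at this
    have e4 := ha4 q hqU
    rw [show a ^ 4 = a * (a * (a * a)) by simp only [pow_succ, pow_zero, one_mul, mul_assoc], conjC, conjC, conjC] at e4
    have fin : ∀ q' q'', q' ∈ U → a * q * a⁻¹ = q' → c * q' * c⁻¹ = q'' → q'' ≠ q → q'' ≠ q' →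
        q' ≠ q → q'' = q' * q → (a * q' * a⁻¹ = q ∨ a * q' * a⁻¹ = q' ∨ a * q' * a⁻¹ = q'') → False := by
      intro q' q'' hqU' h1 h2 h3 h4 h5 h6 h7
      rcases h7 with h7 | h7 | h7
      · have := hHact {q, q'} (by simp) (by simp [hqU, hqU']) (by simp [h1, h7]) (c * a)
        rw [conjC, h1, h2] at this
        rcases this with h | h
        · exact h3 h
        · exact h4 h
      · exact h5 (conj_inj' (h7.trans h1.symm))
      · rw [h1, h7, h6, conjM a q' q, h7, h1, h6, mul_assoc q' q q', hcomm q hqU q' hqU', ← mul_assoc q' q' q, ← pow_two, hsq q' hqU', one_mul, h1] at e4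
        exact h5 e4
    rcases hqq with h1 | h1 | h1
    · have := hHact {q} (by simp) (by simpa using hqU) (by simpa using h1)
      refine hq1 (p.core_elt hqC fun g => ?_)
      rw [show g * q * g⁻¹ = q from this g]; exact mem_zpowers q
    · exact fin (u * v) (u * v * q) (mul_mem huU hvU) h1 cp hne2 hne3 hne1 rfl
        (hV _ (Or.inr (Or.inl rfl)) a)
    · refine fin (u * v * q) (u * v) (mul_mem (mul_mem huU hvU) hqU) h1 cpq hne1 hne3.symm hne2 ?_ ?_
      · rw [mul_assoc, a3, mul_one]
      · rcases hV _ (Or.inr (Or.inr rfl)) a with h | h | h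
        · exact Or.inl h
        · exact Or.inr (Or.inr h)
        · exact Or.inr (Or.inl h)
  subst hq1
  have orb' : ∀ g, g * u * g⁻¹ = u ∨ g * u * g⁻¹ = v := fun g => by
    have h0 := orb g
    rw [mul_one, mul_one] at h0
    rcases h0 with h | h | h | h
    · exact Or.inl h
    · exact Or.inr h
    · exact Or.inl h
    · exact Or.inr h
  have hvu : v ≠ u := by
    rintro rfl
    exact hpC (a1 ▸ one_mem _)
  have hHv : ∀ h ∈ H, h * v * h⁻¹ = v := by
    intro h hh
    have h1 := orb' (h * c)
    rw [conjC, ← cu] at h1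
    exact h1.resolve_left fun h2 => hvu (conj_inj' (h2.trans (hH h hh).symm))
  rw [mul_one] at cv
  refine ⟨u, v, u * v, hc, huA, hu1, hu2, hv2, cu.symm, cv, huv, rfl, hpC, hH, hHv, ?_⟩
  intro g
  rw [← conj_iff_comm]
  obtain ⟨h, hh, d, hd, rfl⟩ := p.HC g
  have h1 : c * (u * v) * c⁻¹ = u * v := by rw [conjM, cv, ← cu, huv]
  have h2 : d * (u * v) * d⁻¹ = u * v := by
    rw [hc, mem_zpowers_iff] at hd
    obtain ⟨j, rfl⟩ := hd
    rw [conj_iff_comm] at h1 ⊢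
    exact (show Commute c (u * v) from h1).zpow_left j
  rw [conjC, h2, conjM, hH h hh, hHv h hh]
end SD

namespace SD
universe u
set_option linter.unusedVariables false
set_option linter.style.multiGoal false
set_option linter.unusedSimpArgs false
variable {X : Type u} [Group X] {A H C U : Subgroup X} {c u v w : X}

namespace D8

theorem hw2 (k : D8 A H C c u v w) : w ^ 2 = 1 := by
  rw [k.hw, (show Commute u v from k.huv).mul_pow, k.hu2, k.hv2, one_mul]

theorem hw1 (k : D8 A H C c u v w) : w ≠ 1 := fun h => k.hwC (h ▸ one_mem _)

theorem hvu (k : D8 A H C c u v w) : v ≠ u := fun h => k.hw1 (by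
  rw [k.hw, h, ← pow_two, k.hu2])

theorem hv1 (k : D8 A H C c u v w) : v ≠ 1 := fun h => k.hu1 (by
  have := k.cv; rw [h] at this; simpa using this.symm)

/-- the central involution `w` lies in `H` outside `A` -/
theorem wH [Finite X] (k : D8 A H C c u v w) (p : Sys A H C) : w ∈ H ∧ w ∉ A := by
  have hcC : c ∈ C := k.hc ▸ mem_zpowers c
  have hwn : (zpowers w).Normal := zpowers_normal (fun g => by
    rw [conj_iff_comm.2 (k.cen g)]; exact mem_zpowers w)
  obtain ⟨z, hzH, hzA, w', hw', e, he, hz⟩ := p.L5 hwn (fun h => k.hwC (h (mem_zpowers w)))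
  have hww : w' = 1 ∨ w' = w := invol_uniq ⟨w, rfl⟩ (mem_zpowers w) k.hw1 k.hw2 hw' (by
    rw [mem_zpowers_iff] at hw'
    obtain ⟨j, rfl⟩ := hw'
    rw [← zpow_natCast, ← zpow_mul, mul_comm, zpow_mul, zpow_natCast, k.hw2, one_zpow])
  have hzw : z = w * e := by
    rcases hww with rfl | rfl
    · rw [one_mul] at hz
      exact absurd (p.dis z hzH (hz ▸ he) ▸ one_mem _) hzA
    · exact hz
  clear hww hz hw'
  have hwe : e * w = w * e := k.cen e
  have hz2' : z ^ 2 = e ^ 2 := by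
    rw [hzw, (show Commute w e from hwe.symm).mul_pow, k.hw2, one_mul]
  have hz2 : z ^ 2 = 1 := p.dis _ (pow_mem hzH 2) (hz2' ▸ pow_mem he 2)
  have he2 : e ^ 2 = 1 := by rw [← hz2', hz2]
  have hzi := sq_eq_one_iff' hz2
  have hei := sq_eq_one_iff' he2
  have hwi := sq_eq_one_iff' k.hw2
  have hez : e = w * z := by rw [hzw, ← mul_assoc, ← pow_two, k.hw2, one_mul]
  let T : Subgroup X := {
    carrier := {t | t ∈ A ∧ e * t * e⁻¹ = t⁻¹}
    mul_mem' := by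
      rintro s t ⟨h1, h3⟩ ⟨h4, h6⟩
      refine ⟨mul_mem h1 h4, ?_⟩
      rw [conjM, h3, h6, p.toPair.comm h1 h4, mul_inv_rev]
    one_mem' := ⟨one_mem _, by simp⟩
    inv_mem' := by
      rintro t ⟨h4, h6⟩
      refine ⟨inv_mem h4, ?_⟩
      rw [← conj_inv, h6] }
  have hT : ∀ t ∈ T, t ∈ A ∧ e * t * e⁻¹ = t⁻¹ := fun t h => h
  have hzT : ∀ t, z * t * z⁻¹ = e * t * e⁻¹ := fun t => by
    rw [hzw, conjC, conj_iff_comm.2 (k.cen _).symm]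
  have hyz : ∀ h, h * z * h⁻¹ * z⁻¹ = h * e * h⁻¹ * e⁻¹ := fun h => by
    rw [hzw, conjM, conj_iff_comm.2 (k.cen h), mul_inv_rev, ← mul_assoc, mul_assoc w, ← k.cen,
      mul_assoc _ w, ← k.cen, ← mul_assoc, inv_mul_cancel_right]
  have hyT : ∀ h ∈ H, h * e * h⁻¹ * e⁻¹ ∈ T := by
    intro h hh
    refine ⟨?_, ?_⟩
    · rw [← hyz]
      have e1 : h * z * h⁻¹ * z⁻¹ = (h * z) * (h⁻¹ * z⁻¹) := by group
      rw [e1]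
      by_cases hA : h ∈ A
      · refine p.two _ (mul_mem hh hzH) _ (mul_mem (inv_mem hh) (inv_mem hzH)) ?_ ?_
        · exact p.toPair.mul_nmem hA hzA
        · exact p.toPair.mul_nmem (inv_mem hA) (fun h => hzA (inv_mem_iff.1 h))
      · refine mul_mem (p.two _ hh _ hzH hA hzA) (p.two _ (inv_mem hh) _ (inv_mem hzH) ?_ ?_)
        · exact (fun h => hA (inv_mem_iff.1 h))
        · exact (fun h => hzA (inv_mem_iff.1 h))
    · have : (h * e * h⁻¹ * e⁻¹)⁻¹ = e * h * e⁻¹ * h⁻¹ := by group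
      rw [this]
      calc e * (h * e * h⁻¹ * e⁻¹) * e⁻¹ = e * h * e * h⁻¹ * (e ^ 2)⁻¹ := by rw [pow_two]; group
        _ = e * h * e⁻¹ * h⁻¹ := by rw [he2, hei]; simp
  let N : Subgroup X := closure {w | ∃ g, w = g * e * g⁻¹}
  have hNn : N.Normal := by
    refine ⟨fun x hx g => closure_conj ?_ hx⟩
    rintro s ⟨g', rfl⟩
    rw [← conjC]; exact subset_closure ⟨_, rfl⟩
  have heN : e ∈ N := subset_closure ⟨1, by simp⟩
  have form : ∀ x ∈ N, ∃ t ∈ T, x = t ∨ x = t * e := by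
    intro x hx
    induction hx using closure_induction with
    | mem x hx =>
      obtain ⟨g, rfl⟩ := hx
      obtain ⟨h, hh, d, hd, rfl⟩ := p.HC g
      refine ⟨_, hyT h hh, Or.inr ?_⟩
      have h1 : d * e * d⁻¹ = e := by rw [conj_iff_comm]; exact p.Ccomm hd he
      rw [conjC, h1]; group
    | one => exact ⟨1, one_mem _, Or.inl (by simp)⟩
    | mul x y _ _ hx hy =>
      obtain ⟨t1, ht1, hx⟩ := hx
      obtain ⟨t2, ht2, hy⟩ := hy
      have q3 : e * t2 = t2⁻¹ * e := by rw [← mul_inv_eq_iff_eq_mul]; exact (hT t2 ht2).2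
      rcases hx with rfl | rfl <;> rcases hy with rfl | rfl
      · exact ⟨_, mul_mem ht1 ht2, Or.inl rfl⟩
      · exact ⟨_, mul_mem ht1 ht2, Or.inr (by group)⟩
      · refine ⟨_, mul_mem ht1 (inv_mem ht2), Or.inr ?_⟩
        rw [mul_assoc, q3]; group
      · refine ⟨_, mul_mem ht1 (inv_mem ht2), Or.inl ?_⟩
        rw [mul_assoc, ← mul_assoc e, q3, mul_assoc _ e e, ← pow_two, he2, mul_one]
    | inv x _ hx =>
      obtain ⟨t1, ht1, hx⟩ := hx
      have q3 : e * t1⁻¹ = t1 * e := by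
        rw [← mul_inv_eq_iff_eq_mul]
        have := (hT _ (inv_mem ht1)).2; rwa [inv_inv] at this
      rcases hx with rfl | rfl
      · exact ⟨_, inv_mem ht1, Or.inl rfl⟩
      · exact ⟨_, ht1, Or.inr (by rw [mul_inv_rev, hei, q3])⟩
  have hNsq := p.sqA hNn (by
    intro x hx
    obtain ⟨t, ht, h | h⟩ := form x hx
    · rw [h]; exact pow_mem (hT t ht).1 2
    · have q3 : e * t = t⁻¹ * e := by rw [← mul_inv_eq_iff_eq_mul]; exact (hT t ht).2
      have : x ^ 2 = 1 := by
        calc x ^ 2 = t * (e * t) * e := by rw [h, pow_two]; group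
          _ = e ^ 2 := by rw [q3, pow_two]; group
          _ = 1 := he2
      rw [this]; exact one_mem _)
  have hN4 : ∀ x ∈ N, x = 1 ∨ x = u ∨ x = e ∨ x = u * e := by
    intro x hx
    obtain ⟨t, ht, h⟩ := form x hx
    have htN : t ∈ N := by
      rcases h with h | h
      · exact h ▸ hx
      · exact (mul_mem_cancel_right heN).1 (h ▸ hx)
    rcases invol_uniq p.gA k.huA k.hu1 k.hu2 (hT t ht).1 (hNsq t htN) with rfl | rfl <;>
      rcases h with h | h <;> simp [h]
  have huN : u ∉ N := by
    intro hu
    have hv : v ∈ N := by rw [← k.cu]; exact hNn.conj_mem _ hu c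
    rcases hN4 v hv with h | h | h | h
    · exact k.hv1 h
    · exact k.hvu h
    · have h1 := k.cv
      rw [conj_iff_comm.2 (p.Ccomm hcC (h ▸ he))] at h1
      exact k.hvu h1
    · refine k.hwC ?_
      rw [k.hw, h, ← mul_assoc, ← pow_two, k.hu2, one_mul]; exact he
  have hcen : ∀ h ∈ H, h * e * h⁻¹ = e := by
    intro h hh
    have h1 := hyT h hh
    have h2 : h * e * h⁻¹ * e⁻¹ ∈ N := mul_mem (hNn.conj_mem e heN h) (inv_mem heN)
    rcases invol_uniq p.gA k.huA k.hu1 k.hu2 (hT _ h1).1 (hNsq _ h2) with h3 | h3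
    · rwa [mul_inv_eq_one] at h3
    · exact absurd (h3 ▸ h2) huN
  have he1 : e = 1 := by
    refine p.core_elt he (fun g => ?_)
    obtain ⟨h, hh, d, hd, rfl⟩ := p.HC g
    rw [conjC, conj_iff_comm.2 (p.Ccomm hd he), hcen h hh]; exact mem_zpowers e
  rw [he1, mul_one] at hzw
  exact hzw ▸ ⟨hzH, hzA⟩

/-- elements commuting with a generator of A and with C, normalising -/
theorem topN [Finite X] (k : D8 A H C c u v w) (p : Sys A H C) {a : X} (ha : A = zpowers a) {N : Subgroup X}
    (h1 : a ∈ N) (h2 : w ∈ N) (h3 : c ∈ N) : N = ⊤ := by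
  rw [eq_top_iff']
  have hA : A ≤ N := by rw [ha, zpowers_le]; exact h1
  have hC : C ≤ N := by rw [k.hc, zpowers_le]; exact h3
  obtain ⟨hwH, hwA⟩ := k.wH p
  intro x
  obtain ⟨h, hh, d, hd, rfl⟩ := p.HC x
  refine mul_mem ?_ (hC hd)
  by_cases hhA : h ∈ A
  · exact hA hhA
  · exact (mul_mem_cancel_right h2).1 (hA (p.two h hh w hwH hhA hwA))

theorem coreElt [Finite X] (k : D8 A H C c u v w) (p : Sys A H C) {a q : X} (ha : A = zpowers a) (hq : q ∈ C)
    (h : a * q * a⁻¹ ∈ zpowers q) : q = 1 := by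
  have hcC : c ∈ C := k.hc ▸ mem_zpowers c
  refine p.core_elt hq (fun g => ?_)
  have := k.topN p ha (N := normalizer (zpowers q : Set X)) (norm_gen h)
    (norm_gen (by rw [conj_iff_comm.2 (k.cen q).symm]; exact mem_zpowers q))
    (norm_gen (by rw [conj_iff_comm.2 (p.Ccomm hcC hq)]; exact mem_zpowers q))
  exact (mem_normalizer_iff.1 (this ▸ mem_top g : g ∈ normalizer (zpowers q : Set X)) q).1 (mem_zpowers q)

theorem a4 [Finite X] (k : D8 A H C c u v w) (p : Sys A H C) {a : X} (ha : a ∈ A) : a ^ 4 = 1 := by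
  obtain ⟨hwH, hwA⟩ := k.wH p
  have := p.inv w hwH hwA a ha
  rw [conj_iff_comm.2 (k.cen _).symm, eq_inv_iff_mul_eq_one, ← pow_add] at this
  exact this

theorem c2u (k : D8 A H C c u v w) : c ^ 2 * u * (c ^ 2)⁻¹ = u := by
  rw [pow_two, conjC, k.cu, k.cv]

theorem dfix (k : D8 A H C c u v w) {d : X} (hd : d ∈ C) (h : d * u * d⁻¹ = u) : d ∈ zpowers (c ^ 2) := by
  rw [k.hc, mem_zpowers_iff] at hd
  obtain ⟨j, rfl⟩ := hd
  have e2 : ∀ i : ℤ, c ^ (2 * i) ∈ zpowers (c ^ 2) := fun i => by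
    rw [zpow_mul]; exact zpow_mem (by exact_mod_cast mem_zpowers _) i
  rcases Int.even_or_odd' j with ⟨i, rfl | rfl⟩
  · exact e2 i
  · exfalso
    have h1 : c ^ (2 * i) * v * (c ^ (2 * i))⁻¹ = u := by rw [zpow_add, zpow_one, conjC, k.cu] at h; exact h
    have h2 : c ^ (2 * i) * u * (c ^ (2 * i))⁻¹ = u := by
      rw [conj_iff_comm, zpow_mul]
      exact (show Commute (c ^ (2 : ℤ)) u by exact_mod_cast conj_iff_comm.1 k.c2u).zpow_left i
    exact k.hvu (conj_inj' (h1.trans h2.symm))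

theorem main2 [Finite X] (k : D8 A H C c u v w) (p : Sys A H C) {a : X} (ha : A = zpowers a)
    (ha2 : a ^ 2 = 1) : Nat.card A = 2 ∧ Nat.card C = 2 := by
  have haA : a ∈ A := ha ▸ mem_zpowers a
  have hcC : c ∈ C := k.hc ▸ mem_zpowers c
  have hau : a = u := by
    rcases invol_uniq p.gA k.huA k.hu1 k.hu2 haA ha2 with h | h
    · have := k.huA
      rw [ha, h, zpowers_one_eq_bot, mem_bot] at this
      exact absurd this k.hu1
    · exact h
  have hc2 : c ^ 2 = 1 := k.coreElt p ha (pow_mem hcC 2) (by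
    rw [hau, conj_iff_comm.2 (conj_iff_comm.1 k.c2u).symm]; exact mem_zpowers _)
  constructor
  · rw [ha, Nat.card_zpowers]; exact orderOf_eq_prime ha2 (hau ▸ k.hu1)
  · rw [k.hc, Nat.card_zpowers]
    refine orderOf_eq_prime hc2 ?_
    intro h
    have := k.cu
    rw [h] at this
    exact k.hvu (by simpa using this.symm)

theorem main4 [Finite X] (k : D8 A H C c u v w) (p : Sys A H C) {a : X} (ha : A = zpowers a)
    (ha2 : a ^ 2 ≠ 1) : a ^ 2 = u ∧ Nat.card A = 4 ∧ Nat.card C = 4 ∧ a * c ^ 2 * a⁻¹ = w * c ^ 2 := by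
  have haA : a ∈ A := ha ▸ mem_zpowers a
  have hcC : c ∈ C := k.hc ▸ mem_zpowers c
  obtain ⟨hwH, hwA⟩ := k.wH p
  have ha4 := k.a4 p haA
  have hau : a ^ 2 = u := (invol_uniq p.gA k.huA k.hu1 k.hu2 (pow_mem haA 2) (by
    rw [← pow_mul]; exact ha4)).resolve_left ha2
  have hA4 : Nat.card A = 4 := by
    rw [ha, Nat.card_zpowers]
    exact orderOf_eq_prime_pow (p := 2) (n := 1) ha2 ha4
  refine ⟨hau, hA4, ?_⟩
  have hc2n : c ^ 2 ≠ 1 := by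
    intro hc2
    have hHn : H.Normal := by
      have hcinv := sq_eq_one_iff' hc2
      refine normal_of_two (a := c) (fun x => ?_)
      obtain ⟨d, hd, h, hh, rfl⟩ := p.CH x
      rw [k.hc, mem_zpowers_iff] at hd
      obtain ⟨j, rfl⟩ := hd
      rcases Int.even_or_odd' j with ⟨i, rfl | rfl⟩
      · left; rw [zpow_mul, show c ^ (2 : ℤ) = 1 by exact_mod_cast hc2]; simpa using hh
      · right
        rw [zpow_add, zpow_mul, show c ^ (2 : ℤ) = 1 by exact_mod_cast hc2]; simpa using hh
    have h1 : v ∈ A := by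
      rw [← k.cu, ← hau, ← conj_pow]
      exact p.toPair.sq (hHn.conj_mem a (p.AH haA) c)
    rcases invol_uniq p.gA k.huA k.hu1 k.hu2 h1 k.hv2 with h | h
    · exact k.hv1 h
    · exact k.hvu h
  let U : Subgroup X := closure {u, v}
  have hUm : ∀ x ∈ U, x = 1 ∨ x = u ∨ x = v ∨ x = u * v := fun x hx =>
    mem_klein k.hu2 k.hv2 k.huv (by rintro s (rfl | rfl) <;> simp) hx
  have huU : u ∈ U := subset_closure (by simp)
  have hvU : v ∈ U := subset_closure (by simp)
  have hUn : U.Normal := by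
    have h1 : ∀ h ∈ H, ∀ x ∈ U, h * x * h⁻¹ ∈ U := by
      intro h hh x hx
      refine closure_conj ?_ hx
      rintro s (rfl | rfl)
      · rw [k.hH h hh]; exact huU
      · rw [k.hHv h hh]; exact hvU
    have h2 : U.Normal ∨ True := Or.inr trivial
    have h3 : normalizer (U : Set X) = ⊤ := by
      have m : ∀ h, (∀ x ∈ U, h * x * h⁻¹ ∈ U) → h ∈ normalizer (U : Set X) := fun h hh =>
        mem_normalizer_fintype (fun n hn => hh n hn)
      refine k.topN p ha (m a (h1 a (p.AH haA))) (m w (h1 w hwH)) (m c fun x hx => closure_conj ?_ hx)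
      rintro s (rfl | rfl)
      · rw [k.cu]; exact hvU
      · rw [k.cv]; exact huU
    exact normalizer_eq_top_iff.1 h3
  have htwo : ∀ x, x ∈ U ⊔ C ∨ a⁻¹ * x ∈ U ⊔ C := by
    have ha2K : a ^ 2 ∈ U ⊔ C := mem_sup_left (hau ▸ huU)
    have hwK : w ∈ U ⊔ C := mem_sup_left (k.hw ▸ mul_mem huU hvU)
    have hAK : ∀ x ∈ A, x ∈ U ⊔ C ∨ a⁻¹ * x ∈ U ⊔ C := by
      intro x hx
      rw [ha, mem_zpowers_iff] at hx
      obtain ⟨j, rfl⟩ := hx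
      have e2 : ∀ i : ℤ, a ^ (2 * i) ∈ U ⊔ C := fun i => by
        rw [zpow_mul]; exact zpow_mem (by exact_mod_cast ha2K) i
      rcases Int.even_or_odd' j with ⟨i, rfl | rfl⟩
      · exact Or.inl (e2 i)
      · right; rw [add_comm, zpow_add, zpow_one, inv_mul_cancel_left]; exact e2 i
    intro x
    obtain ⟨h, hh, d, hd, rfl⟩ := p.HC x
    have hdK : d ∈ U ⊔ C := mem_sup_right hd
    rw [← mul_assoc, mul_mem_cancel_right hdK, mul_mem_cancel_right hdK]
    by_cases hA : h ∈ A
    · exact hAK h hA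
    · have := hAK (h * w) (p.two _ hh _ hwH hA hwA)
      rwa [← mul_assoc, mul_mem_cancel_right hwK, mul_mem_cancel_right hwK] at this
  have hKn : (U ⊔ C).Normal := normal_of_two htwo
  have hcu := conj_iff_comm.1 k.c2u
  have hcv : c ^ 2 * v = v * c ^ 2 := by
    rw [← conj_iff_comm, pow_two, conjC, k.cv, k.cu]
  have hcU : ∀ x ∈ U, c ^ 2 * x = x * c ^ 2 := by
    intro x hx
    rcases hUm x hx with rfl | rfl | rfl | rfl
    · simp
    · exact hcu
    · exact hcv
    · exact (show Commute (c ^ 2) u from hcu).mul_right hcv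
  have hcK : ∀ x ∈ U ⊔ C, c ^ 2 * x * (c ^ 2)⁻¹ = x := by
    intro x hx
    rw [← SetLike.mem_coe, Subgroup.normal_mul] at hx
    obtain ⟨y, hy, d, hd, rfl⟩ := hx
    simp only
    rw [conjM, conj_iff_comm.2 (hcU y hy), conj_iff_comm.2 (p.Ccomm (pow_mem hcC 2) hd)]
  have hgK : ∀ x ∈ U ⊔ C, (a * c ^ 2 * a⁻¹) * x * (a * c ^ 2 * a⁻¹)⁻¹ = x := by
    intro x hx
    have := hKn.conj_mem x hx a⁻¹
    rw [conjC, conjC, hcK _ this, ← conjC]; simp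
  obtain ⟨t, ht, d, hd, hcd, htd⟩ : ∃ t, (t = 1 ∨ t = w) ∧ ∃ d ∈ C, d ∈ zpowers (c ^ 2) ∧ a * c ^ 2 * a⁻¹ = t * d := by
    have h1 : a * c ^ 2 * a⁻¹ ∈ U ⊔ C := hKn.conj_mem _ (mem_sup_right (pow_mem hcC 2)) a
    have h2 := hgK c (mem_sup_right hcC)
    have h3 := hgK u (mem_sup_left huU)
    rw [← SetLike.mem_coe, Subgroup.normal_mul] at h1
    obtain ⟨y, hy, d, hd, e⟩ := h1
    simp only at e
    rw [← e, conjC] at h2 h3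
    rw [conj_iff_comm.2 (p.Ccomm hd hcC)] at h2
    have hyu : y * u * y⁻¹ = u := by
      rw [conj_iff_comm]
      rcases hUm y hy with rfl | rfl | rfl | rfl
      · simp
      · rfl
      · exact k.huv.symm
      · exact (show Commute (u * v) u from (Commute.refl u).mul_left k.huv.symm)
    refine ⟨y, ?_, d, hd, k.dfix hd (conj_inj' (h3.trans hyu.symm)), e.symm⟩
    have h4 : c * y * c⁻¹ = y := by
      rw [conj_iff_comm]; exact (conj_iff_comm.1 h2).symm
    rcases hUm y hy with rfl | rfl | rfl | rfl
    · simp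
    · rw [k.cu] at h4; exact absurd h4 k.hvu
    · rw [k.cv] at h4; exact absurd h4.symm k.hvu
    · right; exact k.hw.symm
  have ht2 : t ^ 2 = 1 := by
    rcases ht with rfl | rfl
    · simp
    · exact k.hw2
  have htc : t * d = d * t := by
    rcases ht with rfl | rfl
    · simp
    · exact (k.cen d).symm
  have hsq : a * c ^ 4 * a⁻¹ = d ^ 2 := by
    have : c ^ 4 = (c ^ 2) ^ 2 := by rw [← pow_mul]
    rw [this, ← conj_pow, htd, (show Commute t d from htc).mul_pow, ht2, one_mul]
  have hc4 : c ^ 4 = 1 := by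
    refine k.coreElt p ha (pow_mem hcC 4) ?_
    rw [hsq]
    rw [mem_zpowers_iff] at hcd
    obtain ⟨j, rfl⟩ := hcd
    rw [mem_zpowers_iff]
    refine ⟨j, ?_⟩
    rw [← zpow_natCast, ← zpow_natCast, ← zpow_natCast, ← zpow_mul, ← zpow_mul, ← zpow_mul]
    congr 1; push_cast; ring
  refine ⟨by rw [k.hc, Nat.card_zpowers]; exact orderOf_eq_prime_pow (p := 2) (n := 1) hc2n hc4, ?_⟩
  have hd2 : d ^ 2 = 1 := by rw [← hsq, hc4]; simp
  have hc22 : (c ^ 2) ^ 2 = 1 := by rw [← pow_mul]; exact hc4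
  rcases invol_uniq p.gC (pow_mem hcC 2) hc2n hc22 hd hd2 with rfl | rfl
  · rcases ht with rfl | rfl
    · exact absurd (by simpa using htd) hc2n
    · rw [mul_one, mul_inv_eq_iff_eq_mul, ← k.cen a] at htd
      exact absurd (mul_left_cancel htd ▸ pow_mem hcC 2) k.hwC
  · rcases ht with rfl | rfl
    · rw [one_mul] at htd
      exact absurd (k.coreElt p ha (pow_mem hcC 2) (by rw [htd]; exact mem_zpowers _)) hc2n
    · exact htd
end D8
end SD

namespace SD
universe u
set_option linter.unusedVariables false
set_option linter.style.multiGoal false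
set_option linter.unusedSimpArgs false
variable {X : Type u} [Group X] {A H C U : Subgroup X} {c u v w : X}

/-- the shape of the factor group of order 32 -/
def Data32 (X : Type u) [Group X] : Prop :=
  ∃ N : Subgroup X, N.Normal ∧ Nonempty (N ≃* Multiplicative (ZMod 4 × ZMod 2)) ∧
    ∃ f : X →* Multiplicative (ZMod 4), Function.Surjective f ∧ f.ker = N

theorem prod42 [Finite X] {g h : X} (hg4 : g ^ 4 = 1) (hg2 : g ^ 2 ≠ 1) (hh2 : h ^ 2 = 1) (hh1 : h ≠ 1) (hgh : h ≠ g ^ 2)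
    (hcm : g * h = h * g) :
    Nonempty ((zpowers g ⊔ zpowers h : Subgroup X) ≃* Multiplicative (ZMod 4 × ZMod 2)) := by
  have cg : Nat.card (zpowers g) = 4 := by
    rw [Nat.card_zpowers]; exact orderOf_eq_prime_pow (p := 2) (n := 1) hg2 hg4
  have ch : Nat.card (zpowers h) = 2 := by
    rw [Nat.card_zpowers]; exact orderOf_eq_prime hh2 hh1
  have cm : ∀ (x : zpowers g) (y : zpowers h), Commute ((zpowers g).subtype x) ((zpowers h).subtype y) := by
    rintro ⟨x, i, rfl⟩ ⟨y, j, rfl⟩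
    exact (show Commute g h from hcm).zpow_zpow i j
  have inj : Function.Injective (((zpowers g).subtype).noncommCoprod ((zpowers h).subtype) cm) := by
    rw [MonoidHom.noncommCoprod_injective]
    refine ⟨Subtype.val_injective, Subtype.val_injective, ?_⟩
    rw [range_subtype, range_subtype, disjoint_iff, eq_bot_iff]
    rintro x ⟨hx1, hx2⟩
    have hx2' : x ^ 2 = 1 := by
      have := pow_card_mem hx2
      rwa [ch] at this
    rw [mem_bot]
    rcases invol_uniq ⟨g, rfl⟩ (pow_mem (mem_zpowers g) 2) hg2 (by rw [← pow_mul]; exact hg4) hx1 hx2' with h1 | h1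
    · exact h1
    · rcases invol_uniq ⟨h, rfl⟩ (mem_zpowers h) hh1 hh2 hx2 hx2' with h2 | h2
      · exact h2
      · exact absurd (h2.symm.trans h1) hgh
  have e1 := MonoidHom.ofInjective inj
  have hr : (((zpowers g).subtype).noncommCoprod ((zpowers h).subtype) cm).range = zpowers g ⊔ zpowers h := by
    rw [MonoidHom.noncommCoprod_range, range_subtype, range_subtype]
  rw [hr] at e1
  have e2 : zpowers g ≃* Multiplicative (ZMod 4) := mulEquivOfCyclicCardEq (by rw [cg]; simp)
  have e3 : zpowers h ≃* Multiplicative (ZMod 2) := mulEquivOfCyclicCardEq (by rw [ch]; simp)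
  exact ⟨e1.symm.trans ((MulEquiv.prodCongr e2 e3).trans (MulEquiv.prodMultiplicative _ _).symm)⟩

namespace D8

theorem build [Finite X] (k : D8 A H C c u v w) (p : Sys A H C) {a : X} (ha : A = zpowers a)
    (hX : Nat.card X = 32) {g h : X} (hg4 : g ^ 4 = 1) (hg2 : g ^ 2 ≠ 1) (hh2 : h ^ 2 = 1) (hh1 : h ≠ 1) (hgh : h ≠ g ^ 2)
    (hcm : g * h = h * g) {N : Subgroup X} (hN : N = zpowers g ⊔ zpowers h)
    (ag : a * g * a⁻¹ ∈ N) (ah : a * h * a⁻¹ ∈ N)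
    (cg : c * g * c⁻¹ ∈ N) (ch : c * h * c⁻¹ ∈ N) (hwN : w ∈ N) (hcN : c ∈ N ∨ a * c ∈ N) : Data32 X := by
  obtain ⟨e⟩ := prod42 hg4 hg2 hh2 hh1 hgh hcm
  rw [← hN] at e
  have hNc : N = closure {g, h} := by
    rw [hN, zpowers_eq_closure, zpowers_eq_closure, ← Subgroup.closure_union]; rfl
  have m : ∀ x, x * g * x⁻¹ ∈ N → x * h * x⁻¹ ∈ N → x ∈ normalizer (N : Set X) := by
    intro x h1 h2
    refine mem_normalizer_fintype (fun n hn => ?_)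
    have hn' : n ∈ closure {g, h} := hNc ▸ hn
    rw [hNc] at h1 h2 ⊢
    refine closure_conj ?_ hn'
    rintro s (rfl | rfl)
    · exact h1
    · exact h2
  have hNn : N.Normal := by
    rw [← normalizer_eq_top_iff]
    refine k.topN p ha (m a ag ah) (m w ?_ ?_) (m c cg ch)
    · rw [conj_iff_comm.2 (k.cen g).symm, hN]; exact mem_sup_left (mem_zpowers g)
    · rw [conj_iff_comm.2 (k.cen h).symm, hN]; exact mem_sup_right (mem_zpowers h)
  have hcard : Nat.card N = 8 := by
    rw [Nat.card_congr e.toEquiv]; simp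
  have hQ : Nat.card (X ⧸ N) = 4 := by
    have := N.card_eq_card_quotient_mul_card_subgroup
    rw [hX, hcard] at this; omega
  have htop : N ⊔ zpowers a = ⊤ := by
    have haN : a ∈ N ⊔ zpowers a := mem_sup_right (mem_zpowers a)
    refine k.topN p ha haN (mem_sup_left hwN) ?_
    rcases hcN with h | h
    · exact mem_sup_left h
    · exact (mul_mem_cancel_left haN).1 (mem_sup_left h)
  have hcyc : IsCyclic (X ⧸ N) := by
    refine isCyclic_of_surjective (G' := zpowers a) ((QuotientGroup.mk' N).comp (zpowers a).subtype) ?_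
    intro y
    obtain ⟨x, rfl⟩ := QuotientGroup.mk'_surjective N y
    have hx : x ∈ N ⊔ zpowers a := htop ▸ mem_top x
    rw [mem_sup_of_normal_left] at hx
    obtain ⟨n, hn, d, hd, rfl⟩ := hx
    refine ⟨⟨d, hd⟩, ?_⟩
    rw [map_mul, show QuotientGroup.mk' N n = 1 from (QuotientGroup.eq_one_iff n).2 hn, one_mul]
    rfl
  have e2 : (X ⧸ N) ≃* Multiplicative (ZMod 4) := mulEquivOfCyclicCardEq (by rw [hQ]; simp)
  refine ⟨N, hNn, ⟨e⟩, e2.toMonoidHom.comp (QuotientGroup.mk' N), ?_, ?_⟩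
  · exact e2.surjective.comp (QuotientGroup.mk'_surjective N)
  · ext x
    rw [MonoidHom.mem_ker]
    show e2 (QuotientGroup.mk' N x) = 1 ↔ _
    rw [map_eq_one_iff e2 e2.injective]
    exact QuotientGroup.eq_one_iff x

theorem data32 [Finite X] (k : D8 A H C c u v w) (p : Sys A H C) {a : X} (ha : A = zpowers a)
    (ha2 : a ^ 2 ≠ 1) : Data32 X := by
  obtain ⟨hau, cA, cC, hac⟩ := k.main4 p ha ha2
  have hX : Nat.card X = 32 := by rw [p.card, cA, cC]
  have haA : a ∈ A := ha ▸ mem_zpowers a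
  have hcC : c ∈ C := k.hc ▸ mem_zpowers c
  obtain ⟨hwH, hwA⟩ := k.wH p
  have ha4 := k.a4 p haA
  have hc4 : c ^ 4 = 1 := by have := pow_card_mem hcC; rwa [cC] at this
  have oc : orderOf c = 4 := by rw [← Nat.card_zpowers, ← k.hc, cC]
  have hc2 : c ^ 2 ≠ 1 := fun h => by
    have := orderOf_dvd_of_pow_eq_one h
    rw [oc] at this; omega
  have hvw : v = u * w := by rw [k.hw, ← mul_assoc, ← pow_two, k.hu2, one_mul]
  have hca2 : c * a ^ 2 * c⁻¹ = a ^ 2 * w := by rw [hau, k.cu, hvw]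
  have hvA : v ∉ A := by
    intro h1
    rcases invol_uniq p.gA k.huA k.hu1 k.hu2 h1 k.hv2 with h | h
    · exact k.hv1 h
    · exact k.hvu h
  have ww : w * w = 1 := by rw [← pow_two, k.hw2]
  have hc2a : c ^ 2 * a = a * w * c ^ 2 := by
    have h1 : a * c ^ 2 = w * c ^ 2 * a := by rw [← mul_inv_eq_iff_eq_mul]; exact hac
    calc c ^ 2 * a = w * (w * c ^ 2 * a) := by rw [← mul_assoc, ← mul_assoc, ww, one_mul]
      _ = a * w * c ^ 2 := by rw [← h1, ← mul_assoc, k.cen a]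
  have Hform : ∀ h ∈ H, ∃ i : ℕ, i < 4 ∧ (h = a ^ i ∨ h = a ^ i * w) := by
    have hA : ∀ x ∈ A, ∃ i : ℕ, i < 4 ∧ x = a ^ i := by
      intro x hx
      rw [ha, mem_zpowers_iff] at hx
      obtain ⟨j, rfl⟩ := hx
      refine ⟨(j % 4).toNat, by omega, ?_⟩
      rw [zpow_mod a 4 ha4 j, ← zpow_natCast, Int.toNat_of_nonneg (by omega)]
      rfl
    intro h hh
    by_cases hA' : h ∈ A
    · obtain ⟨i, hi, e⟩ := hA h hA'
      exact ⟨i, hi, Or.inl e⟩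
    · obtain ⟨i, hi, e⟩ := hA _ (p.two h hh w hwH hA' hwA)
      refine ⟨i, hi, Or.inr ?_⟩
      rw [← e, mul_assoc, ww, mul_one]
  have hc2H : ∀ h ∈ H, c ^ 2 * h * (c ^ 2)⁻¹ ∈ H := by
    have h1 : c ^ 2 * a * (c ^ 2)⁻¹ ∈ H := by
      rw [hc2a, mul_inv_cancel_right]; exact mul_mem (p.AH haA) hwH
    intro h hh
    obtain ⟨i, hi, e | e⟩ := Hform h hh
    · rw [e, ← conj_pow]; exact pow_mem h1 i
    · rw [e, conjM, ← conj_pow, conj_iff_comm.2 (k.cen _)]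
      exact mul_mem (pow_mem h1 i) hwH
  have hcc : c ^ 2 * c ^ 2 = 1 := by rw [← pow_add]; exact hc4
  have hci : (c ^ 2)⁻¹ = c ^ 2 := inv_eq_of_mul_eq_one_left hcc
  let K : Subgroup X := {
    carrier := {x | x ∈ H ∨ x * c ^ 2 ∈ H}
    one_mem' := Or.inl (one_mem _)
    mul_mem' := by
      rintro x y (hx | hx) (hy | hy)
      · exact Or.inl (mul_mem hx hy)
      · right; rw [mul_assoc]; exact mul_mem hx hy
      · right
        have := mul_mem hx (hc2H y hy)
        rw [hci, ← mul_assoc, ← mul_assoc, mul_assoc x, hcc, mul_one] at this; exact this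
      · left
        have := mul_mem hx (hc2H _ hy)
        rw [hci, ← mul_assoc, ← mul_assoc, ← mul_assoc, mul_assoc x, hcc, mul_one, mul_assoc _ (c ^ 2), hcc, mul_one] at this
        exact this
    inv_mem' := by
      rintro x (hx | hx)
      · exact Or.inl (inv_mem hx)
      · right
        have := hc2H _ (inv_mem hx)
        rw [mul_inv_rev, hci, ← mul_assoc, hcc, one_mul] at this; exact this }
  have hKn : K.Normal := by
    refine normal_of_two (a := c) (fun x => ?_)
    obtain ⟨d, hd, h, hh, rfl⟩ := p.CH x
    have hhK : h ∈ K := Or.inl hh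
    have hc2K : c ^ 2 ∈ K := Or.inr (by rw [hcc]; exact one_mem _)
    rw [k.hc, mem_zpowers_iff] at hd
    obtain ⟨j, rfl⟩ := hd
    have e2 : ∀ i : ℤ, c ^ (2 * i) ∈ K := fun i => by
      rw [zpow_mul]; exact zpow_mem (by exact_mod_cast hc2K) i
    rcases Int.even_or_odd' j with ⟨i, rfl | rfl⟩
    · exact Or.inl (mul_mem (e2 i) hhK)
    · right; rw [add_comm, zpow_add, zpow_one, mul_assoc c, inv_mul_cancel_left]; exact mul_mem (e2 i) hhK
  have hsq : (c * a * c⁻¹) ^ 2 = v := by rw [conj_pow, hau, k.cu]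
  have hcaH : c * a * c⁻¹ ∉ H := fun h => hvA (hsq ▸ p.toPair.sq h)
  have hcaK : c * a * c⁻¹ ∈ K := hKn.conj_mem a (Or.inl (p.AH haA)) c
  have hca2H : c * a * c⁻¹ * c ^ 2 ∈ H := hcaK.resolve_left hcaH
  have n1 : ∀ x, w * (w * x) = x := fun x => by rw [← mul_assoc, ww, one_mul]
  have key : ∃ s : X, (s = 1 ∨ s = w) ∧ (c * a = a * s * c ^ 3 ∨ c * a = a⁻¹ * s * c ^ 3) := by
    have main : ∀ i : ℕ, i < 4 → ∀ s, (s = 1 ∨ s = w) → c * a * c⁻¹ * c ^ 2 = a ^ i * s →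
        (c * a = a * s * c ^ 3 ∨ c * a = a⁻¹ * s * c ^ 3) := by
      intro i hi s hs e
      have e1 : c * a * c⁻¹ = a ^ i * s * c ^ 2 := by
        rw [← e, mul_assoc _ (c ^ 2), hcc, mul_one]
      have e2 : c * a = a ^ i * s * c ^ 3 := by
        rw [mul_inv_eq_iff_eq_mul] at e1
        rw [e1, mul_assoc _ (c ^ 2), ← pow_succ]
      have hss : s * s = 1 := by rcases hs with rfl | rfl <;> simp [ww]
      have hsc : ∀ g, g * s = s * g := by rcases hs with rfl | rfl <;> simp [k.cen]
      have bad : ∀ x, c ^ 2 * x = x * c ^ 2 → x * x = 1 → c * a * c⁻¹ = x * s * c ^ 2 → False := by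
        intro x h1 h2 h3
        have : (x * s * c ^ 2) ^ 2 = 1 := by
          calc (x * s * c ^ 2) ^ 2 = x * s * (c ^ 2 * (x * s)) * c ^ 2 := by rw [pow_two]; group
            _ = x * s * ((x * s) * c ^ 2) * c ^ 2 := by
                rw [← mul_assoc (c ^ 2), h1, mul_assoc x (c ^ 2), hsc (c ^ 2)]
                simp only [mul_assoc]
            _ = x * s * (x * s) * (c ^ 2 * c ^ 2) := by simp only [mul_assoc]
            _ = x * x * (s * s) * (c ^ 2 * c ^ 2) := by rw [mul_assoc x s, ← mul_assoc s x s, ← hsc x]; simp only [mul_assoc]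
            _ = 1 := by rw [h2, hss, hcc]; simp
        rw [← h3, hsq] at this
        exact k.hv1 this
      interval_cases i
      · exact (bad 1 (by simp) (by simp) (by simpa using e1)).elim
      · left; simpa using e2
      · refine (bad (a ^ 2) ?_ (by rw [← pow_add]; exact ha4) e1).elim
        rw [hau]; exact conj_iff_comm.1 k.c2u
      · right
        rw [e2, show a⁻¹ = a ^ 3 from inv_eq_of_mul_eq_one_left (by rw [← pow_succ]; exact ha4)]
    obtain ⟨i, hi, e | e⟩ := Hform _ hca2H
    · exact ⟨1, Or.inl rfl, main i hi 1 (Or.inl rfl) (by rw [e, mul_one])⟩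
    · exact ⟨w, Or.inr rfl, main i hi w (Or.inr rfl) e⟩
  obtain ⟨s, hs, hplus | hminus⟩ := key
  ·
    have hwN : w ∈ zpowers c ⊔ zpowers w := mem_sup_right (mem_zpowers w)
    have hcN : c ∈ zpowers c ⊔ zpowers w := mem_sup_left (mem_zpowers c)
    have hsN : s ∈ zpowers c ⊔ zpowers w := by
      rcases hs with rfl | rfl
      · exact one_mem _
      · exact hwN
    have hAi : A = zpowers a⁻¹ := by rw [zpowers_inv, ha]
    refine k.build p hAi hX (g := c) (h := w) hc4 hc2 k.hw2 k.hw1 (fun h => k.hwC (h ▸ pow_mem hcC 2))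
      (k.cen c) rfl ?_ ?_ ?_ ?_ hwN (Or.inl hcN)
    · rw [mul_assoc, inv_inv, hplus, mul_assoc a, inv_mul_cancel_left]
      exact mul_mem hsN (pow_mem hcN 3)
    · rw [conj_iff_comm.2 (k.cen _)]; exact hwN
    · rw [conj_iff_comm.2 rfl]; exact hcN
    · rw [conj_iff_comm.2 (k.cen _)]; exact hwN
  · have minus : ∀ a' : X, A = zpowers a' → c ^ 2 * a' = a' * w * c ^ 2 → a' ^ 2 = u → c * a' = a'⁻¹ * w * c ^ 3 → Data32 X := by
      clear hac hc2a hca2 hsq hcaH hcaK hca2H hminus Hform hc2H hKn K hau ha4 ha2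
      clear haA ha
      intro b hb hcb hbu hcb'
      have hbA : b ∈ A := hb ▸ mem_zpowers b
      have hbi : b⁻¹ = b * u := by
        rw [inv_eq_iff_mul_eq_one, ← mul_assoc, ← pow_two, hbu, ← pow_two, k.hu2]
      have hub : u * b = b * u := by rw [← hbu, ← pow_succ, ← pow_succ']
      have hcu : c * u = u * w * c := by rw [← hvw, ← mul_inv_eq_iff_eq_mul]; exact k.cu
      have hc2u : c ^ 2 * u = u * c ^ 2 := conj_iff_comm.1 k.c2u
      have uu : u * u = 1 := by rw [← pow_two, k.hu2]
      have g2 : (b * c) ^ 2 = w := by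
        calc (b * c) ^ 2 = b * (c * b) * c := by rw [pow_two]; group
          _ = w * c ^ 4 := by rw [hcb']; group
          _ = w := by rw [hc4, mul_one]
      have h2 : (u * c ^ 2) ^ 2 = 1 := by
        rw [(show Commute u (c ^ 2) from hc2u.symm).mul_pow, k.hu2, pow_two, hcc, one_mul]
      have hgN : b * c ∈ zpowers (b * c) ⊔ zpowers (u * c ^ 2) := mem_sup_left (mem_zpowers _)
      have hhN : u * c ^ 2 ∈ zpowers (b * c) ⊔ zpowers (u * c ^ 2) := mem_sup_right (mem_zpowers _)
      have hwN : w ∈ zpowers (b * c) ⊔ zpowers (u * c ^ 2) := by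
        have := pow_mem hgN 2; rwa [g2] at this
      have hghf : b * c * (u * c ^ 2) = b⁻¹ * w * c ^ 3 := by
        calc b * c * (u * c ^ 2) = b * (c * u) * c ^ 2 := by group
          _ = b * u * w * c ^ 3 := by rw [hcu]; group
          _ = _ := by rw [hbi]
      have hcm : b * c * (u * c ^ 2) = u * c ^ 2 * (b * c) := by
        rw [hghf]
        calc b⁻¹ * w * c ^ 3 = u * (b * w * c ^ 2) * c := by
              rw [hbi, ← hub]; group
          _ = _ := by rw [← hcb]; group
      have hne : ∀ x ∈ H, u * c ^ 2 ≠ x := fun x hx e => hc2 (p.dis _ ((mul_mem_cancel_left (p.AH k.huA)).1 (e ▸ hx)) (pow_mem hcC 2))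
      refine k.build p hb hX (g := b * c) (h := u * c ^ 2) ?_ ?_ h2 (hne 1 (one_mem _)) (by rw [g2]; exact hne w hwH)
        hcm rfl ?_ ?_ ?_ ?_ hwN (Or.inr hgN)
      · rw [show (b * c) ^ 4 = ((b * c) ^ 2) ^ 2 by rw [← pow_mul], g2, k.hw2]
      · rw [g2]; exact k.hw1
      · have : b * (b * c) * b⁻¹ = b * c * (u * c ^ 2) * w := by
          rw [hghf, mul_inv_eq_iff_eq_mul]
          have c3b : c ^ 3 * b = b⁻¹ * c := by
            calc c ^ 3 * b = c * (c ^ 2 * b) := by rw [← mul_assoc, ← pow_succ']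
              _ = c * b * w * c ^ 2 := by rw [hcb]; simp only [mul_assoc]
              _ = b⁻¹ * (w * (c ^ 3 * w)) * c ^ 2 := by rw [hcb']; simp only [mul_assoc]
              _ = b⁻¹ * (c ^ 4 * c) := by rw [k.cen, n1, mul_assoc, ← pow_add, ← pow_succ]
              _ = b⁻¹ * c := by rw [hc4, one_mul]
          have bb : b⁻¹ * b⁻¹ = u := by rw [← mul_inv_rev, ← pow_two, hbu, sq_eq_one_iff' k.hu2]
          calc b * (b * c) = u * c := by rw [← hbu, pow_two, mul_assoc]
            _ = b⁻¹ * (b⁻¹ * c) := by rw [← mul_assoc, bb]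
            _ = b⁻¹ * (w * (c ^ 3 * w)) * b := by rw [k.cen, n1, mul_assoc, c3b]
            _ = b⁻¹ * w * c ^ 3 * w * b := by simp only [mul_assoc]
        rw [this]; exact mul_mem (mul_mem hgN hhN) hwN
      · have : b * (u * c ^ 2) * b⁻¹ = u * c ^ 2 * w := by
          rw [mul_inv_eq_iff_eq_mul]
          calc b * (u * c ^ 2) = u * (b * c ^ 2) := by rw [← mul_assoc, ← hub, mul_assoc]
            _ = u * (w * (b * w * c ^ 2)) := by rw [k.cen b, mul_assoc w b, n1]
            _ = u * ((w * c ^ 2) * b) := by rw [← hcb, mul_assoc]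
            _ = u * c ^ 2 * w * b := by rw [← k.cen]; simp only [mul_assoc]
        rw [this]; exact mul_mem hhN hwN
      · have : c * (b * c) * c⁻¹ = b * c * (u * c ^ 2) := by
          rw [hghf, ← mul_assoc, mul_inv_cancel_right, hcb']
        rw [this]; exact mul_mem hgN hhN
      · have : c * (u * c ^ 2) * c⁻¹ = u * c ^ 2 * w := by
          rw [← mul_assoc, hcu, mul_assoc _ c, ← pow_succ', mul_assoc, pow_succ, mul_inv_cancel_right, mul_assoc, ← k.cen, mul_assoc]
        rw [this]; exact mul_mem hhN hwN
    rcases hs with rfl | rfl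
    · have c2ai : c ^ 2 * a⁻¹ = a⁻¹ * w * c ^ 2 := by
        rw [mul_assoc, ← hac]; group
      refine minus a⁻¹ (by rw [zpowers_inv, ha]) c2ai ?_ ?_
      · rw [inv_pow, hau, sq_eq_one_iff' k.hu2]
      · rw [mul_one] at hminus
        have e1 : a⁻¹ = c * a * (c ^ 3)⁻¹ := by rw [hminus]; group
        have e2 : (c ^ 3)⁻¹ = c := inv_eq_of_mul_eq_one_left (by rw [← pow_succ']; exact hc4)
        rw [inv_inv]
        calc c * a⁻¹ = c ^ 2 * a * (c ^ 3)⁻¹ := by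
              conv_lhs => rw [e1]
              rw [pow_two]; simp only [mul_assoc]
          _ = a * w * c ^ 3 := by rw [hc2a, e2, mul_assoc _ (c ^ 2), ← pow_succ]
    · exact minus a ha hc2a hau hminus
end D8

theorem lemma5 [Finite X] (p : Sys A H C) (hc : C = zpowers c) (hD : CondD8 A C c) :
    (Nat.card A = 2 ∧ Nat.card C = 2) ∨ (Nat.card A = 4 ∧ Nat.card C = 4 ∧ Data32 X) := by
  obtain ⟨u, v, w, k⟩ := lemma5a p hc hD
  obtain ⟨a, ha⟩ := p.gA
  by_cases h : a ^ 2 = 1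
  · exact Or.inl (k.main2 p ha h)
  · obtain ⟨_, h1, h2, _⟩ := k.main4 p ha h
    exact Or.inr ⟨h1, h2, k.data32 p ha h⟩
end SD

namespace SD
universe u
set_option linter.unusedVariables false
set_option linter.style.multiGoal false
set_option linter.unusedSimpArgs false
variable {X : Type u} [Group X] {A H C B : Subgroup X}

/-- the configuration in which `B` is a maximal subgroup meeting `A` trivially -/
structure Beta (A H C B : Subgroup X) : Prop extends Sys A H C where
  q : Pair C B
  AB : ∀ x ∈ A, x ∈ B → x = 1
  z : ∃ z ∈ B, z ∈ H ∧ z ∉ A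
  Bmax : ∀ L : Subgroup X, B ≤ L → L = B ∨ L = ⊤
  A1 : A ≠ ⊥

theorem card_prod {G K L : Subgroup X} (hK : K ≤ G) (hL : L ≤ G) (hd : ∀ x ∈ K, x ∈ L → x = 1)
    (hG : ∀ g ∈ G, ∃ k ∈ K, ∃ l ∈ L, g = k * l) : Nat.card G = Nat.card K * Nat.card L := by
  rw [← Nat.card_prod]
  symm
  refine Nat.card_eq_of_bijective (fun x : K × L => (⟨x.1 * x.2, mul_mem (hK x.1.2) (hL x.2.2)⟩ : G)) ⟨?_, ?_⟩
  · rintro ⟨⟨x, hx⟩, ⟨y, hy⟩⟩ ⟨⟨x', hx'⟩, ⟨y', hy'⟩⟩ h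
    have h : x * y = x' * y' := congrArg Subtype.val h
    have h1 : x'⁻¹ * x = y' * y⁻¹ := by
      rw [eq_mul_inv_iff_mul_eq, mul_assoc, h, inv_mul_cancel_left]
    have h2 := hd _ (mul_mem (inv_mem hx') hx) (h1 ▸ mul_mem hy' (inv_mem hy))
    rw [h2, eq_comm, mul_inv_eq_one] at h1
    rw [inv_mul_eq_one] at h2
    simp [h1, h2]
  · rintro ⟨g, hg⟩
    obtain ⟨k, hk, l, hl, rfl⟩ := hG g hg
    exact ⟨⟨⟨k, hk⟩, ⟨l, hl⟩⟩, rfl⟩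

namespace Beta

theorem ti [Finite X] (b : Beta A H C B) : TIp C B := b.q.TI b.Bmax b.core

theorem nB (b : Beta A H C B) : ∃ x, x ∉ B := by
  by_contra h
  push Not at h
  exact b.A1 (eq_bot_iff.2 fun x hx => b.AB x hx (h x))

theorem tiA [Finite X] (b : Beta A H C B) {x d : X} (hx : x ∈ A) (hx1 : x ≠ 1) (hd : d ∈ C)
    (h : x * d * x⁻¹ ∈ C) : d = 1 :=
  b.ti x (fun h => hx1 (b.AB x hx h)) d hd h

theorem C1 (b : Beta A H C B) : C ≠ ⊥ := by
  intro h
  have := b.P A (h ▸ bot_le) (fun x hx _ => hx)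
  exact b.A1 (eq_bot_iff.2 (h ▸ this))

theorem gt1 [Finite X] {A : Subgroup X} (h : A ≠ ⊥) : 2 ≤ Nat.card A := by
  have := (Subgroup.one_lt_card_iff_ne_bot A).2 h
  omega

theorem div [Finite X] (b : Beta A H C B) : ∃ r, 1 ≤ r ∧ r * Nat.card C = 2 * (Nat.card A - 1) := by
  obtain ⟨r, hr⟩ := Div b.q.AH b.ti
  rw [b.card, b.q.card] at hr
  have h1 := gt1 b.A1
  have h2 := gt1 b.C1
  generalize Nat.card A = i at *
  generalize Nat.card C = k at *
  have h3 : k * (2 * i) = k * (2 + r * k) := by rw [mul_add]; linarith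
  have h4 : 2 * i = 2 + r * k := Nat.eq_of_mul_eq_mul_left (by omega) h3
  refine ⟨r, ?_, by omega⟩
  rcases Nat.eq_zero_or_pos r with h | h
  · subst h; omega
  · exact h

theorem big [Finite X] (b : Beta A H C B) (h : Nat.card A < Nat.card C) : Nat.card A ≤ 3 := by
  have := BigB b.q b.ti b.nB
  rw [b.card, b.q.card] at this
  have h2 := gt1 b.C1
  generalize Nat.card A = i at *
  generalize Nat.card C = k at *
  have := this (by nlinarith)
  nlinarith

theorem beta1 [Finite X] (b : Beta A H C B) (hmax : ∀ L : Subgroup X, H ≤ L → L = H ∨ L = ⊤) :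
    (Nat.card A = 2 ∧ Nat.card C = 2) ∨ (Nat.card A = 3 ∧ Nat.card C = 4) ∨
    (Nat.card A = 4 ∧ Nat.card C = 3) := by
  have tiH : TIp A H := b.toPair.TI hmax (fun E h1 h2 => b.P'normal h1 h2)
  have hnH : ∃ x, x ∉ H := by
    by_contra h
    push Not at h
    exact b.C1 (eq_bot_iff.2 fun x hx => b.dis x (h x) hx)
  obtain ⟨r, hr1, hr⟩ := b.div
  have hs : ∃ s, 1 ≤ s ∧ s * Nat.card A = 2 * (Nat.card C - 1) := by
    obtain ⟨r, hr⟩ := Div b.AH tiH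
    rw [b.card, b.toPair.card] at hr
    have h1 := gt1 b.A1
    have h2 := gt1 b.C1
    generalize Nat.card A = i at *
    generalize Nat.card C = k at *
    have h3 : i * (2 * k) = i * (2 + r * i) := by rw [mul_add]; linarith
    have h4 : 2 * k = 2 + r * i := Nat.eq_of_mul_eq_mul_left (by omega) h3
    refine ⟨r, ?_, by omega⟩
    rcases Nat.eq_zero_or_pos r with h | h
    · subst h; omega
    · exact h
  obtain ⟨s, hs1, hs⟩ := hs
  have big1 := b.big
  have big2 : Nat.card C < Nat.card A → Nat.card C ≤ 3 := by
    have := BigB b.toPair tiH hnH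
    rw [b.card, b.toPair.card] at this
    have h2 := gt1 b.A1
    intro h
    generalize Nat.card A = i at *
    generalize Nat.card C = k at *
    have := this (by nlinarith)
    nlinarith
  have h1 := gt1 b.A1
  have h2 := gt1 b.C1
  generalize Nat.card A = i at *
  generalize Nat.card C = k at *
  rcases lt_trichotomy i k with h | h | h
  · have := big1 h
    interval_cases i
    · have hk : k ≤ 2 := by nlinarith
      omega
    · have hk : k ≤ 4 := by nlinarith
      interval_cases k <;> omega
  · subst h
    have : r ≤ 1 := by
      by_contra hh
      have : 2 ≤ r := by omega
      have : 2 * i ≤ r * i := Nat.mul_le_mul_right _ this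
      omega
    have : r = 1 := by omega
    subst this
    omega
  · have := big2 h
    interval_cases k
    · have hk : i ≤ 2 := by nlinarith
      omega
    · have hk : i ≤ 4 := by nlinarith
      interval_cases i <;> omega

end Beta

/-- the numerical conclusion of the main theorem -/
def Concl {X : Type u} [Group X] (A C : Subgroup X) : Prop :=
  (Nat.card A = 1 ∧ Nat.card C = 1) ∨ (Nat.card A = 2 ∧ Nat.card C = 2) ∨
  (Nat.card A = 2 ∧ Nat.card C = 3 ∧ Emb4 X) ∨ (Nat.card A = 3 ∧ Nat.card C = 4 ∧ Emb4 X) ∨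
  (Nat.card A = 4 ∧ Nat.card C = 3 ∧ Emb4 X) ∨ (Nat.card A = 4 ∧ Nat.card C = 4 ∧ Data32 X)

/-- induction hypothesis -/
def IH (n : ℕ) : Prop := ∀ (Y : Type u) [Group Y] [Finite Y], Nat.card Y < n →
  ∀ A H C : Subgroup Y, Sys A H C → Concl A C

theorem commute_prime {M : Subgroup X} {p : ℕ} (hp : p.Prime) {x y : X} (hx : x ∈ M) (hy : y ∈ M)
    (hx1 : x ^ p = 1) (nx : ∀ g ∈ M, g * x * g⁻¹ ∈ zpowers x)
    (ny : ∀ g ∈ M, g * y * g⁻¹ ∈ zpowers y) : x * y = y * x := by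
  let t := x * y * x⁻¹ * y⁻¹
  have t1 : t ∈ zpowers y := mul_mem (ny x hx) (inv_mem (mem_zpowers y))
  have t2 : t ∈ zpowers x := by
    have : t = x * (y * x⁻¹ * y⁻¹) := by simp only [t]; group
    rw [this]
    refine mul_mem (mem_zpowers x) ?_
    rw [← conj_inv]; exact inv_mem (nx y hy)
  by_cases ht : t = 1
  · have : x * y * (y * x)⁻¹ = 1 := by rw [← ht]; simp only [t]; group
    exact mul_inv_eq_one.1 this
  · have hx' : x ∈ zpowers t := by
      rw [mem_zpowers_iff] at t2
      obtain ⟨j, hj⟩ := t2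
      have hnd : ¬ ((p : ℤ) ∣ j) := by
        rintro ⟨l, rfl⟩
        rw [zpow_mul, zpow_natCast, hx1, one_zpow] at hj
        exact ht hj.symm
      have hco : IsCoprime (p : ℤ) j := (Nat.prime_iff_prime_int.1 hp).coprime_iff_not_dvd.2 hnd
      obtain ⟨α, β, e⟩ := hco
      rw [mem_zpowers_iff]
      refine ⟨β, ?_⟩
      rw [← hj, ← zpow_mul, mul_comm j β]
      have : x ^ (α * (p : ℤ) + β * j) = x := by rw [e, zpow_one]
      rwa [zpow_add, mul_comm α, zpow_mul, zpow_natCast, hx1, one_zpow, one_mul] at this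
    have : x ∈ zpowers y := (zpowers_le.2 t1) hx'
    rw [mem_zpowers_iff] at this
    obtain ⟨j, rfl⟩ := this
    exact (Commute.refl y).zpow_left j

namespace Beta

theorem noU [Finite X] (b : Beta A H C B) {M U : Subgroup X} (hHM : H ≤ M) (hMn : M.Normal)
    (hC1 : ∃ d ∈ C, d ∈ M ∧ d ≠ 1) (hUA : U ≤ A) (hU : ∀ g ∈ M, ∀ x ∈ U, g * x * g⁻¹ ∈ U) : U = ⊥ := by
  by_contra hU1
  have h2 := gt1 hU1
  obtain ⟨p, hp, hpU⟩ := Nat.exists_prime_and_dvd (n := Nat.card U) (by omega)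
  have : Fact p.Prime := ⟨hp⟩
  obtain ⟨⟨u0, hu0⟩, ho⟩ := exists_prime_orderOf_dvd_card' p hpU
  have ho : orderOf u0 = p := by rw [← ho, Subgroup.orderOf_mk]
  have hu0p : u0 ^ p = 1 := by rw [← ho]; exact pow_orderOf_eq_one _
  have hu01 : u0 ≠ 1 := fun h => by rw [h, orderOf_one] at ho; exact hp.one_lt.ne ho
  have hu0A := hUA hu0
  have nrm : ∀ g ∈ M, g * u0 * g⁻¹ ∈ zpowers u0 := fun g hg =>
    cyc_conj b.gA (zpowers_le.2 hu0A) (mem_zpowers u0) (hUA (hU g hg u0 hu0))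
  have comm1 : ∀ d ∈ C, d * u0 = u0 * d → d = 1 := fun d hd h => by
    refine b.tiA hu0A hu01 hd ?_
    rw [← h, mul_inv_cancel_right]; exact hd
  have gen : ∀ g, ∀ m ∈ M, m * (g * u0 * g⁻¹) * m⁻¹ ∈ zpowers (g * u0 * g⁻¹) := by
    intro g m hm
    have h1 := nrm (g⁻¹ * m * g) (by have := hMn.conj_mem m hm g⁻¹; rwa [inv_inv] at this)
    rw [mem_zpowers_iff] at h1 ⊢
    obtain ⟨j, hj⟩ := h1
    refine ⟨j, ?_⟩
    rw [conj_zpow, hj]; group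
  have genM : ∀ g, g * u0 * g⁻¹ ∈ M := fun g => hMn.conj_mem _ (hHM (b.AH hu0A)) g
  rcases hp.eq_two_or_odd' with rfl | hodd
  · obtain ⟨d, hd, hdM, hd1⟩ := hC1
    refine hd1 (comm1 d hd ?_)
    have h3 := nrm d hdM
    rcases invol_uniq ⟨u0, rfl⟩ (mem_zpowers u0) hu01 hu0p h3 (by rw [conj_pow, hu0p]; simp) with h | h
    · rw [conj_eq_one_iff] at h; exact absurd h hu01
    · exact conj_iff_comm.1 h
  · obtain ⟨l, hl⟩ := hodd
    let S : Set X := {y | ∃ g, y = g * u0 * g⁻¹}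
    let N := closure S
    have hNn : N.Normal := by
      refine ⟨fun x hx g => closure_conj ?_ hx⟩
      rintro s ⟨g', rfl⟩
      rw [← conjC]; exact subset_closure ⟨_, rfl⟩
    have hNM : N ≤ M := (closure_le M).2 (by rintro s ⟨g, rfl⟩; exact genM g)
    have hu0N : u0 ∈ N := subset_closure ⟨1, by simp⟩
    have hS : ∀ s ∈ S, ∀ t ∈ S, s * t = t * s := by
      rintro _ ⟨g, rfl⟩ _ ⟨g', rfl⟩
      exact commute_prime hp (genM g) (genM g') (by rw [conj_pow, hu0p]; simp) (gen g) (gen g')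
    have hNc : ∀ x ∈ N, ∀ y ∈ N, x * y = y * x := by
      have i1 : ∀ x ∈ S, ∀ y ∈ N, x * y = y * x := by
        intro x hx y hy
        induction hy using closure_induction with
        | mem y hy => exact hS x hx y hy
        | one => simp
        | mul y y' _ _ h1 h2 => exact (show Commute x y from h1).mul_right h2
        | inv y _ h1 => exact (show Commute x y from h1).inv_right
      intro x hx y hy
      induction hx using closure_induction with
      | mem x hx => exact i1 x hx y hy
      | one => simp
      | mul x x' _ _ h1 h2 => exact (show Commute x y from h1).mul_left h2
      | inv x _ h1 => exact (show Commute x y from h1).inv_left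
    have hNp : ∀ x ∈ N, x ^ p = 1 := by
      intro x hx
      induction hx using closure_induction with
      | mem x hx => obtain ⟨g, rfl⟩ := hx; rw [conj_pow, hu0p]; simp
      | one => simp
      | mul x x' h1 h2 h3 h4 =>
        rw [(show Commute x x' from hNc x h1 x' h2).mul_pow, h3, h4, one_mul]
      | inv x _ h1 => rw [inv_pow, h1, inv_one]
    have half : ∀ x ∈ N, (x ^ (l + 1)) ^ 2 = x := by
      intro x hx
      rw [← pow_mul, show (l + 1) * 2 = p + 1 by omega, pow_succ, hNp x hx, one_mul]
    obtain ⟨h, hh, hhA, y, hy, d, hd, e⟩ := b.L5 hNn (fun h => hu01 (b.dis u0 (b.AH hu0A) (h hu0N)))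
    have hinv : h * u0 * h⁻¹ = u0⁻¹ := by
      have := b.inv h hh hhA (u0 ^ (l + 1)) (pow_mem hu0A _)
      rwa [half u0 hu0N] at this
    have hdinv : d * u0 * d⁻¹ = u0⁻¹ := by
      have h4 : d * u0 * d⁻¹ ∈ N := hNn.conj_mem _ hu0N d
      rw [e, conjC, conj_iff_comm.2 (hNc y hy _ h4)] at hinv
      exact hinv
    have hdN : ∀ x ∈ N, d * x * d⁻¹ = x⁻¹ := by
      intro x hx
      induction hx using closure_induction with
      | mem x hx =>
        obtain ⟨g, rfl⟩ := hx
        obtain ⟨d', hd', h', hh', rfl⟩ := b.CH g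
        have h5 := b.toPair.sub_inv (U := zpowers u0) (zpowers_le.2 hu0A) hh' (mem_zpowers u0)
        rw [mem_zpowers_iff] at h5
        obtain ⟨j, hj⟩ := h5
        rw [conjC d', ← hj, ← conjC, b.Ccomm hd hd', conjC, ← conj_zpow, hdinv, inv_zpow, conj_inv]
      | one => simp
      | mul x x' h1 h2 h3 h4 => rw [conjM, h3, h4, mul_inv_rev, hNc _ (inv_mem h1) _ (inv_mem h2)]
      | inv x _ h1 => rw [← conj_inv, h1]
    have hwy := half y hy
    have hwN : y ^ (l + 1) ∈ N := pow_mem hy _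
    generalize y ^ (l + 1) = w at hwy hwN
    have hd1 : d = 1 := by
      refine b.HconjC (g := w) hh hd ?_
      have h6 := hdN _ (inv_mem hwN)
      rw [inv_inv] at h6
      rw [e, ← hwy, pow_two]
      conv_lhs => rw [mul_assoc]; enter [2, 1]; rw [← h6]
      group
    rw [hd1] at hdinv
    have : u0 ^ 2 = 1 := by
      have : u0 = u0⁻¹ := by simpa using hdinv
      rw [pow_two]; exact eq_inv_iff_mul_eq_one.1 this
    have := orderOf_dvd_of_pow_eq_one this
    rw [ho] at this
    have := Nat.le_of_dvd (by norm_num) this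
    have := hp.two_le
    omega

end Beta
end SD

namespace SD
universe u
set_option linter.unusedVariables false
set_option linter.style.multiGoal false
set_option linter.unusedSimpArgs false
variable {X : Type u} [Group X] {A H C B : Subgroup X}

theorem card_subgroupOf {K L : Subgroup X} (h : K ≤ L) : Nat.card (K.subgroupOf L) = Nat.card K :=
  Nat.card_congr (subgroupOfEquivOfLe h).toEquiv

namespace Beta

theorem sysM [Finite X] (b : Beta A H C B) {M : Subgroup X} (hHM : H ≤ M) (hMn : M.Normal)
    (hC1 : ∃ d ∈ C, d ∈ M ∧ d ≠ 1) : Sys (A.subgroupOf M) (H.subgroupOf M) ((C ⊓ M).subgroupOf M) := by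
  have hM : ∀ x ∈ M, ∃ h ∈ H, ∃ d ∈ C, d ∈ M ∧ x = h * d := by
    intro x hx
    obtain ⟨h, hh, d, hd, rfl⟩ := b.HC x
    exact ⟨h, hh, d, hd, (mul_mem_cancel_left (hHM hh)).1 hx, rfl⟩
  refine ⟨⟨⟨cyc_subgroupOf b.gA, ?_, ?_, ?_⟩, ?_, ?_, ?_, ?_, ?_⟩, ?_⟩
  · intro x hx; exact b.AH hx
  · obtain ⟨z, hz, hzA⟩ := b.ex
    exact ⟨⟨z, hHM hz⟩, hz, hzA⟩
  · intro x hx y hy h1 h2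
    exact b.two x hx y hy h1 h2
  · exact cyc_subgroupOf (cyc_sub b.gC inf_le_left)
  · intro h hh hhA x hx
    exact Subtype.ext (b.inv h hh hhA x hx)
  · rintro ⟨x, hx⟩
    obtain ⟨h, hh, d, hd, hdM, rfl⟩ := hM x hx
    exact ⟨⟨h, hHM hh⟩, hh, ⟨d, hdM⟩, ⟨hd, hdM⟩, rfl⟩
  · intro x hx hxC
    exact Subtype.ext (b.dis x hx hxC.1)
  · intro L' hL1 hL2
    let L := L'.map M.subtype
    have hLM : L ≤ M := by rintro _ ⟨x, _, rfl⟩; exact x.2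
    have hLi : ∀ x : M, (x : X) ∈ L ↔ x ∈ L' := by
      intro x
      constructor
      · rintro ⟨y, hy, e⟩
        rwa [← Subtype.ext e]
      · intro h; exact ⟨x, h, rfl⟩
    have hCL : C ⊓ M ≤ L := by
      intro x hx
      rw [mem_inf] at hx
      exact (hLi ⟨x, hx.2⟩).2 (hL1 (show (x : X) ∈ C ⊓ M from mem_inf.2 hx))
    have hLH : ∀ x ∈ L, x ∈ H → x ∈ A := fun x hx hxH =>
      hL2 ⟨x, hLM hx⟩ ((hLi _).1 hx) hxH
    have hcard : Nat.card L = Nat.card (L ⊓ A : Subgroup X) * Nat.card (C ⊓ M : Subgroup X) := by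
      refine card_prod inf_le_left hCL ?_ ?_
      · intro x hx hxC
        exact b.dis x (b.AH (mem_inf.1 hx).2) (mem_inf.1 hxC).1
      · intro g hg
        obtain ⟨h, hh, d, hd, hdM, rfl⟩ := hM g (hLM hg)
        have hdC : d ∈ C ⊓ M := mem_inf.2 ⟨hd, hdM⟩
        have hhL := (mul_mem_cancel_right (hCL hdC)).1 hg
        exact ⟨h, mem_inf.2 ⟨hhL, hLH h hhL hh⟩, d, hdC, rfl⟩
    have fr := Frob (G := L) (H0 := L ⊓ A) (C0 := C ⊓ M) inf_le_left hCL hcard.le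
      (fun x hx hxC => b.dis x (b.AH (mem_inf.1 hx).2) (mem_inf.1 hxC).1)
      (fun h hh h1 d hd hc => b.tiA (mem_inf.1 hh).2 h1 (mem_inf.1 hd).1 (mem_inf.1 hc).1)
    have hLU : ∀ g ∈ L, ∀ x ∈ L ⊓ A, g * x * g⁻¹ ∈ L ⊓ A := by
      intro g hg x hx
      by_contra hn
      obtain ⟨h, hh, d, hd, hd1, e⟩ := fr (g * x * g⁻¹) (mul_mem (mul_mem hg (mem_inf.1 hx).1) (inv_mem hg)) hn
      refine hd1 (b.HconjC (h := x) (g := g⁻¹ * h) (b.AH (mem_inf.1 hx).2) (mem_inf.1 hd).1 ?_)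
      rw [conjC, ← e]; group
    have hU := b.noU (U := L ⊓ A) hHM hMn hC1 inf_le_right (by
      intro g hg x hx
      obtain ⟨h, hh, d, hd, hdM, rfl⟩ := hM g hg
      rw [conjC]
      exact b.toPair.sub_inv inf_le_right hh (hLU d (hCL (mem_inf.2 ⟨hd, hdM⟩)) x hx))
    intro x hx
    have hxL := (hLi x).2 hx
    obtain ⟨h, hh, d, hd, hdM, e⟩ := hM x x.2
    have hdC : d ∈ C ⊓ M := mem_inf.2 ⟨hd, hdM⟩
    rw [e] at hxL
    have hhL := (mul_mem_cancel_right (hCL hdC)).1 hxL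
    have : h ∈ L ⊓ A := mem_inf.2 ⟨hhL, hLH h hhL hh⟩
    rw [hU, mem_bot] at this
    rw [this, one_mul] at e
    show (x : X) ∈ C ⊓ M
    rw [e]; exact hdC
  · intro E hE hEn
    rw [eq_bot_iff]
    intro x hx
    obtain ⟨a, ha⟩ := (ne_bot_iff_exists_ne_one.1 b.A1)
    rw [mem_bot]
    have hx' : (x : X) ∈ C ⊓ M := hE hx
    refine Subtype.ext (b.tiA a.2 (fun h => ha (Subtype.ext h)) (mem_inf.1 hx').1 ?_)
    have := hE (hEn.conj_mem x hx ⟨a, hHM (b.AH a.2)⟩)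
    exact (mem_inf.1 this).1

theorem beta2 [Finite X] (b : Beta A H C B) (ih : IH.{u} (Nat.card X)) {M : Subgroup X} (hHM : H ≤ M)
    (hM1 : M ≠ H) (hM2 : M ≠ ⊤) : Nat.card A = 3 ∧ Nat.card C = 4 := by
  have hM : ∀ x ∈ M, ∃ h ∈ H, ∃ d ∈ C ⊓ M, x = h * d := by
    intro x hx
    obtain ⟨h, hh, d, hd, rfl⟩ := b.HC x
    exact ⟨h, hh, d, mem_inf.2 ⟨hd, (mul_mem_cancel_left (hHM hh)).1 hx⟩, rfl⟩
  have hC1 : C ⊓ M ≠ ⊥ := by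
    intro h
    refine hM1 (le_antisymm (fun x hx => ?_) hHM)
    obtain ⟨h', hh, d, hd, rfl⟩ := hM x hx
    rw [h, mem_bot] at hd
    rw [hd, mul_one]; exact hh
  have hC2 : C ⊓ M ≠ C := by
    intro h
    refine hM2 (eq_top_iff.2 fun x _ => ?_)
    obtain ⟨h', hh, d, hd, rfl⟩ := b.HC x
    exact mul_mem (hHM hh) (mem_inf.1 (h.symm.le hd)).2
  have k1 := gt1 hC1
  obtain ⟨e, he⟩ : Nat.card (C ⊓ M : Subgroup X) ∣ Nat.card C := card_dvd_of_le inf_le_left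
  have hke : Nat.card (C ⊓ M : Subgroup X) ≠ Nat.card C := fun h =>
    hC2 (Subgroup.eq_of_le_of_card_ge inf_le_left h.ge)
  have k2 := gt1 b.C1
  have he2 : 2 ≤ e := by
    rcases e with _ | _ | e
    · omega
    · rw [he] at hke; simp at hke
    · omega
  have hk4 : 4 ≤ Nat.card C := by rw [he]; nlinarith
  have hi := gt1 b.A1
  obtain ⟨r, hr1, hr⟩ := b.div
  have cardM : Nat.card M = Nat.card H * Nat.card (C ⊓ M : Subgroup X) :=
    card_prod hHM inf_le_right (fun x hx hxC => b.dis x hx (mem_inf.1 hxC).1) hM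
  rw [b.toPair.card] at cardM
  let K := M.normalCore
  have hKn : K.Normal := normalCore_normal M
  have hKM : K ≤ M := normalCore_le M
  have hCK : C ⊓ M ≤ K := by
    intro d hd
    rw [mem_inf] at hd
    intro g
    obtain ⟨h, hh, d', hd', rfl⟩ := b.HC g
    rw [conjC, conj_iff_comm.2 (b.Ccomm hd' hd.1)]
    exact mul_mem (mul_mem (hHM hh) hd.2) (inv_mem (hHM hh))
  obtain ⟨d0, hd0, hd01⟩ : ∃ d ∈ C ⊓ M, d ≠ 1 := by
    obtain ⟨d, hd⟩ := ne_bot_iff_exists_ne_one.1 hC1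
    exact ⟨d, d.2, fun h => hd (Subtype.ext h)⟩
  by_cases hKB : K ≤ B
  · have sq := b.sqC hKn (fun x hx => b.q.sq (hKB hx))
    have := TIcore b.q b.ti (mem_inf.1 hd0).1 hd01 (sq d0 (hCK hd0)) (fun x => hKB (hKn.conj_mem _ (hCK hd0) x))
    have hidx : B.index = Nat.card A := by
      have h1 := B.card_mul_index
      rw [b.card, b.q.card] at h1
      have : 2 * Nat.card C * B.index = 2 * Nat.card C * Nat.card A := by rw [h1]; ring
      exact Nat.eq_of_mul_eq_mul_left (by omega) this
    rw [hidx] at this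
    generalize Nat.card A = i at *
    generalize Nat.card C = k at *
    interval_cases i
    · have : k ≤ 2 := by nlinarith
      omega
    · have : k ≤ 4 := by nlinarith
      exact ⟨rfl, by omega⟩
  · have hKBt : B ⊔ K = ⊤ := by
      rcases b.Bmax (B ⊔ K) le_sup_left with h | h
      · exact absurd (h ▸ le_sup_right) hKB
      · exact h
    have hcK : Nat.card K = Nat.card A * Nat.card (K ⊓ B : Subgroup X) := by
      have h1 := Subgroup.relIndex_sup_right B K
      rw [hKBt, relIndex_top_right] at h1
      have h2 := K.card_mul_index
      have h3 : Nat.card (K ⊓ B : Subgroup X) * K.relIndex B = Nat.card B := by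
        rw [← inf_relIndex_right]
        have := ((K ⊓ B).subgroupOf B).card_mul_index
        rwa [card_subgroupOf inf_le_right] at this
      rw [b.card] at h2
      rw [b.q.card] at h3
      have h4 : K.index ≠ 0 := index_ne_zero_of_finite
      rw [← h1] at h3
      have : K.index * Nat.card K = K.index * (Nat.card A * Nat.card (K ⊓ B : Subgroup X)) := by
        calc K.index * Nat.card K = 2 * Nat.card A * Nat.card C := by rw [← h2]; ring
          _ = Nat.card A * (2 * Nat.card C) := by ring
          _ = _ := by rw [← h3]; ring
      exact Nat.eq_of_mul_eq_mul_left (by omega) this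
    by_cases hKC : K ⊓ B ≤ C
    · exfalso
      have hKB' : K ⊓ B = C ⊓ M := by
        refine le_antisymm (fun x hx => mem_inf.2 ⟨hKC hx, hKM (mem_inf.1 hx).1⟩) (fun x hx => mem_inf.2 ⟨hCK hx, b.q.AH (mem_inf.1 hx).1⟩)
      rw [hKB'] at hcK
      have hKf : ∀ x ∈ K, ∃ h ∈ H ⊓ K, ∃ d ∈ C ⊓ M, x = h * d := by
        intro x hx
        obtain ⟨h, hh, d, hd, rfl⟩ := hM x (hKM hx)
        exact ⟨h, mem_inf.2 ⟨hh, (mul_mem_cancel_right (hCK hd)).1 hx⟩, d, hd, rfl⟩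
      have dis' : ∀ x ∈ H ⊓ K, x ∈ C ⊓ M → x = 1 := fun x hx hxC => b.dis x (mem_inf.1 hx).1 (mem_inf.1 hxC).1
      have hcK2 : Nat.card K = Nat.card (H ⊓ K : Subgroup X) * Nat.card (C ⊓ M : Subgroup X) :=
        card_prod inf_le_right hCK dis' hKf
      have hcH0 : Nat.card (H ⊓ K : Subgroup X) = Nat.card A := by
        rw [hcK] at hcK2
        exact (Nat.eq_of_mul_eq_mul_right (by omega) hcK2).symm
      have hnB : ∀ h ∈ H ⊓ K, h ≠ 1 → h ∉ B := by
        intro h hh h1 hB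
        rw [mem_inf] at hh
        exact h1 (b.dis h hh.1 (hKC (mem_inf.2 ⟨hh.2, hB⟩)))
      have fr := Frob (G := K) (H0 := H ⊓ K) (C0 := C ⊓ M) inf_le_right hCK hcK2.le dis'
        (fun h hh h1 d hd hc => b.ti h (hnB h hh h1) d (mem_inf.1 hd).1 (mem_inf.1 hc).1)
      have hH0n : (H ⊓ K).Normal := by
        refine ⟨fun x hx g => ?_⟩
        by_contra hn
        obtain ⟨h, hh, d, hd, hd1, e⟩ := fr (g * x * g⁻¹) (hKn.conj_mem _ (mem_inf.1 hx).2 g) hn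
        refine hd1 (b.HconjC (h := x) (g := g⁻¹ * h) (mem_inf.1 hx).1 (mem_inf.1 hd).1 ?_)
        rw [conjC, ← e]; group
      have sq := b.sqA hH0n (fun x hx => b.toPair.sq (mem_inf.1 hx).1)
      have pr : Pair (A ⊓ (H ⊓ K)) (H ⊓ K) := by
        refine ⟨cyc_sub b.gA inf_le_left, inf_le_right, ?_, ?_⟩
        · by_contra hn
          push Not at hn
          have := b.P'normal (U := H ⊓ K) (fun x hx => (mem_inf.1 (hn x hx)).1) hH0n
          rw [this] at hcH0
          simp at hcH0; omega
        · intro x hx y hy h1 h2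
          refine mem_inf.2 ⟨b.two x (mem_inf.1 hx).1 y (mem_inf.1 hy).1 (fun h => h1 (mem_inf.2 ⟨h, hx⟩)) (fun h => h2 (mem_inf.2 ⟨h, hy⟩)), mul_mem hx hy⟩
      have hc1 := pr.card
      have hc2 : Nat.card (A ⊓ (H ⊓ K) : Subgroup X) ≤ 2 := by
        obtain ⟨g, hg⟩ := pr.gA
        have : g ∈ A ⊓ (H ⊓ K) := hg ▸ mem_zpowers g
        rw [hg, Nat.card_zpowers]
        exact Nat.le_of_dvd (by norm_num) (orderOf_dvd_of_pow_eq_one (sq g (mem_inf.1 this).2))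
      obtain ⟨h0, hh0, hh01⟩ : ∃ h ∈ H ⊓ K, h ≠ 1 := by
        have : H ⊓ K ≠ ⊥ := fun h => by rw [h] at hcH0; simp at hcH0; omega
        obtain ⟨d, hd⟩ := ne_bot_iff_exists_ne_one.1 this
        exact ⟨d, d.2, fun h => hd (Subtype.ext h)⟩
      have hle : Nat.card C ≤ Nat.card (H ⊓ K : Subgroup X) := by
        refine Nat.card_le_card_of_injective (fun d : C => (⟨d * h0 * (d : X)⁻¹, hH0n.conj_mem _ hh0 d⟩ : (H ⊓ K : Subgroup X))) ?_
        rintro ⟨d, hd⟩ ⟨d', hd'⟩ hdd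
        have hdd : d * h0 * d⁻¹ = d' * h0 * d'⁻¹ := congrArg Subtype.val hdd
        have e1 : (d'⁻¹ * d) * h0 * (d'⁻¹ * d)⁻¹ = h0 := by
          rw [conjC, hdd]; group
        have hm : d'⁻¹ * d ∈ C := mul_mem (inv_mem hd') hd
        have := b.ti h0 (hnB h0 hh0 hh01) _ hm (by
          rw [conj_iff_comm.2 (conj_iff_comm.1 e1).symm]; exact hm)
        exact Subtype.ext (inv_mul_eq_one.1 this).symm
      have hA4 : Nat.card A ≤ 4 := by omega
      have hA4' : Nat.card A = 4 := by omega
      have hC4' : Nat.card C = 4 := by omega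
      rw [hA4', hC4'] at hr
      omega
    · have hlt : 2 * Nat.card (C ⊓ M : Subgroup X) ≤ Nat.card (K ⊓ B : Subgroup X) := by
        have hle : C ⊓ M ≤ K ⊓ B := fun x hx => mem_inf.2 ⟨hCK hx, b.q.AH (mem_inf.1 hx).1⟩
        obtain ⟨t, ht⟩ : Nat.card (C ⊓ M : Subgroup X) ∣ Nat.card (K ⊓ B : Subgroup X) := card_dvd_of_le hle
        have hne : Nat.card (K ⊓ B : Subgroup X) ≠ Nat.card (C ⊓ M : Subgroup X) := fun h => by
          have := Subgroup.eq_of_le_of_card_ge hle h.le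
          exact hKC (this ▸ inf_le_left)
        have hpos : 0 < Nat.card (K ⊓ B : Subgroup X) := Nat.card_pos
        rcases t with _ | _ | t
        · omega
        · rw [ht] at hne; simp at hne
        · rw [ht]; nlinarith
      have hKM' : K = M := Subgroup.eq_of_le_of_card_ge hKM (by
        rw [cardM, hcK]
        calc 2 * Nat.card A * Nat.card (C ⊓ M : Subgroup X) = Nat.card A * (2 * Nat.card (C ⊓ M : Subgroup X)) := by ring
          _ ≤ _ := Nat.mul_le_mul_left _ hlt)
      have hMn : M.Normal := hKM' ▸ hKn
      have sys := b.sysM hHM hMn ⟨d0, (mem_inf.1 hd0).1, (mem_inf.1 hd0).2, hd01⟩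
      have hMX : Nat.card M < Nat.card X := by
        rw [cardM, b.card]
        have : Nat.card (C ⊓ M : Subgroup X) < Nat.card C := by rw [he]; nlinarith
        exact Nat.mul_lt_mul_of_pos_left this (by omega)
      have res := ih M hMX _ _ _ sys
      unfold Concl at res
      rw [card_subgroupOf (b.AH.trans hHM), card_subgroupOf inf_le_right] at res
      have hbig := b.big
      generalize Nat.card A = i at *
      generalize Nat.card (C ⊓ M : Subgroup X) = k1 at *
      generalize Nat.card C = k at *
      rcases res with ⟨h1, h2⟩ | ⟨h1, h2⟩ | ⟨h1, h2, _⟩ | ⟨h1, h2, _⟩ | ⟨h1, h2, _⟩ | ⟨h1, h2, _⟩ <;> subst h1 <;> subst h2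
      · omega
      all_goals
        exfalso
        have hk6 : k ≤ 6 := by nlinarith
        interval_cases k <;> omega

theorem beta [Finite X] (b : Beta A H C B) (ih : IH.{u} (Nat.card X)) :
    (Nat.card A = 2 ∧ Nat.card C = 2) ∨ (Nat.card A = 3 ∧ Nat.card C = 4) ∨
    (Nat.card A = 4 ∧ Nat.card C = 3) := by
  by_cases hmax : ∀ L : Subgroup X, H ≤ L → L = H ∨ L = ⊤
  · exact b.beta1 hmax
  · push Not at hmax
    obtain ⟨M, h1, h2, h3⟩ := hmax
    exact Or.inr (Or.inl (b.beta2 ih h1 h2 h3))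

end Beta
end SD

namespace SD
universe u
set_option linter.unusedVariables false
set_option linter.style.multiGoal false
set_option linter.unusedSimpArgs false
variable {X : Type u} [Group X] {A H C B : Subgroup X} {c : X}

set_option maxRecDepth 100000 in
theorem sign4 : ∀ s : Equiv.Perm (Fin 4), s ^ 4 = 1 → s ^ 2 ≠ 1 → Equiv.Perm.sign s = -1 := by decide

theorem exists_sgn [Finite X] {K : Subgroup X} (hi : K.index = 4) : ∃ f : X →* Equiv.Perm (Fin 4),
    ∀ x, f x = 1 → x ∈ K := by
  have e : (X ⧸ K) ≃ Fin 4 := Finite.equivFinOfCardEq hi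
  refine ⟨(Equiv.permCongrHom e).toMonoidHom.comp (MulAction.toPermHom X (X ⧸ K)), fun x hx => ?_⟩
  have h1 : MulAction.toPermHom X (X ⧸ K) x = 1 :=
    (map_eq_one_iff (Equiv.permCongrHom e) (Equiv.permCongrHom e).injective).1 hx
  have h2 : x ∈ (MulAction.toPermHom X (X ⧸ K)).ker := h1
  rw [← normalCore_eq_ker] at h2
  exact normalCore_le K h2

theorem Beta.cond2 [Finite X] (b : Beta A H C B) (hA : Nat.card A = 4) (hC : Nat.card C = 3)
    (hc : C = zpowers c) : Cond2 A C c := by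
  have hcC : c ∈ C := hc ▸ mem_zpowers c
  obtain ⟨a, ha⟩ := b.gA
  have haA : a ∈ A := ha ▸ mem_zpowers a
  have oa : orderOf a = 4 := by rw [← Nat.card_zpowers, ← ha, hA]
  have oc : orderOf c = 3 := by rw [← Nat.card_zpowers, ← hc, hC]
  have ha4 : a ^ 4 = 1 := by rw [← oa]; exact pow_orderOf_eq_one a
  have hc3 : c ^ 3 = 1 := by rw [← oc]; exact pow_orderOf_eq_one c
  have hc1 : c ≠ 1 := fun h => by rw [h, orderOf_one] at oc; omega
  have ha2 : a ^ 2 ≠ 1 := fun h => by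
    have := Nat.le_of_dvd (by norm_num) (orderOf_dvd_of_pow_eq_one h); omega
  have cX : Nat.card X = 24 := by rw [b.card, hA, hC]
  have hidx : B.index = 4 := by
    have h1 := B.card_mul_index
    rw [cX, b.q.card, hC] at h1
    omega
  obtain ⟨f, hf⟩ := exists_sgn hidx
  let σ : X →* ℤˣ := Equiv.Perm.sign.comp f
  have sa : σ a = -1 := by
    refine sign4 (f a) (by rw [← map_pow, ha4, map_one]) (fun h => ?_)
    rw [← map_pow] at h
    exact ha2 (b.AB _ (pow_mem haA 2) (hf _ h))
  have sc : σ c = 1 := by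
    have : σ c ^ 3 = 1 := by rw [← map_pow, hc3, map_one]
    rcases Int.units_eq_one_or (σ c) with h | h
    · exact h
    · rw [h] at this; exact absurd this (by decide)
  let L := σ.ker
  have hLn : L.Normal := MonoidHom.normal_ker σ
  have haL : a ∉ L := fun h => by
    rw [MonoidHom.mem_ker, sa] at h; exact absurd h (by decide)
  have hCL : C ≤ L := by rw [hc, zpowers_le]; exact sc
  have htwo : ∀ x, x ∉ L → a * x ∈ L := by
    intro x hx
    rw [MonoidHom.mem_ker, map_mul, sa]
    rcases Int.units_eq_one_or (σ x) with h | h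
    · exact absurd h hx
    · rw [h]; decide
  have hLidx : L.index = 2 := by
    rw [index_eq_two_iff]
    refine ⟨a, fun x => ?_⟩
    by_cases hx : x ∈ L
    · exact Or.inr ⟨hx, fun h => haL ((mul_mem_cancel_left hx).1 h)⟩
    · refine Or.inl ⟨?_, hx⟩
      have := htwo x hx
      rw [MonoidHom.mem_ker, map_mul] at this ⊢
      rw [mul_comm]; exact this
  obtain ⟨z, hzB, hzH, hzA⟩ := b.z
  have hBL : ¬ B ≤ L := by
    intro h
    rcases b.Bmax L h with h | h
    · rw [h] at hLidx; omega
    · exact haL (h ▸ mem_top a)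
  have hLB : ∀ x ∈ L, x ∈ B → x ∈ C := by
    intro x hx hxB
    by_contra hxC
    refine hBL (fun y hy => ?_)
    by_cases hyC : y ∈ C
    · exact hCL hyC
    · exact (mul_mem_cancel_left hx).1 (hCL (b.q.two x hxB y hy hxC hyC))
  have dis' : ∀ x ∈ H ⊓ L, x ∈ C → x = 1 := fun x hx hxC => b.dis x (mem_inf.1 hx).1 hxC
  have cL : Nat.card L = Nat.card (H ⊓ L : Subgroup X) * Nat.card C := by
    refine card_prod inf_le_right hCL dis' (fun x hx => ?_)
    obtain ⟨h, hh, d, hd, rfl⟩ := b.HC x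
    exact ⟨h, mem_inf.2 ⟨hh, (mul_mem_cancel_right (hCL hd)).1 hx⟩, d, hd, rfl⟩
  have hnB : ∀ h ∈ H ⊓ L, h ≠ 1 → h ∉ B := by
    intro h hh h1 hB
    exact h1 (dis' h hh (hLB h (mem_inf.1 hh).2 hB))
  have fr := Frob (G := L) (H0 := H ⊓ L) (C0 := C) inf_le_right hCL cL.le dis'
    (fun h hh h1 d hd hc => b.ti h (hnB h hh h1) d hd hc)
  have hVn : (H ⊓ L).Normal := by
    refine ⟨fun x hx g => ?_⟩
    by_contra hn
    obtain ⟨h, hh, d, hd, hd1, e⟩ := fr (g * x * g⁻¹) (hLn.conj_mem _ (mem_inf.1 hx).2 g) hn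
    refine hd1 (b.HconjC (h := x) (g := g⁻¹ * h) (mem_inf.1 hx).1 hd ?_)
    rw [conjC, ← e]; group
  have sq := b.sqA hVn (fun x hx => b.toPair.sq (mem_inf.1 hx).1)
  have cm : ∀ x ∈ H ⊓ L, ∀ y ∈ H ⊓ L, x * y = y * x := fun x hx y hy =>
    comm_of_sq (sq x hx) (sq y hy) (sq _ (mul_mem hx hy))
  have huV : a ^ 2 ∈ H ⊓ L := mem_inf.2 ⟨pow_mem (b.AH haA) 2, by
    rw [MonoidHom.mem_ker, map_pow, sa]; decide⟩
  refine ⟨a ^ 2, pow_mem haA 2, ha2, by rw [← pow_mul]; exact ha4, ?_, ?_⟩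
  · intro x hx
    have : closure {y | ∃ d ∈ C, y = d * a ^ 2 * d⁻¹} ≤ H ⊓ L := by
      rw [closure_le]
      rintro _ ⟨d, hd, rfl⟩
      exact hVn.conj_mem _ huV d
    rw [sq x (this hx)]; exact one_mem _
  · have h1 := hVn.conj_mem _ huV c
    have h2 := hVn.conj_mem _ huV (c ^ 2)
    generalize a ^ 2 = u at *
    have hw : u * (c * u * c⁻¹) * (c ^ 2 * u * (c ^ 2)⁻¹) ∈ H ⊓ L := mul_mem (mul_mem huV h1) h2
    have hcw : c * (u * (c * u * c⁻¹) * (c ^ 2 * u * (c ^ 2)⁻¹)) * c⁻¹ = u * (c * u * c⁻¹) * (c ^ 2 * u * (c ^ 2)⁻¹) := by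
      have e3 : c * (c ^ 2 * u * (c ^ 2)⁻¹) * c⁻¹ = u := by
        rw [← conjC, ← pow_succ', hc3]; simp
      have e2 : c * (c * u * c⁻¹) * c⁻¹ = c ^ 2 * u * (c ^ 2)⁻¹ := by
        rw [← conjC, ← pow_two]
      rw [conjM, conjM, e3, e2, mul_assoc u, cm u huV _ (mul_mem h1 h2)]
    by_contra hn
    refine hc1 (b.ti _ (hnB _ hw (fun h => hn (by rw [h]; exact one_mem _))) c hcC ?_)
    rw [conj_iff_comm.2 (conj_iff_comm.1 hcw).symm]; exact hcC

theorem lift_max {K L : Subgroup X} {Y : Type u} [Group Y] {f : L →* Y} (hs : Function.Surjective f)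
    (hf : ∀ x, f x = 1 → (x : X) ∈ K) (hKL : K ≤ L)
    (hmax : ∀ E, K ≤ E → E ≤ L → E = K ∨ E = L) :
    ∀ E : Subgroup Y, (K.subgroupOf L).map f ≤ E → E = (K.subgroupOf L).map f ∨ E = ⊤ := by
  intro E hE
  have hm : ∀ x : L, (x : X) ∈ (E.comap f).map L.subtype ↔ f x ∈ E := by
    intro x
    constructor
    · rintro ⟨y, hy, e⟩
      rw [← show y = x from Subtype.ext e]; exact hy
    · intro h; exact ⟨x, h, rfl⟩
  have h1 : K ≤ (E.comap f).map L.subtype := by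
    intro x hx
    exact (hm ⟨x, hKL hx⟩).2 (hE ⟨⟨x, hKL hx⟩, hx, rfl⟩)
  have h2 : (E.comap f).map L.subtype ≤ L := by
    rintro _ ⟨x, _, rfl⟩
    exact x.2
  rcases hmax ((E.comap f).map L.subtype) h1 h2 with h | h
  · left
    refine le_antisymm (fun y hy => ?_) hE
    obtain ⟨x, rfl⟩ := hs y
    have := (hm x).2 hy
    rw [h] at this
    exact ⟨x, this, rfl⟩
  · right
    rw [eq_top_iff]
    intro y _
    obtain ⟨x, rfl⟩ := hs y
    exact (hm x).1 (by rw [h]; exact x.2)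

theorem covBy_max {K L : Subgroup X} (h : K ⋖ L) : ∀ E, K ≤ E → E ≤ L → E = K ∨ E = L := by
  intro E h1 h2
  exact h.eq_or_eq h1 h2

theorem main_aux (n : ℕ) : ∀ (X : Type u) [Group X] [Finite X], Nat.card X = n →
    ∀ A H C : Subgroup X, Sys A H C → Concl A C := by
  induction n using Nat.strong_induction_on with
  | _ n ihn =>
  intro X _ _ hn A H C p
  have ih : IH.{u} (Nat.card X) := by
    intro Y _ _ hY A H C q
    exact ihn _ (hn ▸ hY) Y rfl A H C q
  clear ihn
  obtain ⟨c, hc⟩ := p.gC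
  have hcC : c ∈ C := hc ▸ mem_zpowers c
  by_cases hA : A = ⊥
  · left
    have hcA : Nat.card A = 1 := by rw [hA]; simp
    refine ⟨hcA, ?_⟩
    have hCn : C.Normal := by
      obtain ⟨z, hz, hzA⟩ := p.ex
      refine normal_of_two (a := z) (fun x => ?_)
      obtain ⟨h, hh, d, hd, rfl⟩ := p.HC x
      by_cases hhA : h ∈ A
      · left; rw [hA, mem_bot] at hhA; rw [hhA, one_mul]; exact hd
      · right
        have := p.two _ (inv_mem hz) _ hh (fun h => hzA (inv_mem_iff.1 h)) hhA
        rw [hA, mem_bot] at this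
        rw [← mul_assoc, this, one_mul]; exact hd
    rw [p.core C le_rfl hCn]; simp
  have hCtop : C < ⊤ := by
    rw [lt_top_iff_ne_top]
    intro h
    exact hA (eq_bot_iff.2 fun x hx => p.dis x (p.AH hx) (h ▸ mem_top x))
  have con2 : Cond2 A C c → Concl A C := by
    intro h
    obtain ⟨h1 | h1, h2, h3⟩ := lemma3 p hc h
    · exact Or.inr (Or.inr (Or.inl ⟨h1, h2, h3⟩))
    · exact Or.inr (Or.inr (Or.inr (Or.inr (Or.inl ⟨h1, h2, h3⟩))))
  have mapC : ∀ (L : Subgroup X) (hL : c ∈ L) (Y : Type u) [Group Y] (f : L →* Y),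
      (C.subgroupOf L).map f = zpowers (f ⟨c, hL⟩) := by
    intro L hL Y _ f
    rw [← MonoidHom.map_zpowers]
    congr 1
    ext x
    rw [mem_subgroupOf, hc, mem_zpowers_iff, mem_zpowers_iff]
    constructor
    · rintro ⟨j, hj⟩; exact ⟨j, Subtype.ext hj⟩
    · rintro ⟨j, hj⟩; exact ⟨j, congrArg Subtype.val hj⟩
  obtain ⟨B, hCB, _⟩ := exists_covBy_le_of_lt hCtop
  have hBC : ¬ B ≤ C := fun h => hCB.lt.not_ge h
  by_cases hAB : ∃ x ∈ A, x ∈ B ∧ x ≠ 1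
  · obtain ⟨x, hxA, hxB, hx1⟩ := hAB
    obtain ⟨Y, _, _, f, hs, hf, q⟩ := p.reduction hCB.le hBC
    have hcB := hCB.le hcC
    have hA' : (A.subgroupOf B).map f ≠ ⊥ := by
      intro h
      have h1 : f ⟨x, hxB⟩ ∈ (A.subgroupOf B).map f := ⟨_, hxA, rfl⟩
      rw [h, mem_bot] at h1
      exact hx1 (p.dis x (p.AH hxA) (hf _ h1))
    have := lemma1 q hA' (lift_max hs hf hCB.le (covBy_max hCB)) (mapC B hcB Y f)
    exact con2 (Cond2_lift p.toPSys hCB.le hf hcB this)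
  · push Not at hAB
    obtain ⟨z, hzB, hzH, hzA⟩ : ∃ z ∈ B, z ∈ H ∧ z ∉ A := by
      by_contra h
      push Not at h
      exact hBC (p.P B hCB.le h)
    have hz2 : z * z = 1 := hAB _ (p.two z hzH z hzH hzA hzA) (mul_mem hzB hzB)
    have hzC : z ∉ C := fun h => hzA (p.dis z hzH h ▸ one_mem _)
    have hBf : ∀ x ∈ B, x ∈ C ∨ ∃ d ∈ C, x = z * d := by
      intro x hx
      obtain ⟨h, hh, d, hd, rfl⟩ := p.HC x
      have hhB := (mul_mem_cancel_right (hCB.le hd)).1 hx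
      by_cases hhA : h ∈ A
      · left; rw [hAB h hhA hhB, one_mul]; exact hd
      · right
        have h1 := hAB _ (p.two h hh z hzH hhA hzA) (mul_mem hhB hzB)
        have : h = z := by
          rw [mul_eq_one_iff_eq_inv] at h1
          rw [h1]; exact inv_eq_of_mul_eq_one_left hz2
        exact ⟨d, hd, by rw [this]⟩
    have pB : Pair C B := by
      refine ⟨p.gC, hCB.le, ⟨z, hzB, hzC⟩, ?_⟩
      intro x hx y hy hxC hyC
      obtain ⟨d, hd, rfl⟩ := (hBf x hx).resolve_left hxC
      obtain ⟨d', hd', rfl⟩ := (hBf y hy).resolve_left hyC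
      rcases hBf (z * d * (z * d')) (mul_mem hx hy) with h | ⟨d'', hd'', e⟩
      · exact h
      · exfalso
        rw [mul_assoc] at e
        have e := mul_left_cancel e
        have h1 : d * (z * d') ∈ C := e ▸ hd''
        exact hyC ((mul_mem_cancel_left hd).1 h1)
    have hBtop : B < ⊤ := by
      rw [lt_top_iff_ne_top]
      intro h
      exact hA (eq_bot_iff.2 fun x hx => hAB x hx (h ▸ mem_top x))
    obtain ⟨L, hBL, _⟩ := exists_covBy_le_of_lt hBtop
    have hCL : C ≤ L := hCB.le.trans hBL.le
    have hLC : ¬ L ≤ C := fun h => hBC (hBL.le.trans h)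
    obtain ⟨Y, _, _, f, hs, hf, q⟩ := p.reduction hCL hLC
    have pr := p.toPSys.restrict hCL hLC
    have hcL := hCL hcC
    have ihY : IH.{u} (Nat.card Y) := by
      intro Z _ _ hZ
      refine ih Z (lt_of_lt_of_le hZ ?_)
      exact (Nat.card_le_card_of_surjective f hs).trans (Nat.card_le_card_of_injective _ L.subtype_injective)
    have b : Beta ((A.subgroupOf L).map f) ((H.subgroupOf L).map f) ((C.subgroupOf L).map f) ((B.subgroupOf L).map f) := by
      refine ⟨q, ⟨q.gC, ?_, ?_, ?_⟩, ?_, ?_, ?_, ?_⟩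
      · exact Subgroup.map_mono (fun x hx => hCB.le hx)
      · refine ⟨f ⟨z, hBL.le hzB⟩, ⟨_, hzB, rfl⟩, fun h => hzC ((liftC_iff hf).1 h)⟩
      · rintro _ ⟨x, hx, rfl⟩ _ ⟨y, hy, rfl⟩ h1 h2
        rw [liftC_iff hf] at h1 h2
        rw [← map_mul, liftC_iff hf]
        exact pB.two x hx y hy h1 h2
      · rintro _ ⟨x, hx, rfl⟩ ⟨y, hy, e⟩
        have h1 : f (y⁻¹ * x) = 1 := by rw [map_mul, map_inv, e, inv_mul_cancel]
        have h2 : (y⁻¹ * x : L) ∈ B.subgroupOf L := hCB.le (hf _ h1)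
        have h3 : x ∈ B.subgroupOf L := (mul_mem_cancel_left (inv_mem hy)).1 h2
        rw [show x = 1 from Subtype.ext (hAB x hx h3), map_one]
      · refine ⟨f ⟨z, hBL.le hzB⟩, ⟨_, hzB, rfl⟩, ⟨_, hzH, rfl⟩, fun h => hzA ?_⟩
        exact (pr.mapA_iff f hf (x := ⟨z, hBL.le hzB⟩) hzH).1 h
      · exact lift_max hs (fun x hx => hCB.le (hf x hx)) hBL.le (covBy_max hBL)
      · intro hbot
        have hAL : ∀ x ∈ A, x ∈ L → x = 1 := by
          intro x hx hxL
          have h1 : f ⟨x, hxL⟩ ∈ (A.subgroupOf L).map f := ⟨_, hx, rfl⟩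
          rw [hbot, mem_bot] at h1
          exact p.dis x (p.AH hx) (hf _ h1)
        refine hBL.lt.not_ge (fun x hx => ?_)
        obtain ⟨h, hh, d, hd, rfl⟩ := p.HC x
        have hhL := (mul_mem_cancel_right (hCL hd)).1 hx
        refine mul_mem ?_ (hCB.le hd)
        by_cases hhA : h ∈ A
        · rw [hAL h hhA hhL]; exact one_mem _
        · have h1 := hAL _ (p.two h hh z hzH hhA hzA) (mul_mem hhL (hBL.le hzB))
          exact (mul_mem_cancel_right hzB).1 (h1 ▸ one_mem _)
    have hgen := mapC L hcL Y f
    rcases b.beta ihY with ⟨h1, h2⟩ | ⟨h1, h2⟩ | ⟨h1, h2⟩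
    · have := CondD8_lift p.toPSys hCL hf hcL (condD8_of q h1 h2 hgen)
      rcases lemma5 p hc this with h | h
      · exact Or.inr (Or.inl h)
      · exact Or.inr (Or.inr (Or.inr (Or.inr (Or.inr h))))
    · have h4 : f ⟨c, hcL⟩ ^ 4 = 1 := by
        have h3 : f ⟨c, hcL⟩ ∈ (C.subgroupOf L).map f := ⟨_, hcC, rfl⟩
        have := pow_card_mem h3
        rwa [h2] at this
      have h5 : f ⟨c, hcL⟩ ≠ 1 := by
        intro h
        rw [hgen, h, zpowers_one_eq_bot] at h2
        simp at h2
      obtain ⟨s, hs1, hs2, hs3, hs4, hs5, hs6⟩ := Cond34_lift p.toPSys hCL hf hs q hc hcL h4 h5 (cond34_of q h1 h2 hgen)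
      exact Or.inr (Or.inr (Or.inr (Or.inl (lemma4 p hc hs1 hs2 hs3 hs4 hs5 hs6))))
    · exact con2 (Cond2_lift p.toPSys hCL hf hcL (b.cond2 h1 h2 hgen))

theorem main [Finite X] (p : Sys A H C) : Concl A C := main_aux _ X rfl A H C p

end SD

namespace SD
universe u
set_option linter.unusedVariables false
set_option linter.style.multiGoal false
set_option linter.unusedSimpArgs false
variable {X : Type u} [Group X] {A H C : Subgroup X} {c : X}

theorem dihedral_iso [Finite X] {r s : X} (hr4 : r ^ 4 = 1) (hr2 : r ^ 2 ≠ 1) (hs : s * s = 1)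
    (hsr : s * r * s⁻¹ = r⁻¹) (hX : Nat.card X = 8) : Nonempty (X ≃* DihedralGroup 4) := by
  have hs' : s⁻¹ = s := inv_eq_of_mul_eq_one_left hs
  have ho : orderOf r = 4 := by
    have := orderOf_eq_prime_pow (x := r) (p := 2) (n := 1) (by simpa using hr2) (by simpa using hr4)
    simpa using this
  have hk : ∀ k : ℤ, s * r ^ k = r ^ (-k) * s := by
    intro k
    have h1 : s * r ^ k * s⁻¹ = r ^ (-k) := by rw [← conj_zpow, hsr, inv_zpow, zpow_neg]
    rw [← h1]; group
  have hsr' : s ∉ zpowers r := by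
    rintro ⟨k, rfl⟩
    have h1 : r = r⁻¹ := by
      rw [← hsr]
      simp only
      group
    apply hr2
    rw [pow_two]
    nth_rewrite 1 [h1]
    simp
  let F : ZMod 4 → X := fun i => r ^ (i.val : ℤ)
  have hF : ∀ (i : ZMod 4) (k : ℤ), (k : ZMod 4) = i → F i = r ^ k := by
    intro i k h
    change r ^ (i.val : ℤ) = r ^ k
    rw [zpow_eq_zpow_iff_modEq, ho]
    have : ((i.val : ℤ) : ZMod 4) = (k : ZMod 4) := by rw [h]; simp
    exact (ZMod.intCast_eq_intCast_iff _ _ 4).1 this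
  have hv : ∀ i : ZMod 4, (((i.val : ℕ) : ℤ) : ZMod 4) = i := by intro i; simp
  have hadd : ∀ i j, F (i + j) = F i * F j := by
    intro i j
    rw [hF (i + j) (i.val + j.val) (by push_cast [hv]; simp), zpow_add]
  have hsub : ∀ i j, F (i - j) = r ^ (-(j.val : ℤ)) * F i := by
    intro i j
    rw [hF (i - j) (-(j.val) + i.val) (by push_cast; simp; ring), zpow_add]
  let f : DihedralGroup 4 →* X :=
    { toFun := fun x => match x with
        | .r i => F i
        | .sr i => s * F i
      map_one' := by
        change F 0 = 1
        rw [hF 0 0 (by simp)]; simp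
      map_mul' := by
        rintro (i | i) (j | j)
        · exact hadd i j
        · change s * F (j - i) = F i * (s * F j)
          rw [hsub, ← mul_assoc, ← mul_assoc, hk]; simp [F]
        · change s * F (i + j) = s * F i * F j
          rw [hadd, mul_assoc]
        · change F (j - i) = s * F i * (s * F j)
          rw [hsub, hk i.val, mul_assoc, ← mul_assoc s s, hs, one_mul] }
  have hinj : Function.Injective f := by
    rw [injective_iff_map_eq_one]
    rintro (i | i) h
    · change r ^ (i.val : ℤ) = 1 at h
      rw [zpow_natCast, ← orderOf_dvd_iff_pow_eq_one, ho] at h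
      have h1 := ZMod.val_lt i
      have : i.val = 0 := Nat.eq_zero_of_dvd_of_lt h h1
      rw [(ZMod.val_eq_zero i).1 this]; rfl
    · exfalso
      change s * r ^ (i.val : ℤ) = 1 at h
      apply hsr'
      rw [mul_eq_one_iff_eq_inv] at h
      rw [h]
      exact inv_mem (zpow_mem (mem_zpowers r) _)
  have hb : Function.Bijective f := by
    rw [Nat.bijective_iff_injective_and_card]
    exact ⟨hinj, by rw [hX, DihedralGroup.nat_card]⟩
  exact ⟨(MulEquiv.ofBijective f hb).symm⟩

theorem D8_iso [Finite X] (p : Sys A H C) (hA : Nat.card A = 2) (hC : Nat.card C = 2) :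
    Nonempty (X ≃* DihedralGroup 4) := by
  obtain ⟨c, hc⟩ := p.gC
  obtain ⟨u, v, w, k⟩ := lemma5a p hc (condD8_of p hA hC hc)
  have hX := p.toPSys.card
  rw [hA, hC] at hX
  have hc2 : c * c = 1 := by
    have := pow_card_mem (show c ∈ C from hc ▸ mem_zpowers c)
    rwa [hC, pow_two] at this
  have hci : c⁻¹ = c := inv_eq_of_mul_eq_one_left hc2
  have hr2 : (u * c) ^ 2 = w := by
    have h1 : (u * c) ^ 2 = u * (c * u * c⁻¹) * (c * c) := by rw [pow_two]; group
    rw [h1, k.cu, hc2, mul_one, k.hw]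
  refine dihedral_iso (r := u * c) (s := c) ?_ ?_ hc2 ?_ hX
  · rw [show 4 = 2 * 2 from rfl, pow_mul, hr2, k.hw2]
  · rw [hr2]; exact k.hw1
  · rw [mul_inv_rev, hci, sq_eq_one_iff' k.hu2, mul_assoc, mul_assoc, hc2, mul_one]

theorem iso_S4 [Finite X] (h : Emb4 X) (hX : Nat.card X = 24) : Nonempty (X ≃* Equiv.Perm (Fin 4)) := by
  obtain ⟨f, hf⟩ := h
  refine ⟨MulEquiv.ofBijective f ?_⟩
  rw [Nat.bijective_iff_injective_and_card]
  refine ⟨hf, ?_⟩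
  rw [hX, Nat.card_perm, Nat.card_fin]; rfl

theorem iso_A4 [Finite X] (h : Emb4 X) (hX : Nat.card X = 12) : Nonempty (X ≃* alternatingGroup (Fin 4)) := by
  obtain ⟨f, hf⟩ := h
  have e := MonoidHom.ofInjective hf
  have h1 : Nat.card f.range = 12 := by rw [← hX]; exact (Nat.card_congr e.toEquiv).symm
  have h2 := f.range.card_mul_index
  rw [h1, Nat.card_perm, Nat.card_fin, show Nat.factorial 4 = 24 from rfl] at h2
  have h3 : f.range = alternatingGroup (Fin 4) :=
    Equiv.Perm.eq_alternatingGroup_of_index_eq_two (by omega)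
  exact ⟨e.trans (MulEquiv.subgroupCongr h3)⟩

theorem sd_facts [Finite X] {n : ℕ} (hn : 2 ≤ n) {a b : X}
    (ha : orderOf a = 4 * n) (hb : orderOf b = 2)
    (hab : b⁻¹ * a * b = a ^ (2 * n - 1))
    (hG : Nat.card (closure ({a, b} : Set X)) = 8 * n) :
    Pair (zpowers a) (closure ({a, b} : Set X)) ∧
    ∀ h ∈ closure ({a, b} : Set X), h ∉ zpowers a → ∀ x ∈ zpowers a, h * x ^ 2 * h⁻¹ = (x ^ 2)⁻¹ := by
  have haH : a ∈ closure ({a, b} : Set X) := subset_closure (by simp)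
  have hbH : b ∈ closure ({a, b} : Set X) := subset_closure (by simp)
  have hAH : zpowers a ≤ closure ({a, b} : Set X) := by rwa [zpowers_le]
  have hb2 : b * b = 1 := by rw [← pow_two, ← hb, pow_orderOf_eq_one]
  have hbi : b⁻¹ = b := inv_eq_of_mul_eq_one_left hb2
  have hbA : b ∉ zpowers a := by
    intro h
    have h1 : closure ({a, b} : Set X) ≤ zpowers a := by
      rw [closure_le]
      rintro x (rfl | rfl)
      · exact mem_zpowers _
      · exact h
    have h2 := Subgroup.card_le_of_le h1
    rw [hG, Nat.card_zpowers, ha] at h2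
    omega
  have hidx : ((zpowers a).subgroupOf (closure ({a, b} : Set X))).index = 2 := by
    have h1 := ((zpowers a).subgroupOf (closure ({a, b} : Set X))).card_mul_index
    rw [Nat.card_congr (subgroupOfEquivOfLe hAH).toEquiv, hG, Nat.card_zpowers, ha] at h1
    have : 4 * n * 2 = 8 * n := by ring
    rw [← this] at h1
    exact Nat.eq_of_mul_eq_mul_left (by omega) h1
  have htwo : ∀ x ∈ closure ({a, b} : Set X), ∀ y ∈ closure ({a, b} : Set X),
      x ∉ zpowers a → y ∉ zpowers a → x * y ∈ zpowers a := by
    intro x hx y hy h1 h2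
    have := (mul_mem_iff_of_index_two hidx (a := ⟨x, hx⟩) (b := ⟨y, hy⟩)).2
      ⟨fun h => absurd h h1, fun h => absurd h h2⟩
    exact this
  refine ⟨⟨⟨a, rfl⟩, hAH, ⟨b, hbH, hbA⟩, htwo⟩, ?_⟩
  intro h hh hhA x hx
  have h1 := htwo h hh b hbH hhA hbA
  obtain ⟨k, rfl⟩ := hx
  have h2 : b * (a ^ k) ^ 2 * b⁻¹ = ((a ^ k) ^ 2)⁻¹ := by
    have h3 : b * a * b⁻¹ = a ^ (2 * n - 1) := by rw [← hab, hbi]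
    rw [← conj_pow, ← conj_zpow, h3, eq_inv_iff_mul_eq_one, ← zpow_natCast a, ← zpow_mul, ← zpow_natCast,
      ← zpow_mul, ← zpow_natCast (a ^ k), ← zpow_mul, ← zpow_add]
    have h4 : (((2 * n - 1 : ℕ) : ℤ) * k * (2 : ℕ) + k * (2 : ℕ)) = ((4 * n : ℕ) : ℤ) * k := by
      rw [Nat.cast_sub (by omega)]; push_cast; ring
    rw [h4, ← ha, zpow_mul, zpow_natCast, pow_orderOf_eq_one, one_zpow]
  obtain ⟨j, hj⟩ := h1
  have h5 : h = a ^ j * b := by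
    have : a ^ j = h * b := hj
    rw [this, mul_assoc, hb2, mul_one]
  rw [h5]
  simp only at *
  rw [conjC, h2]
  rw [← zpow_natCast, ← zpow_mul, ← zpow_neg, ← zpow_neg, ← zpow_add, ← zpow_add]
  congr 1
  ring

end SD

namespace SD
universe u
set_option linter.unusedVariables false
set_option linter.style.multiGoal false
set_option linter.unusedSimpArgs false
variable {X : Type u} [Group X] {A H C M : Subgroup X} {c : X}

/-- the situation of the theorem, in subgroup language -/
structure Setup {X : Type u} [Group X] (A H C M : Subgroup X) : Prop where
  pair : Pair A H
  inv : ∀ h ∈ H, h ∉ A → ∀ x ∈ A, h * x ^ 2 * h⁻¹ = (x ^ 2)⁻¹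
  gC : ∃ c, C = zpowers c
  HC : ∀ x : X, ∃ h ∈ H, ∃ d ∈ C, x = h * d
  dis : ∀ x, x ∈ H → x ∈ C → x = 1
  CM : C ≤ M
  sub : ∀ x ∈ M, ∃ y ∈ A, ∃ d ∈ C, x = y * d
  max : ∀ L : Subgroup X, C ≤ L → (∀ x ∈ L, ∃ y ∈ A, ∃ d ∈ C, x = y * d) → L ≤ M

namespace Setup

theorem HM (s : Setup A H C M) {x : X} (hH : x ∈ H) (hM : x ∈ M) : x ∈ A := by
  obtain ⟨y, hy, d, hd, rfl⟩ := s.sub x hM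
  have h1 := s.dis d ((mul_mem_cancel_left (s.pair.AH hy)).1 hH) hd
  rw [h1, mul_one]; exact hy

theorem AM [Finite X] (s : Setup A H C M) {x : X} (hA : x ∈ A) (hM : x ∈ M) : x ∈ M.normalCore := by
  intro g
  obtain ⟨h, hh, d, hd, e⟩ := s.HC g⁻¹
  have hg : g = d⁻¹ * h⁻¹ := by rw [← mul_inv_rev, ← e, inv_inv]
  rw [hg, conjC]
  have h1 : h⁻¹ * x * h⁻¹⁻¹ ∈ A ⊓ M := by
    apply cyc_conj s.pair.gA inf_le_left (mem_inf.2 ⟨hA, hM⟩)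
    exact s.pair.normal (inv_mem hh) hA
  exact mul_mem (mul_mem (s.CM (inv_mem hd)) (mem_inf.1 h1).2) (inv_mem (s.CM (inv_mem hd)))

theorem mem_q {K N : Subgroup X} [N.Normal] {x : X} (h : (QuotientGroup.mk' N) x ∈ K.map (QuotientGroup.mk' N)) :
    ∃ y ∈ K, ∃ z ∈ N, x = y * z := by
  obtain ⟨y, hy, e⟩ := h
  exact ⟨y, hy, y⁻¹ * x, QuotientGroup.eq.1 e, by group⟩

theorem one_q {N : Subgroup X} [N.Normal] {x : X} : (QuotientGroup.mk' N) x = 1 ↔ x ∈ N :=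
  QuotientGroup.eq_one_iff x

theorem HqA (s : Setup A H C M) {x : X} (hx : x ∈ H)
    (h : (QuotientGroup.mk' M.normalCore) x ∈ A.map (QuotientGroup.mk' M.normalCore)) : x ∈ A := by
  obtain ⟨y, hy, z, hz, rfl⟩ := mem_q h
  refine mul_mem hy (s.HM ((mul_mem_cancel_left (s.pair.AH hy)).1 hx) (normalCore_le M hz))

theorem qCM (s : Setup A H C M) {x : X}
    (h : (QuotientGroup.mk' M.normalCore) x ∈ C.map (QuotientGroup.mk' M.normalCore)) : x ∈ M := by
  obtain ⟨y, hy, z, hz, rfl⟩ := mem_q h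
  exact mul_mem (s.CM hy) (normalCore_le M hz)

theorem sys [Finite X] (s : Setup A H C M) :
    Sys (A.map (QuotientGroup.mk' M.normalCore)) (H.map (QuotientGroup.mk' M.normalCore))
      (C.map (QuotientGroup.mk' M.normalCore)) := by
  have hsurj := QuotientGroup.mk'_surjective M.normalCore
  refine ⟨⟨⟨?_, map_mono s.pair.AH, ?_, ?_⟩, ?_, ?_, ?_, ?_, ?_⟩, ?_⟩
  · obtain ⟨a, rfl⟩ := s.pair.gA
    exact ⟨_, MonoidHom.map_zpowers _ _⟩
  · obtain ⟨z, hz, hzA⟩ := s.pair.ex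
    exact ⟨_, mem_map_of_mem _ hz, fun h => hzA (s.HqA hz h)⟩
  · rintro _ ⟨x, hx, rfl⟩ _ ⟨y, hy, rfl⟩ h1 h2
    rw [← map_mul]
    exact mem_map_of_mem _ (s.pair.two x hx y hy (fun h => h1 (mem_map_of_mem _ h)) (fun h => h2 (mem_map_of_mem _ h)))
  · obtain ⟨a, rfl⟩ := s.gC
    exact ⟨_, MonoidHom.map_zpowers _ _⟩
  · rintro _ ⟨h, hh, rfl⟩ h1 _ ⟨x, hx, rfl⟩
    have := s.inv h hh (fun h => h1 (mem_map_of_mem _ h)) x hx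
    simpa using congrArg (QuotientGroup.mk' M.normalCore) this
  · intro x
    obtain ⟨x, rfl⟩ := hsurj x
    obtain ⟨h, hh, d, hd, rfl⟩ := s.HC x
    exact ⟨_, mem_map_of_mem _ hh, _, mem_map_of_mem _ hd, map_mul _ _ _⟩
  · rintro _ ⟨x, hx, rfl⟩ h
    have h1 := s.qCM h
    exact one_q.2 (s.AM (s.HM hx h1) h1)
  · intro L hCL hL x hx
    obtain ⟨x, rfl⟩ := hsurj x
    have h1 : L.comap (QuotientGroup.mk' M.normalCore) ≤ M := by
      apply s.max
      · intro d hd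
        exact hCL (mem_map_of_mem _ hd)
      · intro y hy
        obtain ⟨h, hh, d, hd, rfl⟩ := s.HC y
        refine ⟨h, ?_, d, hd, rfl⟩
        have h2 : QuotientGroup.mk' M.normalCore h ∈ L := by
          rw [mem_comap, map_mul] at hy
          exact (mul_mem_cancel_right (hCL (mem_map_of_mem _ hd))).1 hy
        exact s.HqA hh (hL _ h2 (mem_map_of_mem _ hh))
    have h2 : x ∈ M := h1 hx
    obtain ⟨y, hy, d, hd, rfl⟩ := s.sub x h2
    have h3 := s.AM hy ((mul_mem_cancel_right (s.CM hd)).1 h2)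
    rw [map_mul, one_q.2 h3, one_mul]
    exact mem_map_of_mem _ hd
  · intro E hE hEn
    rw [eq_bot_iff]
    intro x hx
    obtain ⟨x, rfl⟩ := hsurj x
    rw [mem_bot, one_q]
    have : (E.comap (QuotientGroup.mk' M.normalCore)).Normal := inferInstance
    refine (normal_le_normalCore (N := E.comap (QuotientGroup.mk' M.normalCore)) (H := M)).2 ?_ hx
    intro y hy
    exact s.qCM (hE hy)

theorem M_eq [Finite X] (s : Setup A H C M) {a : X} (hA : A = zpowers a) {i : ℕ}
    (hi : Nat.card (A.map (QuotientGroup.mk' M.normalCore)) = i) :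
    (M : Set X) = (zpowers (a ^ i) : Set X) * (C : Set X) := by
  subst hA
  rw [MonoidHom.map_zpowers, Nat.card_zpowers] at hi
  have h1 : a ^ i ∈ M.normalCore := by rw [← one_q, map_pow, ← hi, pow_orderOf_eq_one]
  ext x
  rw [Set.mem_mul]
  constructor
  · intro hx
    obtain ⟨y, hy, d, hd, rfl⟩ := s.sub x hx
    refine ⟨y, ?_, d, hd, rfl⟩
    have h3 := s.AM hy ((mul_mem_cancel_right (s.CM hd)).1 hx)
    obtain ⟨k, rfl⟩ := hy
    simp only at h3
    rw [← one_q, map_zpow, ← orderOf_dvd_iff_zpow_eq_one, hi] at h3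
    obtain ⟨j, rfl⟩ := h3
    exact ⟨j, by simp [zpow_mul]⟩
  · rintro ⟨y, hy, d, hd, rfl⟩
    exact mul_mem ((zpowers_le.2 (normalCore_le M h1)) hy) (s.CM hd)

theorem core_eq [Finite X] (s : Setup A H C M) {a c : X} (hA : A = zpowers a) (hC : C = zpowers c) {i k : ℕ}
    (hi : Nat.card (A.map (QuotientGroup.mk' M.normalCore)) = i)
    (hk : Nat.card (C.map (QuotientGroup.mk' M.normalCore)) = k) :
    (M.normalCore : Set X) = (zpowers (a ^ i) : Set X) * (zpowers (c ^ k) : Set X) := by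
  have hM := s.M_eq hA hi
  subst hA hC
  rw [MonoidHom.map_zpowers, Nat.card_zpowers] at hi hk
  have h1 : a ^ i ∈ M.normalCore := by rw [← one_q, map_pow, ← hi, pow_orderOf_eq_one]
  have h2 : c ^ k ∈ M.normalCore := by rw [← one_q, map_pow, ← hk, pow_orderOf_eq_one]
  ext x
  rw [Set.mem_mul]
  constructor
  · intro hx
    have hx' : x ∈ (M : Set X) := normalCore_le M hx
    rw [hM] at hx'
    obtain ⟨y, hy, d, hd, rfl⟩ := hx'
    refine ⟨y, hy, d, ?_, rfl⟩
    have h3 : d ∈ M.normalCore := (mul_mem_cancel_left ((zpowers_le.2 h1) hy)).1 hx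
    obtain ⟨j, rfl⟩ := hd
    simp only at h3
    rw [← one_q, map_zpow, ← orderOf_dvd_iff_zpow_eq_one, hk] at h3
    obtain ⟨j, rfl⟩ := h3
    exact ⟨j, by simp [zpow_mul]⟩
  · rintro ⟨y, hy, d, hd, rfl⟩
    exact mul_mem ((zpowers_le.2 h1) hy) ((zpowers_le.2 h2) hd)

end Setup

end SD

theorem stmt14 {X : Type*} [Group X] [Finite X] (n m : ℕ) (hn : 2 ≤ n) (hm : 2 ≤ m)
    (a b c : X)
    (ha : orderOf a = 4 * n) (hb : orderOf b = 2)
    (hab : b⁻¹ * a * b = a ^ (2 * n - 1))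
    (hG : Nat.card (closure ({a, b} : Set X)) = 8 * n)
    (hc : orderOf c = m)
    (hprod : (closure ({a, b} : Set X) : Set X) * (zpowers c : Set X) = Set.univ)
    (hint : closure ({a, b} : Set X) ⊓ zpowers c = ⊥)
    (M : Subgroup X)
    (hcM : zpowers c ≤ M)
    (hMsub : (M : Set X) ⊆ (zpowers a : Set X) * (zpowers c : Set X))
    (hMmax : ∀ M' : Subgroup X,
      zpowers c ≤ M' → (M' : Set X) ⊆ (zpowers a : Set X) * (zpowers c : Set X) → M' ≤ M) :
    ((M : Set X) = (zpowers a : Set X) * (zpowers c : Set X) ∧ M.normalCore = M ∧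
        Nonempty ((X ⧸ M.normalCore) ≃* Multiplicative (ZMod 2))) ∨
    ((M : Set X) = (zpowers (a ^ 2) : Set X) * (zpowers c : Set X) ∧
        (M.normalCore : Set X) = (zpowers (a ^ 2) : Set X) * (zpowers (c ^ 2) : Set X) ∧
        Nonempty ((X ⧸ M.normalCore) ≃* DihedralGroup 4)) ∨
    ((M : Set X) = (zpowers (a ^ 2) : Set X) * (zpowers c : Set X) ∧
        (M.normalCore : Set X) = (zpowers (a ^ 2) : Set X) * (zpowers (c ^ 3) : Set X) ∧
        Nonempty ((X ⧸ M.normalCore) ≃* alternatingGroup (Fin 4))) ∨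
    ((M : Set X) = (zpowers (a ^ 4) : Set X) * (zpowers c : Set X) ∧
        (M.normalCore : Set X) = (zpowers (a ^ 4) : Set X) * (zpowers (c ^ 3) : Set X) ∧
        Nonempty ((X ⧸ M.normalCore) ≃* Equiv.Perm (Fin 4))) ∨
    ((M : Set X) = (zpowers (a ^ 4) : Set X) * (zpowers c : Set X) ∧
        (M.normalCore : Set X) = (zpowers (a ^ 4) : Set X) * (zpowers (c ^ 4) : Set X) ∧
        Nat.card (X ⧸ M.normalCore) = 32 ∧
        ∃ N : Subgroup (X ⧸ M.normalCore), N.Normal ∧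
          Nonempty (N ≃* Multiplicative (ZMod 4 × ZMod 2)) ∧
          ∃ f : (X ⧸ M.normalCore) →* Multiplicative (ZMod 4),
            Function.Surjective f ∧ f.ker = N) ∨
    ((M : Set X) = (zpowers (a ^ 3) : Set X) * (zpowers c : Set X) ∧
        (M.normalCore : Set X) = (zpowers (a ^ 3) : Set X) * (zpowers (c ^ 4) : Set X) ∧
        Nonempty ((X ⧸ M.normalCore) ≃* Equiv.Perm (Fin 4))) := by 
  obtain ⟨hpair, hinv⟩ := SD.sd_facts hn ha hb hab hG
  have s : SD.Setup (zpowers a) (closure ({a, b} : Set X)) (zpowers c) M := by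
    refine ⟨hpair, hinv, ⟨c, rfl⟩, ?_, ?_, hcM, ?_, ?_⟩
    · intro x
      have hx : x ∈ (closure ({a, b} : Set X) : Set X) * (zpowers c : Set X) := by
        rw [hprod]; exact Set.mem_univ x
      obtain ⟨h, hh, d, hd, e⟩ := Set.mem_mul.1 hx
      exact ⟨h, hh, d, hd, e.symm⟩
    · intro x h1 h2
      have : x ∈ closure ({a, b} : Set X) ⊓ zpowers c := mem_inf.2 ⟨h1, h2⟩
      rwa [hint, mem_bot] at this
    · intro x hx
      obtain ⟨y, hy, d, hd, e⟩ := Set.mem_mul.1 (hMsub hx)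
      exact ⟨y, hy, d, hd, e.symm⟩
    · intro L hL h
      refine hMmax L hL (fun x hx => ?_)
      obtain ⟨y, hy, d, hd, e⟩ := h x hx
      exact Set.mem_mul.2 ⟨y, hy, d, hd, e.symm⟩
  have p := s.sys
  have hcard := p.toPSys.card
  rcases SD.main p with ⟨h1, h2⟩ | ⟨h1, h2⟩ | ⟨h1, h2, h3⟩ | ⟨h1, h2, h3⟩ | ⟨h1, h2, h3⟩ | ⟨h1, h2, h3⟩
  · left
    have e1 := s.M_eq rfl h1
    have e2 := s.core_eq rfl rfl h1 h2
    rw [pow_one] at e1 e2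
    rw [pow_one] at e2
    refine ⟨e1, SetLike.coe_injective (e2.trans e1.symm), ?_⟩
    rw [h1, h2] at hcard
    have : Fact (Nat.Prime 2) := ⟨Nat.prime_two⟩
    exact ⟨mulEquivOfPrimeCardEq (p := 2) (by simpa using hcard) (by simp)⟩
  · right; left
    exact ⟨s.M_eq rfl h1, s.core_eq rfl rfl h1 h2, SD.D8_iso p h1 h2⟩
  · right; right; left
    rw [h1, h2] at hcard
    exact ⟨s.M_eq rfl h1, s.core_eq rfl rfl h1 h2, SD.iso_A4 h3 hcard⟩
  · right; right; right; right; right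
    rw [h1, h2] at hcard
    exact ⟨s.M_eq rfl h1, s.core_eq rfl rfl h1 h2, SD.iso_S4 h3 hcard⟩
  · right; right; right; left
    rw [h1, h2] at hcard
    exact ⟨s.M_eq rfl h1, s.core_eq rfl rfl h1 h2, SD.iso_S4 h3 hcard⟩
  · right; right; right; right; left
    rw [h1, h2] at hcard
    exact ⟨s.M_eq rfl h1, s.core_eq rfl rfl h1 h2, hcard, h3⟩
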